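/- The only rational points on the smooth projective plane quartic curve C₃ : 3x³y + 2y³z + z³x = 0 are (1 : 0 : 0), (0 : 1 : 0), (0 : 0 : 1), and (1 : 1 : −1). Equivalently, every triple of coprime integers (x, y, z), not all zero, satisfying 3x³y + 2y³z + z³x = 0 equals ±(1,0,0), ±(0,1,0), ±(0,0,1), or ±(1,1,−1). -/

import Mathlib

section
open Polynomial NumberField

namespace C3

theorem irr : Irreducible (X ^ 7 - C 162 : ℚ[X]) := by
  apply X_pow_sub_C_irreducible_of_prime (by norm_num)
  intro b hb
  have h1 : (padicValRat 2 (b ^ 7)) = 1 := by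
    rw [hb]
    have : (162 : ℚ) = 2 * 81 := by norm_num
    rw [this, padicValRat.mul (by norm_num) (by norm_num)]
    have h2 : padicValRat 2 (2 : ℚ) = 1 := by
      exact_mod_cast padicValRat.self (p := 2) (by norm_num)
    have h3 : padicValRat 2 (81 : ℚ) = 0 := by
      have : padicValNat 2 81 = 0 := padicValNat.eq_zero_of_not_dvd (by norm_num)
      have h4 := padicValRat.of_nat (p := 2) (n := 81)
      rw [this] at h4
      exact_mod_cast h4
    rw [h2, h3]; rfl
  rw [padicValRat.pow] at h1
  omega

instance irrFact : Fact (Irreducible (X ^ 7 - C 162 : ℚ[X])) := ⟨irr⟩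

/-- The field of definition. -/
def L : Type := AdjoinRoot (X ^ 7 - C 162 : ℚ[X])

noncomputable instance : Field L := inferInstanceAs (Field (AdjoinRoot (X ^ 7 - C 162 : ℚ[X])))

theorem monicf : (X ^ 7 - C 162 : ℚ[X]).Monic := monic_X_pow_sub_C _ (by norm_num)

theorem natdeg : (X ^ 7 - C 162 : ℚ[X]).natDegree = 7 := natDegree_X_pow_sub_C

/-- the coefficient map -/
noncomputable def ofL : ℚ →+* L := AdjoinRoot.of (X ^ 7 - C 162 : ℚ[X])

instance : CharZero L := charZero_of_injective_ringHom ofL.injective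

/-- the uniformizer -/
noncomputable def p : L := AdjoinRoot.root (X ^ 7 - C 162 : ℚ[X])

theorem hp : p ^ 7 = 162 := by
  have h : AdjoinRoot.mk (X ^ 7 - C 162 : ℚ[X]) (X ^ 7 - C 162) = 0 := AdjoinRoot.mk_self
  simp only [map_sub, map_pow, AdjoinRoot.mk_X, AdjoinRoot.mk_C] at h
  have h2 := sub_eq_zero.1 h
  have h3 : ofL 162 = 162 := map_ofNat ofL 162
  exact Eq.trans h2 h3

theorem minpoly_p : minpoly ℚ p = X ^ 7 - C 162 := by
  symm
  apply minpoly.eq_of_irreducible_of_monic irr _ monicf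
  simp [hp]

theorem int_p : IsIntegral ℚ p := ⟨_, monicf, by simp [hp]⟩

theorem ex_poly (x : L) : ∃ f : ℚ[X], x = aeval p f := by
  obtain ⟨f, hf⟩ := AdjoinRoot.mk_surjective x
  refine ⟨f, ?_⟩
  have e : algebraMap ℚ L = ofL := RingHom.ext_rat _ _
  rw [aeval_def, e, ← hf]
  have := AdjoinRoot.eval₂_root (X ^ 7 - C 162 : ℚ[X])
  induction f using Polynomial.induction_on' generalizing x with
  | add f g h1 h2 => rw [eval₂_add, ← h1 _ rfl, ← h2 _ rfl]; exact map_add _ f g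
  | monomial n a =>
    rw [eval₂_monomial, ← C_mul_X_pow_eq_monomial]
    exact (map_mul _ _ _).trans (congrArg₂ (fun u v : L => u * v) rfl (map_pow _ _ _))

theorem adj_top : Algebra.adjoin ℚ {p} = ⊤ := by
  rw [eq_top_iff]
  intro x _
  obtain ⟨f, rfl⟩ := ex_poly x
  exact aeval_mem_adjoin_singleton ℚ p

noncomputable def pb : PowerBasis ℚ L := PowerBasis.ofAdjoinEqTop int_p adj_top

instance : FiniteDimensional ℚ L := pb.finite

instance : NumberField L where

theorem pb_gen : pb.gen = p := by simp [pb]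
theorem pb_dim : pb.dim = 7 := by
  rw [← pb.natDegree_minpoly, pb_gen, minpoly_p, natdeg]

theorem finrankL : Module.finrank ℚ L = 7 := by rw [pb.finrank, pb_dim]

theorem p_ne : p ≠ 0 := by
  intro h
  have := hp
  rw [h] at this
  norm_num at this

/-- real embedding -/
theorem real_root : ∃ r : ℝ, 0 < r ∧ r ^ 7 = 162 := by
  refine ⟨(162 : ℝ) ^ ((1 : ℝ) / 7), by positivity, ?_⟩
  rw [← Real.rpow_natCast, ← Real.rpow_mul (by norm_num)]
  norm_num

noncomputable def rr : ℝ := real_root.choose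

theorem rr_pos : 0 < rr := real_root.choose_spec.1
theorem rr_pow : rr ^ 7 = 162 := real_root.choose_spec.2

theorem rr_eval : (X ^ 7 - C 162 : ℚ[X]).eval₂ (algebraMap ℚ ℝ) rr = 0 := by
  simp [rr_pow]

noncomputable def σ : L →+* ℝ := AdjoinRoot.lift (algebraMap ℚ ℝ) rr rr_eval

theorem σp : σ p = rr := AdjoinRoot.lift_root rr_eval

theorem σ_inj : Function.Injective σ := σ.injective

/-- every element is a polynomial in p -/
theorem repr7 (x : L) : ∃ a : Fin 7 → ℚ, x = ∑ i, (a i : L) * p ^ (i : ℕ) := by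
  refine ⟨fun i => pb.basis.repr x (Fin.cast pb_dim.symm i), ?_⟩
  conv_lhs => rw [← pb.basis.sum_repr x]
  rw [← Equiv.sum_comp (finCongr pb_dim.symm)]
  refine Finset.sum_congr rfl fun i _ => ?_
  simp only [finCongr_apply, pb.coe_basis, pb_gen, Fin.val_cast]
  rw [Algebra.smul_def]
  simp

end C3
end

section
open Polynomial NumberField Matrix
namespace C3

theorem hom_ext {R : Type*} [CommRing R] [Algebra ℚ R] (f g : L →+* R) (h : f p = g p) : f = g := by
  refine RingHom.ext fun x => ?_
  obtain ⟨a, ha⟩ := repr7 x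
  rw [ha]
  have e : ∀ q : ℚ, f (q : L) = g (q : L) := fun q => by
    have := RingHom.ext_rat (f.comp (algebraMap ℚ L)) (g.comp (algebraMap ℚ L))
    simpa using congrArg (fun k : ℚ →+* R => k q) this
  simp [map_sum, h, e]

theorem nrReal : InfinitePlace.nrRealPlaces L = 1 := by
  have h0 : 0 < InfinitePlace.nrRealPlaces L :=
    InfinitePlace.nrRealPlaces_pos_of_odd_finrank (by rw [finrankL]; decide)
  have h1 : InfinitePlace.nrRealPlaces L ≤ 1 := by
    classical
    rw [← InfinitePlace.card_real_embeddings, Fintype.card_le_one_iff]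
    rintro ⟨f, hf⟩ ⟨g, hg⟩
    apply Subtype.ext
    apply hom_ext
    have key : ∀ f : L →+* ℂ, ComplexEmbedding.IsReal f → f p = (rr : ℂ) := by
      intro f hf
      have h2 : (starRingEnd ℂ) (f p) = f p := by
        have := congrArg (fun g : L →+* ℂ => g p) (ComplexEmbedding.isReal_iff.1 hf)
        simpa using this
      obtain ⟨r, hr⟩ := Complex.conj_eq_iff_real.1 h2
      have h3 : (f p) ^ 7 = 162 := by rw [← map_pow, hp]; exact map_ofNat f 162
      rw [hr] at h3 ⊢
      have h4 : r ^ 7 = 162 := by exact_mod_cast h3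
      have h5 : r = rr := (Odd.strictMono_pow (R := ℝ) (n := 7) (by decide)).injective (by
        simp only [h4, rr_pow])
      rw [h5]
    simp only
    rw [key f hf, key g hg]
  omega

theorem nrComplex : InfinitePlace.nrComplexPlaces L = 3 := by
  have := InfinitePlace.card_add_two_mul_card_eq_rank L
  rw [nrReal, finrankL] at this
  omega

theorem rankL : Units.rank L = 3 := by
  rw [Units.rank, InfinitePlace.card_eq_nrRealPlaces_add_nrComplexPlaces, nrReal, nrComplex]

theorem norm_p : Algebra.norm ℚ p = 162 := by
  have := Algebra.PowerBasis.norm_gen_eq_coeff_zero_minpoly pb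
  rw [pb_gen, pb_dim, minpoly_p] at this
  rw [this]; simp; norm_num

/-- integral elements -/
def jj : Fin 7 → ℕ := ![0, 0, 1, 1, 2, 2, 3]

noncomputable def om (i : Fin 7) : L := p ^ (i : ℕ) / 3 ^ (jj i)

theorem om_pow (i : Fin 7) : ∃ m : ℤ, om i ^ 7 = m := by
  have h : om i ^ 7 = 162 ^ (i : ℕ) / 3 ^ (7 * jj i) := by
    rw [om, div_pow, ← pow_mul, ← hp, ← pow_mul, ← pow_mul, mul_comm, mul_comm (jj i)]
  rw [h]
  fin_cases i
  · exact ⟨1, by norm_num [jj]⟩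
  · exact ⟨162, by norm_num [jj]⟩
  · exact ⟨12, by norm_num [jj]⟩
  · exact ⟨1944, by norm_num [jj]⟩
  · exact ⟨144, by norm_num [jj]⟩
  · exact ⟨23328, by norm_num [jj]⟩
  · exact ⟨1728, by norm_num [jj]⟩

theorem om_int (i : Fin 7) : IsIntegral ℤ (om i) := by
  obtain ⟨m, hm⟩ := om_pow i
  apply IsIntegral.of_pow (n := 7) (by norm_num)
  rw [hm]
  exact isIntegral_algebraMap (R := ℤ) (x := m)

/-- integral basis element as an algebraic integer -/
noncomputable def omO (i : Fin 7) : 𝓞 L := ⟨om i, om_int i⟩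

theorem omO_coe (i : Fin 7) : ((omO i : 𝓞 L) : L) = om i := rfl

theorem discr_om : Algebra.discr ℚ om = - (7 ^ 7 * 6 ^ 6) := by
  have h1 := Algebra.discr_powerBasis_eq_norm (K := ℚ) pb
  rw [pb_gen, finrankL, minpoly_p] at h1
  have h2 : Algebra.norm ℚ (aeval p (derivative (X ^ 7 - C 162 : ℚ[X]))) = 7 ^ 7 * 162 ^ 6 := by
    simp only [derivative_sub, derivative_X_pow, derivative_C, sub_zero, map_mul, aeval_C, map_pow, aeval_X]
    rw [Algebra.norm_algebraMap, norm_p, finrankL]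
    norm_num
  rw [h2] at h1
  have h3 : (fun i : Fin 7 => p ^ (i : ℕ)) = pb.basis ∘ (finCongr pb_dim).symm := by
    funext i; simp [pb_gen]
  have h4 : Algebra.discr ℚ (fun i : Fin 7 => p ^ (i : ℕ)) = Algebra.discr ℚ pb.basis := by
    rw [h3]; exact Algebra.discr_reindex ℚ pb.basis (finCongr pb_dim)
  have h5 : om = (Matrix.diagonal (fun i => (1 / 3 ^ jj i : ℚ))).map (algebraMap ℚ L) *ᵥ
      (fun i : Fin 7 => p ^ (i : ℕ)) := by
    funext i
    rw [Matrix.diagonal_map (by simp), Matrix.mulVec_diagonal]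
    simp [om, div_eq_inv_mul]
  rw [h5, Algebra.discr_of_matrix_mulVec, h4, h1, Matrix.det_diagonal]
  simp [Fin.prod_univ_succ, jj]
  norm_num

theorem discr_le : |NumberField.discr L| ≤ 7 ^ 7 * 6 ^ 6 := by
  classical
  let b := (RingOfIntegers.basis L)
  have hc : Fintype.card (Module.Free.ChooseBasisIndex ℤ (𝓞 L)) = 7 := by
    rw [← Module.finrank_eq_card_chooseBasisIndex, RingOfIntegers.rank, finrankL]
  let e : Fin 7 ≃ Module.Free.ChooseBasisIndex ℤ (𝓞 L) := (Fintype.equivFinOfCardEq hc).symm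
  let b' := b.reindex e.symm
  let bq : Module.Basis (Fin 7) ℚ L := (integralBasis L).reindex e.symm
  let M : Matrix (Fin 7) (Fin 7) ℤ := fun i j => b'.repr (omO i) j
  have h1 : om = (M.map (algebraMap ℤ ℚ)).map (algebraMap ℚ L) *ᵥ bq := by
    funext i
    have := congrArg (fun x : 𝓞 L => (x : L)) (b'.sum_repr (omO i))
    simp only [map_sum] at this
    rw [← omO_coe, ← this]
    simp [Matrix.mulVec, dotProduct, M, bq, b', b, integralBasis_apply]
    refine Finset.sum_congr rfl fun x _ => ?_
    have e2 : ∀ z : ℤ, (z : L) = (((z : ℤ) : ℚ) : L) := fun z => by simp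
    rw [e2]; rfl
  have h2 : Algebra.discr ℚ bq = NumberField.discr L := by
    rw [coe_discr]
    have := Algebra.discr_reindex ℚ (integralBasis L) e.symm
    rw [← this]
    congr 1
    funext i; simp [bq]
  have h3 := discr_om
  rw [h1, Algebra.discr_of_matrix_mulVec, h2] at h3
  have h4 : (M.map (algebraMap ℤ ℚ)).det = (M.det : ℚ) := by
    rw [← RingHom.mapMatrix_apply, ← RingHom.map_det]; simp
  rw [h4] at h3
  have h5 : M.det ^ 2 * NumberField.discr L = - (7 ^ 7 * 6 ^ 6) := by exact_mod_cast h3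
  have h6 : M.det ^ 2 ≠ 0 := by
    intro h; rw [h] at h5; norm_num at h5
  have h7 : 1 ≤ M.det ^ 2 := by have := sq_nonneg M.det; omega
  have h8 : |M.det ^ 2 * NumberField.discr L| = 7 ^ 7 * 6 ^ 6 := by rw [h5]; norm_num
  rw [abs_mul, abs_of_nonneg (sq_nonneg _)] at h8
  nlinarith [abs_nonneg (NumberField.discr L)]

end C3
end

section
open Polynomial NumberField Matrix
namespace C3

/-- matrix from a list of rows -/
def toM (n : ℕ) (l : List (List ℤ)) : Matrix (Fin n) (Fin n) ℤ :=
  Matrix.of fun i j => (l.getD i []).getD j 0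

/-- condensed row -/
def crow (a : ℤ) (r0 : List ℤ) (r : List ℤ) : List ℤ :=
  List.zipWith (fun x y => a * x - r.getD 0 0 * y) r.tail r0

def cnd : List (List ℤ) → List (List ℤ)
  | [] => []
  | r0 :: rs => rs.map (crow (r0.getD 0 0) r0.tail)

def ch : ℕ → List (List ℤ) → ℤ × ℤ
  | 0, _ => (1, 1)
  | n + 1, l => ((l.getD 0 []).getD 0 0 * (ch n (cnd l)).1, (l.getD 0 []).getD 0 0 ^ n * (ch n (cnd l)).2)

def wf (n : ℕ) (l : List (List ℤ)) : Prop := l.length = n ∧ ∀ r ∈ l, r.length = n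

theorem wf_cnd {n : ℕ} {l : List (List ℤ)} (h : wf (n + 1) l) : wf n (cnd l) := by
  obtain ⟨h1, h2⟩ := h
  cases l with
  | nil => simp at h1
  | cons r0 rs =>
    refine ⟨by simpa [cnd] using h1, ?_⟩
    intro r hr
    simp only [cnd, List.mem_map] at hr
    obtain ⟨s, hs, rfl⟩ := hr
    have e1 := h2 s (by simp [hs])
    have e2 := h2 r0 (by simp)
    simp [crow, e1, e2]

theorem chio (n : ℕ) (M : Matrix (Fin (n + 1)) (Fin (n + 1)) ℤ) :
    M 0 0 * (Matrix.of fun i j : Fin n => M 0 0 * M i.succ j.succ - M i.succ 0 * M 0 j.succ).det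
      = M 0 0 ^ n * M.det := by
  have h1 := Matrix.det_mul_column (Fin.cons 1 (fun _ => M 0 0) : Fin (n + 1) → ℤ) M
  rw [Fin.prod_univ_succ] at h1
  simp only [Fin.cons_zero, Fin.cons_succ, Finset.prod_const, Finset.card_univ, Fintype.card_fin,
    one_mul] at h1
  rw [← h1]
  rw [← Matrix.det_eq_of_forall_row_eq_smul_add_const (A := Matrix.of fun i j : Fin (n + 1) =>
    (Fin.cons 1 (fun _ => M 0 0) : Fin (n + 1) → ℤ) i * M i j -
     (Fin.cons 0 (fun i => M i.succ 0) : Fin (n + 1) → ℤ) i * M 0 j)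
     (c := fun i => -(Fin.cons 0 (fun i => M i.succ 0) : Fin (n + 1) → ℤ) i) (k := 0)]
  · rw [Matrix.det_succ_column_zero, Fin.sum_univ_succ]
    simp [mul_comm]
    left
    congr 1
    ext i j
    simp [mul_comm]
  · simp
  · intro i j
    simp; ring

theorem toM_cnd {n : ℕ} {l : List (List ℤ)} (h : wf (n + 1) l) :
    toM n (cnd l) = Matrix.of fun i j : Fin n => toM (n + 1) l 0 0 * toM (n + 1) l i.succ j.succ -
      toM (n + 1) l i.succ 0 * toM (n + 1) l 0 j.succ := by
  obtain ⟨h1, h2⟩ := h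
  cases l with
  | nil => simp at h1
  | cons r0 rs =>
    ext i j
    have hl : rs.length = n := by simpa using h1
    have hi : (i : ℕ) < rs.length := by rw [hl]; exact i.2
    have e1 := h2 rs[(i : ℕ)] (by simp)
    have e2 := h2 r0 (by simp)
    have hj : (j : ℕ) + 1 < n + 1 := by have := j.2; omega
    simp [toM, cnd, crow, e1, e2, hl, List.getD_eq_getElem?_getD, List.getElem?_zipWith]

theorem ch_spec (n : ℕ) : ∀ l, wf n l → (toM n l).det * (ch n l).2 = (ch n l).1 := by
  induction n with
  | zero => intro l _; simp [ch]
  | succ n ih =>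
    intro l h
    have h1 := ih _ (wf_cnd h)
    have h2 := chio n (toM (n + 1) l)
    rw [← toM_cnd h] at h2
    have h3 : toM (n + 1) l 0 0 = (l.getD 0 []).getD 0 0 := rfl
    rw [h3] at h2
    simp only [ch]
    rw [← h1]
    linear_combination -(ch n (cnd l)).2 * h2

end C3
end

section
open Polynomial NumberField Matrix
namespace C3

/-- integer vectors of length seven -/
structure V7 where
  (a b c d e f g : ℤ)

/-- the element with these coordinates in the basis `om` -/
noncomputable def V7.el (v : V7) : 𝓞 L :=
  v.a * omO 0 + v.b * omO 1 + v.c * omO 2 + v.d * omO 3 + v.e * omO 4 + v.f * omO 5 + v.g * omO 6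

/-- element in powers of p -/
noncomputable def V7.pe (v : V7) : L :=
  v.a + v.b * p + v.c * p ^ 2 + v.d * p ^ 3 + v.e * p ^ 4 + v.f * p ^ 5 + v.g * p ^ 6

def V7.sc (v : V7) : V7 := ⟨27 * v.a, 27 * v.b, 9 * v.c, 9 * v.d, 3 * v.e, 3 * v.f, v.g⟩

theorem V7.el_coe (v : V7) : 27 * (v.el : L) = v.sc.pe := by
  simp only [V7.el, V7.sc, V7.pe, map_add, map_mul, map_intCast, omO_coe, om, jj]
  push_cast
  simp
  ring

def V7.mat (v : V7) : List (List ℤ) :=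
  [[v.a, 162 * v.g, 162 * v.f, 162 * v.e, 162 * v.d, 162 * v.c, 162 * v.b],
   [v.b, v.a, 162 * v.g, 162 * v.f, 162 * v.e, 162 * v.d, 162 * v.c],
   [v.c, v.b, v.a, 162 * v.g, 162 * v.f, 162 * v.e, 162 * v.d],
   [v.d, v.c, v.b, v.a, 162 * v.g, 162 * v.f, 162 * v.e],
   [v.e, v.d, v.c, v.b, v.a, 162 * v.g, 162 * v.f],
   [v.f, v.e, v.d, v.c, v.b, v.a, 162 * v.g],
   [v.g, v.f, v.e, v.d, v.c, v.b, v.a]]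

theorem V7.wf_mat (v : V7) : wf 7 v.mat := by
  refine ⟨rfl, ?_⟩
  simp [V7.mat]

noncomputable def pB : Module.Basis (Fin 7) ℚ L := pb.basis.reindex (finCongr pb_dim)

theorem pB_apply (i : Fin 7) : pB i = p ^ (i : ℕ) := by
  simp [pB, pb_gen]

theorem V7.norm_pe (v : V7) : Algebra.norm ℚ v.pe = ((toM 7 v.mat).det : ℚ) := by
  rw [Algebra.norm_eq_matrix_det pB]
  have : Algebra.leftMulMatrix pB v.pe = (Int.castRingHom ℚ).mapMatrix (toM 7 v.mat) := by
    ext i j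
    rw [Algebra.leftMulMatrix_eq_repr_mul]
    have h : v.pe * pB j = ∑ k, (((toM 7 v.mat) k j : ℤ) : ℚ) • pB k := by
      simp only [Algebra.smul_def, pB_apply]
      fin_cases j <;> simp [Fin.sum_univ_succ, toM, V7.mat, V7.pe]
      · ring
      · linear_combination v.g * hp
      · linear_combination (v.g * p + v.f) * hp
      · linear_combination (v.g * p ^ 2 + v.f * p + v.e) * hp
      · linear_combination (v.g * p ^ 3 + v.f * p ^ 2 + v.e * p + v.d) * hp
      · linear_combination (v.g * p ^ 4 + v.f * p ^ 3 + v.e * p ^ 2 + v.d * p + v.c) * hp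
      · linear_combination (v.g * p ^ 5 + v.f * p ^ 4 + v.e * p ^ 3 + v.d * p ^ 2 + v.c * p + v.b) * hp
    rw [h]
    simp [Finsupp.single_apply]
  rw [this, ← RingHom.map_det]
  simp

/-- norm check -/
def V7.nck (v : V7) (B : ℕ) : Bool :=
  let c := ch 7 v.sc.mat
  c.1 ≠ 0 && c.1.natAbs < c.2.natAbs * (27 ^ 7 * B)

theorem V7.nck_spec (v : V7) (B : ℕ) (h : v.nck B = true) :
    v.el ≠ 0 ∧ Ideal.absNorm (Ideal.span {v.el}) < B := by
  simp only [V7.nck, Bool.and_eq_true, decide_eq_true_eq] at h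
  obtain ⟨h1, h2⟩ := h
  have h3 := ch_spec 7 _ v.sc.wf_mat
  have h4 := V7.norm_pe v.sc
  rw [← V7.el_coe, map_mul, show (27 : L) = algebraMap ℚ L 27 by simp, Algebra.norm_algebraMap, finrankL] at h4
  have h5 : Algebra.norm ℚ (v.el : L) = (Algebra.norm ℤ v.el : ℤ) := by
    exact (Algebra.coe_norm_int v.el).symm
  rw [h5] at h4
  have h6 : 27 ^ 7 * Algebra.norm ℤ v.el = (toM 7 v.sc.mat).det := by exact_mod_cast h4
  rw [← h6] at h3
  have hne : Algebra.norm ℤ v.el ≠ 0 := by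
    intro h0; rw [h0] at h3; apply h1; rw [← h3]; ring
  refine ⟨fun h0 => hne (by rw [h0]; exact Algebra.norm_zero), ?_⟩
  rw [Ideal.absNorm_span_singleton]
  have h7 := congrArg Int.natAbs h3
  rw [Int.natAbs_mul, Int.natAbs_mul] at h7
  rw [← h7] at h2
  have h8 : Int.natAbs (27 ^ 7) = 27 ^ 7 := by norm_num
  rw [h8] at h2
  by_contra hc
  push Not at hc
  have : (ch 7 v.sc.mat).2.natAbs * (27 ^ 7 * B) ≤ 27 ^ 7 * (Algebra.norm ℤ v.el).natAbs * (ch 7 v.sc.mat).2.natAbs := by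
    calc _ ≤ (ch 7 v.sc.mat).2.natAbs * (27 ^ 7 * (Algebra.norm ℤ v.el).natAbs) := by gcongr
      _ = _ := by ring
  omega

end C3
end

section
open Polynomial NumberField Matrix
namespace C3

def tab : List (ℕ × ℕ × V7) := [
  (5, 3, ⟨-2, 1, 2, 0, 0, 0, -1⟩),
  (7, 1, ⟨-1, -1, -1, 0, 0, 0, 0⟩),
  (11, 6, ⟨-1, 0, 1, 0, 0, 0, 0⟩),
  (13, 7, ⟨1, 0, 1, 0, 0, 0, 0⟩),
  (17, 2, ⟨2, 0, 0, 0, 1, 0, 0⟩),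
  (19, 13, ⟨1, 0, -1, 0, 1, 0, 0⟩),
  (23, 1, ⟨-1, 1, 0, 0, 0, 0, 0⟩),
  (29, 8, ⟨-2, 0, 1, 0, 0, 0, 0⟩),
  (29, 10, ⟨2, 0, 1, 1, 0, 0, 1⟩),
  (29, 12, ⟨-1, -1, 0, 0, 1, 0, 0⟩),
  (29, 15, ⟨1, 0, 0, 0, 1, 0, 0⟩),
  (29, 18, ⟨-2, 0, -1, 0, -1, 0, 0⟩),
  (29, 26, ⟨-1, -1, 0, 0, 0, 0, 1⟩),
  (29, 27, ⟨2, 1, 0, 0, 0, 0, 0⟩),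
  (31, 19, ⟨2, -1, 1, 0, 0, 0, 0⟩),
  (37, 23, ⟨1, 0, 0, -1, 1, 0, 0⟩),
  (41, 33, ⟨-1, 0, -1, 0, 1, 0, 0⟩),
  (47, 27, ⟨1, 1, 0, -1, 0, 0, 0⟩),
  (53, 5, ⟨1, 0, 2, 0, 0, 0, 0⟩),
  (59, 39, ⟨-3, 0, -2, 0, -1, 0, 0⟩),
  (61, 21, ⟨1, 0, -1, -1, 0, 0, 0⟩),
  (67, 18, ⟨-1, 0, 0, 1, 0, 0, 0⟩),
  (73, 55, ⟨-1, 1, 1, 0, 1, 0, 0⟩),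
  (79, 11, ⟨-1, 1, 2, 0, -1, 0, 0⟩),
  (83, 54, ⟨2, 0, 2, 0, 0, 0, -1⟩),
  (89, 44, ⟨3, 0, 1, 0, 1, 0, 0⟩),
  (97, 11, ⟨1, 0, 1, 1, 0, 0, 0⟩),
  (101, 28, ⟨-1, 0, -1, 0, 0, 0, 1⟩),
  (103, 26, ⟨2, -1, 0, 0, 0, 0, 1⟩),
  (107, 88, ⟨2, 0, -1, 0, 1, 0, 0⟩),
  (109, 24, ⟨2, 1, 1, 0, 0, 0, 0⟩),
  (131, 14, ⟨1, 1, -1, 0, 0, 0, 1⟩),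
  (137, 9, ⟨1, 0, 0, 0, 1, 0, 1⟩),
  (139, 76, ⟨-2, 0, -1, 0, 1, 0, 1⟩),
  (149, 93, ⟨-1, 0, 2, 1, -1, 0, 0⟩),
  (151, 144, ⟨-1, 0, 1, 1, 1, 0, 0⟩),
  (157, 6, ⟨1, 0, 1, 0, 1, 0, 0⟩),
  (163, 162, ⟨1, 1, 0, 0, 0, 0, 0⟩),
  (167, 152, ⟨2, -1, 2, 0, 0, 0, 0⟩),
  (173, 74, ⟨-2, -1, 1, -1, 0, 0, 0⟩),
  (179, 79, ⟨-1, -1, -2, 0, 1, 0, 0⟩),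
  (181, 19, ⟨1, 1, 0, 0, 1, 0, 0⟩),
  (191, 117, ⟨-2, -1, -1, 0, 0, 0, 1⟩),
  (193, 139, ⟨-1, 0, -1, 1, 0, 0, 0⟩),
  (199, 178, ⟨-1, 1, -2, 0, 1, 0, 0⟩),
  (223, 181, ⟨1, 0, 2, 0, -1, 0, -1⟩),
  (227, 118, ⟨-2, 0, 0, 1, 0, 0, 0⟩),
  (229, 116, ⟨-3, 1, 2, 0, 0, 0, 0⟩),
  (233, 116, ⟨1, 2, 0, 0, 0, 0, 0⟩),
  (241, 194, ⟨-1, 0, 2, -1, 1, 0, 0⟩),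
  (251, 71, ⟨-2, 0, 1, 1, 0, 0, 0⟩),
  (257, 73, ⟨2, 0, 2, 0, -1, 0, 1⟩),
  (263, 12, ⟨-2, 0, -1, 1, 0, 0, 0⟩),
  (269, 237, ⟨-2, 1, -1, 1, 0, 0, 0⟩),
  (271, 78, ⟨2, 1, 0, 1, 0, 0, 0⟩),
  (277, 94, ⟨-1, 0, 1, -1, 1, 0, 0⟩),
  (283, 140, ⟨-3, -1, 2, 0, 0, 0, 0⟩),
  (293, 28, ⟨1, -1, 1, 0, 1, 0, 0⟩),
  (307, 48, ⟨1, 0, -2, 0, 0, 0, 0⟩),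
  (311, 96, ⟨2, 1, -1, 0, 0, 0, 1⟩),
  (313, 261, ⟨1, -1, 0, -1, 1, 0, 0⟩),
  (317, 128, ⟨1, 0, 2, 1, 0, 0, 0⟩),
  (331, 242, ⟨1, -1, 0, 1, 0, 0, 0⟩),
  (347, 240, ⟨2, 0, 3, 0, 0, 0, 0⟩),
  (349, 311, ⟨-1, 0, 0, 0, -1, 0, 1⟩),
  (353, 265, ⟨1, -1, 1, -1, 1, 0, 0⟩),
  (359, 229, ⟨-2, 0, -1, 0, 0, 0, 1⟩),
  (367, 356, ⟨-1, 0, -1, 1, 1, 0, 0⟩),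
  (373, 207, ⟨-2, -1, -1, 0, 1, 0, 0⟩),
  (383, 101, ⟨1, 0, 2, 0, 0, 0, 1⟩),
  (389, 18, ⟨1, 0, 0, 1, 0, 0, 0⟩),
  (397, 45, ⟨1, 0, 2, 0, -1, 0, 1⟩),
  (401, 275, ⟨2, -2, -1, 0, 1, 0, 0⟩),
  (409, 200, ⟨-2, 1, -2, 0, 1, 0, 0⟩),
  (419, 194, ⟨1, 1, -1, 1, 1, 0, 0⟩),
  (421, 42, ⟨-1, -1, 0, 0, 1, 0, 1⟩),
  (421, 69, ⟨-1, 0, 1, 1, 0, 0, 1⟩),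
  (421, 123, ⟨1, -1, -1, 0, 0, 0, 1⟩),
  (421, 172, ⟨1, 0, 1, 0, -1, 0, 1⟩),
  (421, 203, ⟨-2, 1, 0, 0, 1, 0, 0⟩),
  (421, 270, ⟨2, 1, -1, 0, 1, 0, 0⟩),
  (421, 384, ⟨-1, -1, -2, 1, 1, 0, 0⟩),
  (431, 9, ⟨1, 1, 0, 0, -1, 0, 1⟩),
  (433, 351, ⟨3, 0, -2, 0, 1, 0, 0⟩),
  (439, 144, ⟨-3, 0, 1, 1, 0, 0, 0⟩),
  (443, 80, ⟨3, 0, -1, 0, -1, 0, 1⟩),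
  (457, 392, ⟨1, -1, 1, 0, -1, 0, 1⟩),
  (461, 390, ⟨-3, -1, -1, 0, 0, 0, 1⟩),
  (467, 384, ⟨-3, -1, 1, 0, 0, 0, 1⟩),
  (479, 21, ⟨-1, 1, -2, 0, 0, 0, 1⟩),
  (487, 241, ⟨-2, 0, -2, -1, 1, 0, 0⟩),
  (491, 24, ⟨3, 0, -1, 1, 0, 0, 0⟩),
  (491, 112, ⟨-1, 0, 1, 0, 1, 0, 0⟩),
  (491, 235, ⟨2, -1, 3, 0, 0, 0, 0⟩),
  (491, 359, ⟨-2, 2, -1, 0, 1, 0, 0⟩),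
  (491, 366, ⟨1, 0, 0, 1, -1, 0, 1⟩),
  (491, 426, ⟨1, 1, 0, 0, 1, 0, 1⟩),
  (491, 442, ⟨-2, 2, 0, -1, 0, 0, 0⟩),
  (499, 445, ⟨2, 1, -2, 0, 0, 0, 0⟩),
  (503, 79, ⟨-2, 0, 2, 1, 0, 0, 0⟩),
  (509, 119, ⟨1, 1, -3, 0, 1, 0, 0⟩),
  (521, 248, ⟨-2, -1, 1, -1, 1, 0, 0⟩),
  (523, 55, ⟨3, 1, 1, -1, 0, 0, 0⟩),
  (541, 305, ⟨1, -1, 1, 1, 0, 0, 1⟩),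
  (557, 117, ⟨2, 0, 1, 0, -1, 0, 1⟩),
  (563, 46, ⟨-3, 0, 2, 0, -1, 0, 1⟩),
  (569, 79, ⟨1, 0, 0, 0, 0, 1, 0⟩),
  (571, 423, ⟨2, -1, 1, 0, 0, 0, 1⟩),
  (577, 372, ⟨1, 1, 0, 1, 1, 0, 1⟩),
  (587, 248, ⟨2, 0, 0, 0, 1, 0, 1⟩),
  (593, 538, ⟨-1, -2, 0, 0, -1, 0, 1⟩),
  (599, 556, ⟨1, 1, 2, 0, 0, -1, 0⟩),
  (601, 96, ⟨2, -1, 1, 0, 0, 1, 0⟩),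
  (607, 570, ⟨2, -1, 1, 1, 0, 0, 0⟩),
  (613, 134, ⟨-1, 0, 3, 1, 0, 0, 0⟩),
  (619, 181, ⟨3, 0, -1, 0, 0, 1, 0⟩),
  (641, 483, ⟨1, 0, -1, 0, 2, 0, 0⟩),
  (643, 429, ⟨1, 1, 2, 0, -2, 0, 1⟩),
  (647, 642, ⟨5, 1, 0, 0, 0, 0, 0⟩),
  (653, 610, ⟨-2, -1, 0, 0, 1, 0, 1⟩),
  (661, 160, ⟨-2, 1, 2, 0, 1, 0, 0⟩),
  (677, 20, ⟨-1, 0, 1, 0, 1, 0, 1⟩),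
  (683, 628, ⟨-3, 1, 1, -1, 1, 0, 0⟩),
  (691, 226, ⟨3, 0, 1, 0, 0, 0, 1⟩),
  (709, 590, ⟨2, 1, -2, -1, 0, 0, -1⟩),
  (719, 535, ⟨1, 1, 0, -1, 0, 0, 1⟩),
  (727, 64, ⟨1, 1, -2, 0, 0, 0, 0⟩),
  (733, 407, ⟨3, 0, 1, 0, 0, 0, 0⟩),
  (739, 390, ⟨-1, -1, -1, 1, 0, 0, 1⟩),
  (743, 36, ⟨-3, 0, -2, 0, 0, 0, 1⟩),
  (743, 192, ⟨-1, 1, -1, 0, 0, 0, 1⟩),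
  (743, 281, ⟨-1, -2, 1, 0, 0, 0, 0⟩),
  (743, 508, ⟨1, -1, 0, 0, 1, 1, 0⟩),
  (743, 564, ⟨1, 1, -2, 1, 1, 0, 0⟩),
  (743, 663, ⟨1, -1, -1, 0, 1, 0, 0⟩),
  (743, 728, ⟨-1, 0, 2, 0, 0, 0, 1⟩),
  (751, 53, ⟨1, -1, 0, 0, -2, 0, 1⟩),
  (761, 21, ⟨-1, -2, 0, 1, 0, 0, 0⟩),
  (769, 413, ⟨1, 0, 0, -1, -1, 0, 1⟩),
  (773, 730, ⟨-1, 1, 0, 0, 1, 0, 1⟩),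
  (787, 350, ⟨3, 1, 1, 0, 0, 0, 0⟩),
  (797, 648, ⟨1, 0, 0, 0, 0, 1, -1⟩),
  (809, 520, ⟨2, -1, 1, 0, 2, 0, 0⟩),
  (811, 734, ⟨-2, -1, 2, 0, 1, 0, 0⟩),
  (821, 208, ⟨1, 2, -1, 0, 1, 0, 0⟩),
  (823, 560, ⟨-1, -1, 1, 0, 0, 0, 0⟩),
  (829, 28, ⟨-2, -1, -2, 0, 0, 0, 0⟩),
  (839, 122, ⟨1, 1, -1, 1, 0, 0, 0⟩),
  (853, 624, ⟨-2, 0, 2, 0, 1, 0, 0⟩),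
  (857, 523, ⟨-1, -1, 2, 0, 0, 1, 0⟩),
  (859, 292, ⟨-1, 2, 0, 0, 1, 0, 0⟩),
  (863, 29, ⟨-3, 0, -2, 0, -2, 0, 0⟩),
  (877, 474, ⟨-1, -1, 2, -1, 1, 0, 0⟩),
  (881, 490, ⟨-2, 1, -1, 0, 1, 0, 0⟩),
  (887, 432, ⟨-3, 1, -1, 0, -1, 0, 1⟩),
  (907, 611, ⟨-1, 2, 0, -1, 1, 0, 0⟩),
  (919, 338, ⟨-1, 0, 3, 0, -1, 0, 1⟩),
  (929, 289, ⟨-1, -1, 2, 0, 0, 0, 1⟩),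
  (937, 702, ⟨4, 0, -2, 0, 1, 0, 0⟩),
  (941, 640, ⟨-2, 0, 2, 1, 1, 0, 0⟩),
  (947, 825, ⟨-2, 0, 2, -1, 0, 0, 1⟩),
  (971, 93, ⟨2, 1, 1, 1, 0, 0, -1⟩),
  (977, 343, ⟨4, 0, -1, 0, 1, 0, 0⟩),
  (983, 456, ⟨-2, 0, 1, -1, 1, 0, 0⟩),
  (991, 314, ⟨-2, 0, 2, 0, -1, 1, 0⟩),
  (997, 334, ⟨-1, -1, -1, 0, 1, 0, 0⟩),
  (1013, 683, ⟨2, 1, 1, -1, 0, 0, 1⟩),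
  (1019, 641, ⟨2, 2, 1, 0, 0, 0, 0⟩),
  (1021, 690, ⟨1, 0, 3, 0, -1, 0, 1⟩),
  (1031, 390, ⟨-2, 1, 1, 0, -2, 0, 0⟩),
  (1033, 8, ⟨4, 0, 0, 0, 1, 0, 0⟩),
  (1039, 134, ⟨1, 0, 0, 1, 1, 0, 0⟩),
  (1049, 391, ⟨-2, 1, 0, 0, 0, 0, 1⟩),
  (1061, 40, ⟨1, 1, 1, 1, 1, 0, -1⟩),
  (1063, 194, ⟨1, 0, -1, -1, 2, 0, -1⟩),
  (1069, 91, ⟨4, -1, 1, 1, 1, 0, 0⟩),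
  (1087, 377, ⟨4, 0, -1, 1, 1, 0, 0⟩),
  (1091, 1084, ⟨-1, 1, -1, 0, 1, 0, 0⟩),
  (1097, 472, ⟨1, 0, 2, -1, -1, 0, 1⟩),
  (1103, 652, ⟨-1, 0, 0, -1, -1, 0, 1⟩),
  (1109, 418, ⟨3, 0, -1, 0, 1, 0, 0⟩),
  (1117, 927, ⟨1, -1, 0, 0, 1, 0, 0⟩),
  (1123, 988, ⟨-3, -1, -2, 1, 0, 0, 0⟩),
  (1129, 283, ⟨4, 0, 2, 0, 1, 0, 0⟩),
  (1151, 602, ⟨2, 1, 1, 0, -2, 0, 1⟩),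
  (1153, 1107, ⟨-2, 1, 1, -1, 0, 0, -1⟩),
  (1171, 863, ⟨-1, 2, 0, 1, 0, 0, 0⟩),
  (1181, 1010, ⟨1, -1, 1, 0, -2, 0, 0⟩),
  (1187, 159, ⟨2, 2, 0, 0, 1, 0, 0⟩),
  (1193, 276, ⟨-4, 0, 0, 0, 1, 0, 1⟩),
  (1201, 400, ⟨-3, 1, 1, 0, 1, 0, 0⟩),
  (1213, 835, ⟨4, 0, 0, 0, -1, 1, 0⟩),
  (1217, 960, ⟨2, 0, 1, 0, 1, 0, 1⟩),
  (1223, 324, ⟨4, -1, -2, 0, 1, 0, 0⟩),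
  (1229, 890, ⟨2, 0, 1, 1, 1, 0, 0⟩),
  (1231, 992, ⟨2, 0, -1, 1, 0, 0, 1⟩),
  (1237, 191, ⟨3, 1, -1, 0, 0, 0, 1⟩),
  (1249, 161, ⟨2, 1, 0, 1, 0, 0, 1⟩),
  (1259, 124, ⟨-2, 2, 0, 0, -2, 0, -1⟩),
  (1277, 827, ⟨-1, -1, -1, 0, 0, 0, 1⟩),
  (1279, 1075, ⟨-2, 1, -2, -1, -1, 0, -1⟩),
  (1283, 700, ⟨-2, 0, 3, 0, 1, 0, 0⟩),
  (1291, 1019, ⟨-2, 0, 0, -1, 1, 0, 0⟩),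
  (1297, 271, ⟨3, -2, -1, 0, 1, 0, 0⟩),
  (1301, 1200, ⟨1, 2, 0, 0, 1, 0, 1⟩),
  (1307, 446, ⟨2, 0, -1, 1, 1, 0, 0⟩),
  (1319, 181, ⟨-2, 1, 1, 1, 0, 1, 0⟩),
  (1321, 831, ⟨2, 1, 0, -1, 1, 0, -1⟩),
  (1327, 731, ⟨4, 0, -1, -1, 1, 0, 0⟩),
  (1361, 650, ⟨-2, 0, -1, 0, -1, 1, 0⟩),
  (1367, 622, ⟨2, 0, -2, 0, 1, 1, 0⟩),
  (1381, 59, ⟨-1, -1, 1, 1, 2, 0, 0⟩),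
  (1399, 531, ⟨-2, 0, 1, 1, 0, 0, 1⟩),
  (1409, 309, ⟨-2, -1, 0, -1, 0, 1, 0⟩),
  (1423, 706, ⟨-1, 0, -3, 0, 0, 0, 1⟩),
  (1427, 1415, ⟨-2, 2, 0, -1, 1, 0, 0⟩),
  (1433, 127, ⟨5, -1, 1, 0, 0, 0, 0⟩),
  (1439, 421, ⟨-1, 1, 0, 0, 1, 0, 0⟩),
  (1447, 1258, ⟨1, -2, -1, 0, -1, 1, 0⟩),
  (1451, 1267, ⟨2, 2, 1, 0, 0, 0, 1⟩),
  (1453, 516, ⟨-1, 0, 1, -1, 0, 1, -1⟩),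
  (1459, 375, ⟨1, -1, 2, 0, 0, 0, 0⟩),
  (1471, 5, ⟨-1, 0, -1, 0, 2, 0, 1⟩),
  (1471, 83, ⟨3, -1, -1, 0, 2, 0, 1⟩),
  (1471, 201, ⟨1, 0, -1, 1, 0, 0, 0⟩),
  (1471, 388, ⟨2, 1, -3, 0, -1, 0, 0⟩),
  (1471, 431, ⟨-4, 1, -2, 0, 1, 0, 0⟩),
  (1471, 851, ⟨-3, 0, -1, 1, 0, 0, 0⟩),
  (1471, 983, ⟨2, 0, 0, -1, 1, 1, 0⟩),
  (1481, 456, ⟨1, 1, 0, 1, 2, 0, 0⟩),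
  (1483, 978, ⟨-1, 0, -2, 0, 2, 1, 0⟩),
  (1487, 343, ⟨3, 0, 2, 0, -1, 1, 0⟩),
  (1489, 44, ⟨-1, -1, -1, 0, -1, 1, 0⟩),
  (1493, 905, ⟨-5, 0, 0, 0, -1, 0, -1⟩),
  (1511, 1140, ⟨1, -1, -1, 0, -2, 0, 1⟩),
  (1523, 1121, ⟨-1, 0, 1, 0, 2, 0, 1⟩),
  (1531, 1026, ⟨1, -1, 1, 0, -2, 0, 1⟩),
  (1543, 658, ⟨2, -1, -2, 1, 1, 0, 0⟩),
  (1549, 1216, ⟨-3, 1, -1, 1, 1, 0, 0⟩),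
  (1553, 818, ⟨2, -1, -2, 0, 1, 0, 0⟩),
  (1559, 547, ⟨3, 0, 1, 1, 1, -1, 0⟩),
  (1567, 1444, ⟨-4, 0, -2, 0, 0, 0, -1⟩),
  (1571, 1310, ⟨2, 0, 1, 1, 0, 0, 0⟩),
  (1579, 161, ⟨-1, -2, -1, 0, 1, 0, 1⟩),
  (1601, 157, ⟨4, -1, 0, 0, 0, 0, 1⟩),
  (1607, 621, ⟨-1, 0, -3, 1, 0, 0, 0⟩),
  (1609, 1416, ⟨1, -1, -2, 0, 1, 0, 1⟩),
  (1613, 1035, ⟨3, 0, -1, 0, 1, 1, 0⟩),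
  (1619, 1468, ⟨3, 0, -2, 1, 1, 0, 0⟩),
  (1621, 416, ⟨-2, 1, 1, 0, 1, 1, 0⟩),
  (1627, 714, ⟨2, 1, -2, -1, 1, 0, 0⟩),
  (1637, 1243, ⟨1, 1, -1, -1, 2, 0, 0⟩),
  (1657, 1237, ⟨1, 0, 0, 1, 0, 0, 1⟩),
  (1663, 560, ⟨2, -1, 2, 0, 1, 0, 0⟩),
  (1669, 641, ⟨1, 0, 0, 0, -1, 0, 1⟩),
  (1693, 902, ⟨-2, -1, 0, 1, 0, 0, 0⟩),
  (1697, 65, ⟨1, -1, -1, 0, -1, 0, 1⟩),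
  (1699, 1358, ⟨-5, 0, 0, 0, 0, 0, -1⟩),
  (1721, 1585, ⟨-1, -2, -1, -1, 1, 0, 0⟩),
  (1733, 1455, ⟨-1, 1, -1, 0, 1, 1, 0⟩),
  (1741, 748, ⟨2, 1, -1, 1, 0, 1, 0⟩),
  (1747, 912, ⟨-2, 0, -1, 1, 1, 0, 0⟩),
  (1753, 70, ⟨-2, 2, 2, 0, 1, 0, 0⟩),
  (1759, 1708, ⟨3, -1, 1, -1, 1, 0, 0⟩),
  (1777, 731, ⟨4, 0, 0, 1, 1, -1, 0⟩),
  (1783, 244, ⟨1, 2, -2, 0, 0, 0, 1⟩),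
  (1787, 336, ⟨-1, 0, -1, -1, -1, 1, 0⟩),
  (1789, 1318, ⟨2, 1, 2, 0, -1, 0, 1⟩),
  (1801, 444, ⟨1, 0, 0, -1, 0, 0, 1⟩),
  (1811, 1126, ⟨-2, 1, 1, 0, 0, 0, 1⟩),
  (1823, 592, ⟨-1, 1, 2, 1, -1, 0, 1⟩),
  (1831, 1820, ⟨-2, 0, 1, 1, 2, 0, 0⟩),
  (1847, 1077, ⟨-2, 0, 1, -1, 0, 0, 1⟩),
  (1861, 411, ⟨-1, 1, 1, 0, 2, 0, 0⟩),
  (1867, 229, ⟨1, 1, 1, 0, 1, 0, 2⟩),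
  (1871, 860, ⟨-2, 0, -1, -1, -1, 1, 0⟩),
  (1873, 1274, ⟨-2, 1, 1, 1, 2, 0, 0⟩),
  (1879, 1749, ⟨3, -1, -1, -1, 0, 1, 0⟩),
  (1889, 1864, ⟨-1, 2, -2, 0, 1, 0, 1⟩),
  (1901, 1282, ⟨1, 1, 2, -1, 2, 0, 0⟩),
  (1907, 1124, ⟨-2, 0, -2, -1, 2, 0, 0⟩),
  (1913, 1289, ⟨2, 1, 1, 1, -1, 1, 0⟩),
  (1931, 848, ⟨-2, -2, 1, 0, 0, 0, 1⟩),
  (1949, 753, ⟨-3, 0, 1, 0, 1, 1, 1⟩),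
  (1951, 993, ⟨1, 1, -1, 1, 2, 0, 0⟩),
  (1973, 1855, ⟨-2, 1, 1, 0, -2, 1, 0⟩),
  (1979, 1643, ⟨-2, -1, 0, -1, -1, 0, 1⟩),
  (1987, 1413, ⟨-2, -1, 2, 0, 1, 1, 0⟩),
  (1993, 1961, ⟨1, 0, 1, -1, 1, 0, 0⟩),
  (1997, 1832, ⟨1, 1, -3, 1, 0, 0, -1⟩),
  (1999, 505, ⟨-1, -1, 0, 1, 2, 0, 1⟩),
  (2011, 1765, ⟨-2, 1, -2, -1, -1, 0, 1⟩),
  (2027, 789, ⟨4, 0, 1, -1, 1, 0, 0⟩),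
  (2029, 1550, ⟨-3, 0, -1, 0, 1, 0, 0⟩),
  (2039, 1002, ⟨-1, 2, -2, 0, 1, 0, 0⟩),
  (2053, 1910, ⟨-2, 1, -1, 0, -1, 0, 1⟩),
  (2063, 1451, ⟨-2, 0, -2, -1, -2, 0, 0⟩),
  (2069, 174, ⟨-1, -1, 1, 0, 0, 0, -2⟩),
  (2081, 755, ⟨-2, -1, -2, 0, -1, 0, 1⟩),
  (2083, 1452, ⟨-1, 0, -1, -1, 1, 0, 0⟩),
  (2089, 1404, ⟨-3, 0, -1, 1, 0, 0, 1⟩),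
  (2099, 1876, ⟨3, 1, -1, 1, 1, 0, 1⟩),
  (2111, 273, ⟨-1, 1, 0, 1, 0, 0, 1⟩),
  (2113, 817, ⟨-2, -2, 0, 1, 0, 0, 0⟩),
  (2131, 527, ⟨-1, -1, 0, -1, 0, 0, 1⟩),
  (2137, 1568, ⟨-1, -1, 0, 0, -1, -1, 1⟩),
  (2141, 749, ⟨-4, -1, 2, 0, 0, 0, 0⟩),
  (2153, 1567, ⟨-5, 0, -2, 0, 0, 0, 0⟩),
  (2161, 1731, ⟨2, 1, -2, -1, 0, 1, 0⟩),
  (2179, 2109, ⟨4, 1, -2, 1, 0, 0, 0⟩),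
  (2203, 985, ⟨-2, -1, 1, 1, 1, 0, 1⟩),
  (2207, 1698, ⟨-2, 1, -1, 0, 1, 0, 1⟩),
  (2221, 1538, ⟨2, 0, 0, -1, 0, 1, -1⟩),
  (2237, 830, ⟨2, 0, 0, 1, 1, -1, 1⟩),
  (2239, 832, ⟨4, 1, -3, 0, 1, 0, 0⟩),
  (2243, 1315, ⟨1, 1, -1, -1, 0, 1, 0⟩),
  (2251, 1637, ⟨4, 1, -2, 1, 0, 0, -1⟩),
  (2267, 425, ⟨1, 2, -2, -1, 1, 0, 0⟩),
  (2273, 739, ⟨1, 0, 0, 0, 2, 0, 1⟩),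
  (2281, 2056, ⟨1, 1, 0, 0, -1, 0, -2⟩),
  (2287, 1614, ⟨1, -1, 0, 1, 2, 0, 0⟩),
  (2293, 2191, ⟨2, -1, 0, 0, -1, 0, -2⟩),
  (2309, 338, ⟨-2, 1, -1, 1, 0, 0, 1⟩),
  (2333, 882, ⟨1, 1, 0, 1, -1, 0, 1⟩),
  (2341, 1362, ⟨2, 0, -2, 1, 1, 0, 1⟩),
  (2347, 2071, ⟨-1, 0, 0, 1, 0, 0, 1⟩),
  (2351, 198, ⟨-2, 1, 1, 0, 2, 1, 0⟩),
  (2357, 578, ⟨2, -1, -3, 0, 1, 0, 0⟩),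
  (2371, 1279, ⟨-1, 2, 1, 1, 0, 0, 1⟩),
  (2377, 547, ⟨-1, 0, -2, 1, 0, -1, 1⟩),
  (2383, 2225, ⟨-2, 1, 2, 1, -1, 0, 1⟩),
  (2389, 2359, ⟨-4, 0, -1, 0, -1, 0, 1⟩),
  (2393, 310, ⟨4, 1, 1, 0, 1, 0, 0⟩),
  (2399, 2130, ⟨1, -2, 2, 0, 0, 0, 0⟩),
  (2411, 272, ⟨-1, -1, -2, 0, -1, 0, 1⟩),
  (2417, 1499, ⟨2, 0, -2, -1, 1, 0, 0⟩),
  (2441, 1510, ⟨3, 0, 1, -1, -1, 0, 1⟩),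
  (2447, 359, ⟨1, -2, 1, -1, 1, 0, 0⟩),
  (2459, 2183, ⟨2, 2, 2, 0, 1, 0, 0⟩),
  (2467, 1836, ⟨1, 1, -2, 0, -1, 1, 0⟩),
  (2473, 2257, ⟨2, 0, 1, 0, -2, 0, 0⟩)]

def V7.ev (v : V7) (r : ℤ) : ℤ :=
  27 * v.a + r * (27 * v.b + r * (9 * v.c + r * (9 * v.d + r * (3 * v.e + r * (3 * v.f + r * v.g)))))

def rowck (t : ℕ × ℕ × V7) : Bool :=
  t.2.2.nck (t.1 ^ 2) && t.2.2.ev t.2.1 % t.1 == 0 && t.2.1 ^ 7 % t.1 == 162 % t.1 && 5 ≤ t.1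

theorem tab_ok : tab.all rowck = true := by decide +kernel

def qck (q : ℕ) : Bool :=
  (List.range 48).any (fun d => q % (d + 2) == 0 && d + 2 < q) ||
  if q % 7 = 1 then 162 ^ ((q - 1) / 7) % q != 1 ||
      (List.range q).all (fun r => r ^ 7 % q != 162 % q || tab.any fun t => t.1 == q && t.2.1 == r)
    else tab.any fun t => t.1 == q

theorem q_ok : (List.range 2472).all (fun k => qck (k + 5)) = true := by decide +kernel
end C3
end

section
open Polynomial NumberField Matrix
namespace C3

noncomputable def pO : 𝓞 L := omO 1

theorem pO_coe : (pO : L) = p := by simp [pO, omO_coe, om, jj]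

theorem pO_pow : pO ^ 7 = 162 := by
  apply RingOfIntegers.ext
  simp only [map_pow, map_ofNat, pO_coe, hp]

theorem V7.el_pO (v : V7) : 27 * v.el = v.sc.a + v.sc.b * pO + v.sc.c * pO ^ 2 + v.sc.d * pO ^ 3
    + v.sc.e * pO ^ 4 + v.sc.f * pO ^ 5 + v.sc.g * pO ^ 6 := by
  apply RingOfIntegers.ext
  have := v.el_coe
  simp only [map_mul, map_add, map_pow, map_intCast, pO_coe, map_ofNat]
  rw [this, V7.pe]

theorem mem_of_ev {P : Ideal (𝓞 L)} [P.IsPrime] (v : V7) (q r : ℕ) (hq : (q : 𝓞 L) ∈ P)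
    (h27 : (27 : 𝓞 L) ∉ P) (hr : pO - (r : 𝓞 L) ∈ P) (hv : v.ev r % q = 0) : v.el ∈ P := by
  have h1 : (27 : 𝓞 L) * v.el ∈ P := by
    rw [← Ideal.Quotient.eq_zero_iff_mem] at hq hr ⊢
    have e : Ideal.Quotient.mk P pO = (r : 𝓞 L ⧸ P) := by
      rw [map_sub, sub_eq_zero] at hr; simpa using hr
    rw [V7.el_pO]
    obtain ⟨m, hm⟩ := Int.dvd_of_emod_eq_zero hv
    have e2 : ((v.ev r : ℤ) : 𝓞 L ⧸ P) = 0 := by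
      rw [hm]; push_cast; rw [map_natCast] at hq; rw [hq, zero_mul]
    simp only [map_add, map_mul, map_pow, e, map_intCast]
    rw [← e2]
    simp only [V7.ev, V7.sc]
    push_cast
    ring
  rcases Ideal.IsPrime.mem_or_mem ‹_› h1 with h | h
  · exact absurd h h27
  · exact h

def V7.mul (v w : V7) : V7 :=
  ⟨v.a * w.a + 6 * v.b * w.g + 6 * v.c * w.f + 6 * v.d * w.e + 6 * v.e * w.d + 6 * v.f * w.c + 6 * v.g * w.b,
   v.a * w.b + v.b * w.a + 2 * v.c * w.g + 6 * v.d * w.f + 2 * v.e * w.e + 6 * v.f * w.d + 2 * v.g * w.c,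
   v.a * w.c + 3 * v.b * w.b + v.c * w.a + 6 * v.d * w.g + 6 * v.e * w.f + 6 * v.f * w.e + 6 * v.g * w.d,
   v.a * w.d + v.b * w.c + v.c * w.b + v.d * w.a + 2 * v.e * w.g + 6 * v.f * w.f + 2 * v.g * w.e,
   v.a * w.e + 3 * v.b * w.d + v.c * w.c + 3 * v.d * w.b + v.e * w.a + 6 * v.f * w.g + 6 * v.g * w.f,
   v.a * w.f + v.b * w.e + v.c * w.d + v.d * w.c + v.e * w.b + v.f * w.a + 2 * v.g * w.g,
   v.a * w.g + 3 * v.b * w.f + v.c * w.e + 3 * v.d * w.d + v.e * w.c + 3 * v.f * w.b + v.g * w.a⟩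

theorem V7.el_mul (v w : V7) : v.el * w.el = (v.mul w).el := by
  apply RingOfIntegers.ext
  simp only [V7.el, V7.mul, map_mul, map_add, map_intCast, omO_coe, om, jj]
  simp
  linear_combination (v.b * w.g / 27 * p ^ 0 + v.c * w.f / 27 * p ^ 0 + v.c * w.g / 81 * p ^ 1 + v.d * w.e / 27 * p ^ 0 + v.d * w.f / 27 * p ^ 1 + v.d * w.g / 81 * p ^ 2 + v.e * w.d / 27 * p ^ 0 + v.e * w.e / 81 * p ^ 1 + v.e * w.f / 81 * p ^ 2 + v.e * w.g / 243 * p ^ 3 + v.f * w.c / 27 * p ^ 0 + v.f * w.d / 27 * p ^ 1 + v.f * w.e / 81 * p ^ 2 + v.f * w.f / 81 * p ^ 3 + v.f * w.g / 243 * p ^ 4 + v.g * w.b / 27 * p ^ 0 + v.g * w.c / 81 * p ^ 1 + v.g * w.d / 81 * p ^ 2 + v.g * w.e / 243 * p ^ 3 + v.g * w.f / 243 * p ^ 4 + v.g * w.g / 729 * p ^ 5) * hp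

theorem prod13 : (V7.mk (-1) 0 (-1) 0 0 0 0).el * (V7.mk 1 (-1) (-1) 0 0 0 0).el *
   (V7.mk 2 (-1) (-2) 0 0 0 0).el * (V7.mk 1 0 0 1 0 0 (-1)).el = 13 * (V7.mk (-2) (-1) (-1) 0 2 0 0).el := by
  apply RingOfIntegers.ext
  simp only [V7.el, map_mul, map_add, map_intCast, omO_coe, om, jj, map_ofNat]
  simp
  have := hp
  grind

theorem prod41 : (V7.mk 1 0 1 0 (-1) 0 0).el * (V7.mk 2 0 (-2) (-1) 0 0 (-1)).el *
   (V7.mk (-4) (-1) (-2) (-1) 0 0 0).el * (V7.mk 1 0 0 0 0 (-1) (-1)).el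
   = 41 * (V7.mk 2 2 (-2) (-2) (-1) 0 0).el := by
  apply RingOfIntegers.ext
  simp only [V7.el, map_mul, map_add, map_intCast, omO_coe, om, jj, map_ofNat]
  simp
  have := hp
  grind

theorem prod11 : (V7.mk 1 0 (-1) 0 0 0 0).el * (V7.mk (-2) 1 2 0 1 0 (-1)).el *
   (V7.mk (-1) 1 0 0 (-1) 0 (-1)).el = 11 * (V7.mk (-2) (-1) 1 1 0 0 0).el := by
  apply RingOfIntegers.ext
  simp only [V7.el, map_mul, map_add, map_intCast, omO_coe, om, jj, map_ofNat]
  simp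
  have := hp
  grind

theorem pow_b2 : (V7.mk 2 1 0 0 (-2) 0 0).el ^ 7 =
    2 * (V7.mk (-246959) (-69160) 28392 71694 107660 12194 (-45591)).el := by
  apply RingOfIntegers.ext
  simp only [V7.el, map_mul, map_add, map_pow, map_intCast, omO_coe, om, jj, map_ofNat]
  simp
  have := hp
  grind

theorem pow_b3 : (V7.mk (-3) 2 1 (-2) 1 1 (-1)).el ^ 7 =
    3 * (V7.mk (-54493781) 10795736 31241707 (-14291634) (-12681340) 12749541 662466).el := by
  have e3 : (3 : 𝓞 L) = (V7.mk 3 0 0 0 0 0 0).el := by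
    apply RingOfIntegers.ext
    simp [V7.el, omO_coe, om, jj]
  rw [e3]
  simp only [pow_succ, pow_zero, one_mul, V7.el_mul]
  exact congrArg V7.el rfl

end C3
end

section
open Polynomial NumberField Matrix
namespace C3

theorem ex_row (q : ℕ) (hq : q.Prime) (h5 : 5 ≤ q) (hle : q ≤ 2476) (h7 : q % 7 ≠ 1) :
    ∃ t ∈ tab, t.1 = q := by
  have h := List.all_eq_true.1 q_ok (q - 5) (by simp; omega)
  rw [show q - 5 + 5 = q by omega, qck] at h
  rw [if_neg h7, Bool.or_eq_true] at h
  rcases h with h | h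
  · exfalso
    simp only [List.any_eq_true, List.mem_range, Bool.and_eq_true, beq_iff_eq, decide_eq_true_eq] at h
    obtain ⟨d, _, h1, h2⟩ := h
    rcases (Nat.dvd_prime hq).1 (Nat.dvd_of_mod_eq_zero h1) with h3 | h3 <;> omega
  · simpa [List.any_eq_true] using h

theorem ex_row' (q r : ℕ) (hq : q.Prime) (h5 : 5 ≤ q) (hle : q ≤ 2476) (h7 : q % 7 = 1)
    (hr : r < q) (hr7 : r ^ 7 % q = 162 % q) (h162 : 162 ^ ((q - 1) / 7) % q = 1) :
    ∃ t ∈ tab, t.1 = q ∧ t.2.1 = r := by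
  have h := List.all_eq_true.1 q_ok (q - 5) (by simp; omega)
  rw [show q - 5 + 5 = q by omega, qck] at h
  rw [if_pos h7, Bool.or_eq_true, Bool.or_eq_true] at h
  rcases h with h | h | h
  · exfalso
    simp only [List.any_eq_true, List.mem_range, Bool.and_eq_true, beq_iff_eq, decide_eq_true_eq] at h
    obtain ⟨d, _, h1, h2⟩ := h
    rcases (Nat.dvd_prime hq).1 (Nat.dvd_of_mod_eq_zero h1) with h3 | h3 <;> omega
  · simp [h162] at h
  · have h1 := List.all_eq_true.1 h r (by simpa using hr)
    simp only [bne_iff_ne, ne_eq, hr7, not_true_eq_false, Bool.or_eq_true, List.any_eq_true,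
      Bool.and_eq_true, beq_iff_eq, false_or] at h1
    obtain ⟨t, ht, h2⟩ := h1
    exact ⟨t, ht, h2⟩

theorem row_spec (t : ℕ × ℕ × V7) (ht : t ∈ tab) : t.2.2.nck (t.1 ^ 2) = true ∧
    t.2.2.ev t.2.1 % t.1 = 0 ∧ t.2.1 ^ 7 % t.1 = 162 % t.1 := by
  have h := List.all_eq_true.1 tab_ok t ht
  simp only [rowck, Bool.and_eq_true, beq_iff_eq, decide_eq_true_eq] at h
  exact ⟨h.1.1.1, h.1.1.2, h.1.2⟩

theorem nck_mono (v : V7) (B C : ℕ) (h : B ≤ C) (hv : v.nck B = true) : v.nck C = true := by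
  simp only [V7.nck, Bool.and_eq_true, decide_eq_true_eq] at hv ⊢
  refine ⟨hv.1, hv.2.trans_le ?_⟩
  gcongr

theorem hlist0 : ((List.range 50).all fun q => (List.range 5).all fun f =>
    q < 5 || f < 2 || 2476 < q ^ f || q ^ f % 7 != 1 ||
    ((List.range 47).any fun d => 2 ≤ d && q % d == 0 && d != q) ||
    q == 13 && f == 2 || q == 29 && f == 2 || q == 41 && f == 2 || q == 43 && f == 2 || q == 11 && f == 3)
    = true := by
  decide +kernel

theorem hlist (q : ℕ) (hq : q < 50) (f : ℕ) (hf : f < 5) (h1 : 5 ≤ q) (h2 : 2 ≤ f) (h3 : q ^ f ≤ 2476)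
    (h4 : q ^ f % 7 = 1) (h5 : ∀ d < 47, 2 ≤ d → q % d = 0 → d = q) :
    (q = 13 ∧ f = 2) ∨ (q = 29 ∧ f = 2) ∨ (q = 41 ∧ f = 2) ∨ (q = 43 ∧ f = 2) ∨ (q = 11 ∧ f = 3) := by
  have h := List.all_eq_true.1 (List.all_eq_true.1 hlist0 q (by simpa using hq)) f (by simpa using hf)
  simp only [Bool.or_eq_true, Bool.and_eq_true, decide_eq_true_eq, beq_iff_eq, bne_iff_ne,
    List.any_eq_true, List.mem_range] at h
  rcases h with ((((((((h | h) | h) | h) | h) | h) | h) | h) | h) | h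
  · omega
  · omega
  · omega
  · exact absurd h4 h
  · obtain ⟨d, hd, ⟨h6, h7⟩, h8⟩ := h
    exact absurd (h5 d hd h6 h7) h8
  · exact Or.inl h
  · exact Or.inr (Or.inl h)
  · exact Or.inr (Or.inr (Or.inl h))
  · exact Or.inr (Or.inr (Or.inr (Or.inl h)))
  · exact Or.inr (Or.inr (Or.inr (Or.inr h)))

theorem tab29 : ∀ r ∈ [8, 10, 12, 15, 18, 26, 27], (tab.any fun t => t.1 == 29 && t.2.1 == r) = true := by
  decide +kernel

theorem roots29 {k : Type*} [Field k] (π : k) (hπ7 : π ^ 7 = 162) (h29 : (29 : k) = 0) :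
    ∃ r ∈ [8, 10, 12, 15, 18, 26, 27], π = ((r : ℕ) : k) := by
  have hz : (π - 8) * (π - 10) * (π - 12) * (π - 15) * (π - 18) * (π - 26) * (π - 27) = 0 := by
    linear_combination hπ7 + ((-6274422) * π ^ 0 + (3175200) * π ^ 1 + (-668664) * π ^ 2 + (75924) * π ^ 3 + (-5018) * π ^ 4 + (193) * π ^ 5 + (-4) * π ^ 6) * h29
  simp only [mul_eq_zero, sub_eq_zero] at hz
  rcases hz with (((((hz | hz) | hz) | hz) | hz) | hz) | hz
  · exact ⟨8, by simp, by rw [hz]; norm_num⟩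
  · exact ⟨10, by simp, by rw [hz]; norm_num⟩
  · exact ⟨12, by simp, by rw [hz]; norm_num⟩
  · exact ⟨15, by simp, by rw [hz]; norm_num⟩
  · exact ⟨18, by simp, by rw [hz]; norm_num⟩
  · exact ⟨26, by simp, by rw [hz]; norm_num⟩
  · exact ⟨27, by simp, by rw [hz]; norm_num⟩

set_option maxHeartbeats 1000000 in
theorem small_elt (P : Ideal (𝓞 L)) (hP : P.IsPrime) (h0 : P ≠ ⊥) (hN : Ideal.absNorm P ≤ 2476) :
    ∃ v : V7, v.el ∈ P ∧ v.nck (Ideal.absNorm P ^ 2) = true := by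
  have hmax : P.IsMaximal := hP.isMaximal h0
  let _ : Field (𝓞 L ⧸ P) := Ideal.Quotient.field P
  have _ : Finite (𝓞 L ⧸ P) := Ideal.finiteQuotientOfFreeOfNeBot P h0
  let _ : Fintype (𝓞 L ⧸ P) := Fintype.ofFinite _
  obtain ⟨q, hcq⟩ := CharP.exists (𝓞 L ⧸ P)
  obtain ⟨f, hq, hcard⟩ := FiniteField.card (𝓞 L ⧸ P) q
  have hNc : Ideal.absNorm P = Fintype.card (𝓞 L ⧸ P) := by
    rw [Ideal.absNorm_apply, Submodule.cardQuot_apply, Nat.card_eq_fintype_card]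
  rw [hNc] at hN ⊢
  set N := Fintype.card (𝓞 L ⧸ P) with hNdef
  have hcast : ∀ m : ℕ, ((m : ℕ) : 𝓞 L) ∈ P ↔ q ∣ m := by
    intro m
    rw [← Ideal.Quotient.eq_zero_iff_mem, map_natCast, CharP.cast_eq_zero_iff (𝓞 L ⧸ P) q]
  have hqP : (q : 𝓞 L) ∈ P := (hcast q).2 dvd_rfl
  have hqN : q ≤ N := by rw [hcard]; exact Nat.le_self_pow f.ne_zero q
  have hq2 := hq.two_le
  by_cases hq5 : q < 5
  · have : q = 2 ∨ q = 3 := by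
      interval_cases q
      · simp
      · simp
      · exact absurd hq (by norm_num)
    rcases this with rfl | rfl
    · refine ⟨_, hP.mem_of_pow_mem 7 (pow_b2 ▸ Ideal.mul_mem_right _ _ (by exact_mod_cast hqP)), ?_⟩
      exact nck_mono _ 4 _ (by nlinarith) (by decide +kernel)
    · refine ⟨_, hP.mem_of_pow_mem 7 (pow_b3 ▸ Ideal.mul_mem_right _ _ (by exact_mod_cast hqP)), ?_⟩
      exact nck_mono _ 9 _ (by nlinarith) (by decide +kernel)
  push Not at hq5
  have h27 : (27 : 𝓞 L) ∉ P := by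
    intro h
    have h1 := (hcast 27).1 (by exact_mod_cast h)
    have h2 := hq.dvd_of_dvd_pow (show q ∣ 3 ^ 3 from h1)
    have := Nat.le_of_dvd (by norm_num) h2
    omega
  set π := Ideal.Quotient.mk P pO with hπ
  have hπ7 : π ^ 7 = 162 := by rw [hπ, ← map_pow, pO_pow]; exact map_ofNat _ 162
  have h162 : (162 : 𝓞 L ⧸ P) ≠ 0 := by
    intro h
    have h1 : ((162 : ℕ) : 𝓞 L ⧸ P) = 0 := by exact_mod_cast h
    rw [CharP.cast_eq_zero_iff (𝓞 L ⧸ P) q] at h1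
    have h2 : q ∣ 2 * 3 ^ 4 := h1
    rcases (Nat.Prime.dvd_mul hq).1 h2 with h3 | h3
    · have := Nat.le_of_dvd (by norm_num) h3; omega
    · have := Nat.le_of_dvd (by norm_num) (hq.dvd_of_dvd_pow h3); omega
  have hπ0 : π ≠ 0 := by
    intro h; rw [h] at hπ7; apply h162; rw [← hπ7]; simp
  have hfermat : π ^ (N - 1) = 1 := FiniteField.pow_card_sub_one_eq_one π hπ0
  have fin_row : ∀ t ∈ tab, t.1 = q → π = (t.2.1 : 𝓞 L ⧸ P) →
      ∃ v : V7, v.el ∈ P ∧ v.nck (N ^ 2) = true := by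
    intro t ht htq htr
    obtain ⟨h1, h2, h3⟩ := row_spec t ht
    refine ⟨t.2.2, mem_of_ev t.2.2 q t.2.1 hqP h27 ?_ ?_, nck_mono _ _ _ ?_ h1⟩
    · rw [← Ideal.Quotient.eq_zero_iff_mem, map_sub, map_natCast, ← htr, ← hπ, sub_self]
    · rw [← htq]; exact h2
    · rw [htq]; gcongr
  have hrow7 : ∀ t ∈ tab, t.1 = q → ((t.2.1 : 𝓞 L ⧸ P)) ^ 7 = 162 := by
    intro t ht htq
    obtain ⟨h1, h2, h3⟩ := row_spec t ht
    rw [htq] at h3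
    have := (CharP.natCast_eq_natCast (𝓞 L ⧸ P) q (a := t.2.1 ^ 7) (b := 162)).2 h3
    exact_mod_cast this
  by_cases hN7 : N % 7 = 1
  · by_cases hf : (f : ℕ) = 1
    · have hNq : N = q := by rw [hcard, hf, pow_one]
      have hsurj : ∃ r : ℕ, r < q ∧ π = (r : 𝓞 L ⧸ P) := by
        have _ : Fact q.Prime := ⟨hq⟩
        have hb : Function.Bijective (ZMod.castHom (dvd_refl q) (𝓞 L ⧸ P)) := by
          rw [Fintype.bijective_iff_injective_and_card]
          refine ⟨ZMod.castHom_injective _, ?_⟩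
          rw [ZMod.card, ← hNdef, hNq]
        obtain ⟨z, hz⟩ := hb.2 π
        refine ⟨z.val, ZMod.val_lt z, ?_⟩
        rw [← hz]
        conv_lhs => rw [← ZMod.natCast_zmod_val z]
        rw [map_natCast]
      obtain ⟨r, hrq, hr⟩ := hsurj
      have hr7 : r ^ 7 % q = 162 % q := by
        apply (CharP.natCast_eq_natCast (𝓞 L ⧸ P) q).1
        push_cast
        rw [← hr, hπ7]
      have h1 : 162 ^ ((q - 1) / 7) % q = 1 := by
        have : ((162 ^ ((q - 1) / 7) : ℕ) : 𝓞 L ⧸ P) = ((1 : ℕ) : 𝓞 L ⧸ P) := by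
          push_cast
          rw [← hπ7, ← pow_mul, Nat.mul_div_cancel' (by omega), ← hNq, hfermat]
        have := (CharP.natCast_eq_natCast (𝓞 L ⧸ P) q).1 this
        rw [this]; exact Nat.mod_eq_of_lt (by omega)
      obtain ⟨t, ht, h3, h4⟩ := ex_row' q r hq hq5 (by omega) (by omega) hrq hr7 h1
      exact fin_row t ht h3 (by rw [h4, hr])
    · have hf2 : 2 ≤ (f : ℕ) := by have := f.pos; omega
      have hq50 : q < 50 := by
        by_contra hc
        push Not at hc
        have : q ^ 2 ≤ N := by rw [hcard]; exact Nat.pow_le_pow_right (by omega) hf2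
        nlinarith
      have hf5 : (f : ℕ) < 5 := by
        by_contra hc
        push Not at hc
        have h1 : q ^ 5 ≤ N := by rw [hcard]; exact Nat.pow_le_pow_right (by omega) hc
        have h2 : 5 ^ 5 ≤ q ^ 5 := Nat.pow_le_pow_left hq5 5
        omega
      have hcases := hlist q hq50 f hf5 hq5 hf2 (by rw [← hcard]; exact hN) (by rw [← hcard]; exact hN7) (by
        intro d _ hd hqd
        rcases (Nat.dvd_prime hq).1 (Nat.dvd_of_mod_eq_zero hqd) with h | h <;> omega)
      rcases hcases with ⟨h1, h2⟩ | ⟨h1, h2⟩ | ⟨h1, h2⟩ | ⟨h1, h2⟩ | ⟨h1, h2⟩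
      · rw [h2, h1] at hcard
        have hm : (13 : 𝓞 L) ∈ P := by rw [h1] at hqP; exact_mod_cast hqP
        have hm2 := Ideal.mul_mem_right (V7.mk (-2) (-1) (-1) 0 2 0 0).el P hm
        rw [← prod13] at hm2
        rw [hcard]
        rcases hP.mem_or_mem hm2 with h | h
        · rcases hP.mem_or_mem h with h | h
          · rcases hP.mem_or_mem h with h | h
            · exact ⟨_, h, by decide +kernel⟩
            · exact ⟨_, h, by decide +kernel⟩
          · exact ⟨_, h, by decide +kernel⟩
        · exact ⟨_, h, by decide +kernel⟩
      · subst h1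
        have _ := hcq
        have key : ∃ r : ℕ, π = (r : 𝓞 L ⧸ P) ∧ ∃ t ∈ tab, t.1 = 29 ∧ t.2.1 = r := by
          have h29 : (29 : 𝓞 L ⧸ P) = 0 := by
            have := CharP.cast_eq_zero (𝓞 L ⧸ P) 29
            exact_mod_cast this
          have key2 := roots29 π hπ7 h29
          obtain ⟨r, hr, h3⟩ := key2
          refine ⟨r, h3, ?_⟩
          have := tab29 r hr
          simpa [List.any_eq_true] using this
        obtain ⟨r, hr, t, ht, h3, h4⟩ := key
        exact fin_row t ht h3 (by rw [h4, hr])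
      · rw [h2, h1] at hcard
        have hm : (41 : 𝓞 L) ∈ P := by rw [h1] at hqP; exact_mod_cast hqP
        have hm2 := Ideal.mul_mem_right (V7.mk 2 2 (-2) (-2) (-1) 0 0).el P hm
        rw [← prod41] at hm2
        rw [hcard]
        rcases hP.mem_or_mem hm2 with h | h
        · rcases hP.mem_or_mem h with h | h
          · rcases hP.mem_or_mem h with h | h
            · exact ⟨_, h, by decide +kernel⟩
            · exact ⟨_, h, by decide +kernel⟩
          · exact ⟨_, h, by decide +kernel⟩
        · exact ⟨_, h, by decide +kernel⟩
      · exfalso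
        rw [h2, h1] at hcard
        rw [hcard] at hfermat
        have h3 : ((162 ^ 264 : ℕ) : 𝓞 L ⧸ P) = ((1 : ℕ) : 𝓞 L ⧸ P) := by
          push_cast
          rw [← hπ7, ← pow_mul]; exact hfermat
        have := (CharP.natCast_eq_natCast (𝓞 L ⧸ P) q).1 h3
        rw [h1] at this
        revert this
        decide +kernel
      · rw [h2, h1] at hcard
        have hm : (11 : 𝓞 L) ∈ P := by rw [h1] at hqP; exact_mod_cast hqP
        have hm2 := Ideal.mul_mem_right (V7.mk (-2) (-1) 1 1 0 0 0).el P hm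
        rw [← prod11] at hm2
        rw [hcard]
        rcases hP.mem_or_mem hm2 with h | h
        · rcases hP.mem_or_mem h with h | h
          · exact ⟨_, h, by decide +kernel⟩
          · exact ⟨_, h, by decide +kernel⟩
        · exact ⟨_, h, by decide +kernel⟩
  · have hq7 : q % 7 ≠ 1 := by
      intro h; apply hN7; rw [hcard, Nat.pow_mod, h]; simp
    obtain ⟨t, ht, htq⟩ := ex_row q hq hq5 (by omega) hq7
    refine fin_row t ht htq ?_
    have h7 := hrow7 t ht htq
    set r := (t.2.1 : 𝓞 L ⧸ P) with hr
    have hr0 : r ≠ 0 := by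
      intro h; rw [h] at h7; apply h162; rw [← h7]; simp
    have hf2 : r ^ (N - 1) = 1 := FiniteField.pow_card_sub_one_eq_one r hr0
    have e1 : (π / r) ^ 7 = 1 := by rw [div_pow, hπ7, h7, div_self h162]
    have e2 : (π / r) ^ (N - 1) = 1 := by rw [div_pow, hfermat, hf2, div_one]
    have e3 := pow_gcd_eq_one.2 ⟨e1, e2⟩
    have hNpos : 1 < N := by omega
    have e4 : Nat.gcd 7 (N - 1) = 1 := by
      rw [← Nat.coprime_iff_gcd_eq_one, Nat.Prime.coprime_iff_not_dvd (by norm_num)]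
      omega
    rw [e4, pow_one] at e3
    exact (div_eq_one_iff_eq hr0).1 e3

end C3
end

section
open Polynomial NumberField Matrix
namespace C3

theorem principal_small : ∀ n : ℕ, ∀ I : Ideal (𝓞 L), I ≠ ⊥ → Ideal.absNorm I = n → n ≤ 2476 →
    Submodule.IsPrincipal I := by
  intro n
  induction n using Nat.strong_induction_on with
  | _ n ih =>
  intro I hI hn hle
  by_cases htop : I = ⊤
  · rw [htop]; exact top_isPrincipal
  obtain ⟨P, hPmax, hIP⟩ := Ideal.exists_le_maximal I htop
  have hP := hPmax.isPrime
  have hP0 : P ≠ ⊥ := fun h => hI (by rw [h] at hIP; exact le_bot_iff.1 hIP)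
  obtain ⟨Q, hQ⟩ := Ideal.dvd_iff_le.2 hIP
  have hQ0 : Q ≠ ⊥ := by rintro rfl; apply hI; rw [hQ, Ideal.mul_bot]
  have hmul : Ideal.absNorm P * Ideal.absNorm Q = n := by rw [← hn, hQ, map_mul]
  have hPpos : 1 < Ideal.absNorm P := by
    have h1 : Ideal.absNorm P ≠ 0 := by rwa [Ne, Ideal.absNorm_eq_zero_iff]
    have h2 : Ideal.absNorm P ≠ 1 := by rw [Ne, Ideal.absNorm_eq_one_iff]; exact hP.ne_top
    omega
  have hQpos : 0 < Ideal.absNorm Q := by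
    have h1 : Ideal.absNorm Q ≠ 0 := by rwa [Ne, Ideal.absNorm_eq_zero_iff]
    omega
  by_cases hQ1 : Q = ⊤
  · rw [hQ1, Ideal.mul_top] at hQ
    rw [hQ] at hn ⊢
    obtain ⟨v, hv, hck⟩ := small_elt P hP hP0 (by omega)
    obtain ⟨hv0, hvn⟩ := v.nck_spec _ hck
    obtain ⟨R, hR⟩ := Ideal.dvd_iff_le.2 ((Ideal.span_singleton_le_iff_mem P).2 hv)
    rw [hR, map_mul, pow_two] at hvn
    have hRn : Ideal.absNorm R < Ideal.absNorm P := lt_of_mul_lt_mul_left hvn (Nat.zero_le _)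
    have hR0 : R ≠ ⊥ := by
      rintro rfl
      rw [Ideal.mul_bot, Ideal.span_singleton_eq_bot] at hR
      exact hv0 hR
    obtain ⟨b, hb⟩ := ih _ (by omega) R hR0 rfl (by omega)
    rw [Ideal.submodule_span_eq] at hb
    have hvR : v.el ∈ R := by
      have : Ideal.span {v.el} ≤ R := Ideal.dvd_iff_le.1 ⟨P, by rw [mul_comm]; exact hR⟩
      exact this (Ideal.mem_span_singleton_self _)
    rw [hb, Ideal.mem_span_singleton] at hvR
    obtain ⟨c, hc⟩ := hvR
    refine ⟨c, ?_⟩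
    rw [Ideal.submodule_span_eq]
    rw [hb, hc, ← Ideal.span_singleton_mul_span_singleton, mul_comm] at hR
    rw [hb] at hR0
    exact (mul_right_cancel₀ hR0 hR).symm
  · have hQ2 : Ideal.absNorm Q ≠ 1 := by rwa [Ne, Ideal.absNorm_eq_one_iff]
    have hPn : Ideal.absNorm P < n := by
      rw [← hmul]; exact lt_mul_of_one_lt_right (by omega) (by omega)
    have hQn : Ideal.absNorm Q < n := by
      rw [← hmul]; exact lt_mul_of_one_lt_left (by omega) (by omega)
    obtain ⟨a, ha⟩ := ih _ hPn P hP0 rfl (by omega)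
    obtain ⟨b, hb⟩ := ih _ hQn Q hQ0 rfl (by omega)
    refine ⟨a * b, ?_⟩
    rw [hQ, ha, hb]
    simp [Ideal.span_singleton_mul_span_singleton]

theorem mink : (4 / Real.pi) ^ InfinitePlace.nrComplexPlaces L *
    ((Module.finrank ℚ L).factorial / (Module.finrank ℚ L : ℝ) ^ (Module.finrank ℚ L) * √|NumberField.discr L|) < 2477 := by
  rw [nrComplex, finrankL]
  have h1 : √(|NumberField.discr L| : ℝ) ≤ 196021 := by
    rw [Real.sqrt_le_left (by norm_num)]
    have : ((|NumberField.discr L| : ℤ) : ℝ) ≤ ((7 ^ 7 * 6 ^ 6 : ℤ) : ℝ) := by exact_mod_cast discr_le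
    push_cast at this
    refine this.trans (by norm_num)
  have h2 : 4 / Real.pi ≤ 4 / 3.1415 := by
    apply div_le_div_of_nonneg_left (by norm_num) (by norm_num)
    exact Real.pi_gt_d4.le
  have h3 : 0 ≤ 4 / Real.pi := by positivity
  calc _ ≤ (4 / 3.1415 : ℝ) ^ 3 * (((Nat.factorial 7 : ℕ) : ℝ) / ((7 : ℕ) : ℝ) ^ 7 * 196021) := by gcongr
    _ < 2477 := by norm_num [Nat.factorial]

instance pid : IsPrincipalIdealRing (𝓞 L) := by
  apply RingOfIntegers.isPrincipalIdealRing_of_isPrincipal_of_norm_le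
  intro I hI
  have h1 : (Ideal.absNorm (I : Ideal (𝓞 L)) : ℝ) < 2477 := lt_of_le_of_lt hI mink
  have h2 : Ideal.absNorm (I : Ideal (𝓞 L)) < 2477 := by exact_mod_cast h1
  exact principal_small _ _ (nonZeroDivisors.coe_ne_zero I) rfl (by omega)

end C3
end

section
open Polynomial NumberField
namespace C3

/-- finite places -/
abbrev Pl := IsDedekindDomain.HeightOneSpectrum (𝓞 L)

/-- the valuation -/
noncomputable abbrev vl (v : Pl) : Valuation L (WithZero (Multiplicative ℤ)) := v.valuation L

theorem vl_int (v : Pl) (n : ℤ) : vl v (n : L) ≤ 1 := by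
  have := v.valuation_le_one (K := L) (n : 𝓞 L)
  simpa using this

theorem vl_p_le (v : Pl) : vl v p ≤ 1 := by
  have := v.valuation_le_one (K := L) pO
  rw [← pO_coe]; exact this

/-- place above two -/
def A2 (v : Pl) : Prop := vl v 2 < 1

theorem A2_odd {v : Pl} (hv : A2 v) (n : ℤ) (hn : n % 2 = 1) : vl v (n : L) = 1 := by
  obtain ⟨m, rfl⟩ : ∃ m, n = 1 + 2 * m := ⟨n / 2, by omega⟩
  push_cast
  have : vl v (2 * (m : L)) < 1 := by
    rw [map_mul]
    exact mul_lt_one_of_lt_of_le hv (vl_int v m)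
  rw [Valuation.map_one_add_of_lt _ this]

theorem A2_two {v : Pl} (hv : A2 v) : vl v 2 = vl v p ^ 7 := by
  rw [← map_pow, hp, show (162 : L) = 2 * ((81 : ℤ) : L) by norm_num, map_mul, A2_odd hv 81 (by norm_num), mul_one]

theorem A2_p {v : Pl} (hv : A2 v) : vl v p < 1 := by
  by_contra h
  have h1 : vl v p = 1 := le_antisymm (vl_p_le v) (not_lt.1 h)
  have := A2_two hv
  rw [h1, one_pow] at this
  exact absurd this hv.ne

theorem vp_ne (v : Pl) : vl v p ≠ 0 := by
  rw [Valuation.ne_zero_iff]; exact p_ne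

/-- divisible by `p ^ k` locally -/
def D (k : ℤ) (x : L) : Prop := ∀ v, A2 v → vl v x ≤ vl v p ^ k

/-- exact order `k` -/
def E (k : ℤ) (x : L) : Prop := ∀ v, A2 v → vl v x = vl v p ^ k

theorem ex_A2 : ∃ v, A2 v := by
  have h2 : ¬ IsUnit (2 : 𝓞 L) := by
    intro h
    have h3 := h.map (Algebra.norm ℤ)
    have h4 : Algebra.norm ℤ (2 : 𝓞 L) = 2 ^ 7 := by
      have := Algebra.norm_algebraMap (S := 𝓞 L) (2 : ℤ)
      rw [RingOfIntegers.rank, finrankL] at this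
      simpa using this
    rw [h4, Int.isUnit_iff] at h3
    omega
  obtain ⟨M, hM, h⟩ := Ideal.exists_le_maximal (Ideal.span {(2 : 𝓞 L)}) (by
    rwa [Ne, Ideal.span_singleton_eq_top])
  have hm : (2 : 𝓞 L) ∈ M := h (Ideal.mem_span_singleton_self _)
  refine ⟨⟨M, hM.isPrime, ?_⟩, ?_⟩
  · rintro rfl
    simp at hm
  · unfold A2
    have := (IsDedekindDomain.HeightOneSpectrum.valuation_lt_one_iff_mem (K := L) ⟨M, hM.isPrime, by rintro rfl; simp at hm⟩ (2 : 𝓞 L)).2 hm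
    exact this

theorem E.d {k : ℤ} {x : L} (h : E k x) : D k x := fun v hv => (h v hv).le

theorem D.mono {k l : ℤ} {x : L} (h : D k x) (hl : l ≤ k) : D l x := fun v hv =>
  (h v hv).trans (zpow_le_zpow_right_of_le_one₀ (zero_lt_iff.2 (vp_ne v)) (A2_p hv).le hl)

theorem D.add {k : ℤ} {x y : L} (h : D k x) (h' : D k y) : D k (x + y) := fun v hv =>
  (Valuation.map_add_le _ (h v hv) (h' v hv))

theorem D.neg {k : ℤ} {x : L} (h : D k x) : D k (-x) := fun v hv => by
  rw [Valuation.map_neg]; exact h v hv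

theorem D.sub {k : ℤ} {x y : L} (h : D k x) (h' : D k y) : D k (x - y) := by
  rw [sub_eq_add_neg]; exact h.add h'.neg

theorem D.sub_comm {k : ℤ} {x y : L} (h : D k (x - y)) : D k (y - x) := by
  rw [← neg_sub]; exact h.neg

theorem D.mul {k l : ℤ} {x y : L} (h : D k x) (h' : D l y) : D (k + l) (x * y) := fun v hv => by
  rw [map_mul, zpow_add₀ (vp_ne v)]
  exact mul_le_mul' (h v hv) (h' v hv)

theorem E.mul {k l : ℤ} {x y : L} (h : E k x) (h' : E l y) : E (k + l) (x * y) := fun v hv => by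
  rw [map_mul, zpow_add₀ (vp_ne v), h v hv, h' v hv]

theorem E.inv {k : ℤ} {x : L} (h : E k x) : E (-k) x⁻¹ := fun v hv => by
  rw [map_inv₀, h v hv, zpow_neg]

theorem E.neg {k : ℤ} {x : L} (h : E k x) : E k (-x) := fun v hv => by
  rw [Valuation.map_neg]; exact h v hv

theorem E.div {k l : ℤ} {x y : L} (h : E k x) (h' : E l y) : E (k - l) (x / y) := by
  rw [div_eq_mul_inv, sub_eq_add_neg]; exact h.mul h'.inv

theorem D.div {k l : ℤ} {x y : L} (h : D k x) (h' : E l y) : D (k - l) (x / y) := by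
  rw [div_eq_mul_inv, sub_eq_add_neg]; exact h.mul h'.inv.d

theorem E.pow {k : ℤ} {x : L} (h : E k x) (n : ℕ) : E (n * k) (x ^ n) := fun v hv => by
  rw [map_pow, h v hv, ← zpow_natCast, ← zpow_mul, mul_comm]

theorem D.pow {k : ℤ} {x : L} (h : D k x) (n : ℕ) : D (n * k) (x ^ n) := fun v hv => by
  rw [map_pow, mul_comm, zpow_mul, zpow_natCast]
  exact pow_le_pow_left₀ zero_le (h v hv) n

theorem E.zpow {k : ℤ} {x : L} (h : E k x) (n : ℤ) : E (n * k) (x ^ n) := fun v hv => by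
  rw [map_zpow₀, h v hv, ← zpow_mul, mul_comm]

theorem D_zero (k : ℤ) : D k 0 := fun v _ => by simp

theorem D_int (n : ℤ) : D 0 (n : L) := fun v _ => by simpa using vl_int v n

theorem E_p : E 1 p := fun v _ => by simp

theorem E_pp (k : ℤ) : E k (p ^ k) := by simpa using E_p.zpow k

theorem E_two : E 7 (2 : L) := fun v hv => by
  rw [A2_two hv]; norm_cast

theorem E_odd (n : ℤ) (hn : n % 2 = 1) : E 0 (n : L) := fun v hv => by
  rw [A2_odd hv n hn, zpow_zero]

theorem E.ne {k : ℤ} {x : L} (h : E k x) : x ≠ 0 := by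
  obtain ⟨v, hv⟩ := ex_A2
  have h1 : vl v x ≠ 0 := by rw [h v hv]; exact zpow_ne_zero _ (vp_ne v)
  exact (Valuation.ne_zero_iff _).1 h1

theorem E.notD {k : ℤ} {x : L} (h : E k x) (h' : D (k + 1) x) : False := by
  obtain ⟨v, hv⟩ := ex_A2
  have h1 := h' v hv
  rw [h v hv] at h1
  have := zpow_lt_zpow_right_of_lt_one₀ (zero_lt_iff.2 (vp_ne v)) (A2_p hv) (show k < k + 1 by omega)
  exact absurd h1 (not_le.2 this)

theorem E.le {k l : ℤ} {x : L} (h : E k x) (h' : D l x) : l ≤ k := by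
  by_contra hc
  exact h.notD (h'.mono (by omega))

theorem E.uniq {k l : ℤ} {x : L} (h : E k x) (h' : E l x) : k = l :=
  le_antisymm (h'.le h.d) (h.le h'.d)

theorem E.addD {k l : ℤ} {x y : L} (h : E k x) (h' : D l y) (hl : k < l) : E k (x + y) := fun v hv => by
  rw [← h v hv]
  apply Valuation.map_add_eq_of_lt_left
  rw [h v hv]
  refine lt_of_le_of_lt (h' v hv) ?_
  exact zpow_lt_zpow_right_of_lt_one₀ (zero_lt_iff.2 (vp_ne v)) (A2_p hv) hl

theorem E.subD {k l : ℤ} {x y : L} (h : E k x) (h' : D l y) (hl : k < l) : E k (x - y) := by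
  rw [sub_eq_add_neg]; exact h.addD h'.neg hl

/-- leading term -/
def N (k : ℤ) (x : L) : Prop := D (k + 1) (x - p ^ k)

theorem N.e {k : ℤ} {x : L} (h : N k x) : E k x := by
  have := (E_pp k).addD h (by omega)
  rwa [add_sub_cancel] at this

theorem N.addD {k l : ℤ} {x y : L} (h : N k x) (h' : D l y) (hl : k < l) : N k (x + y) := by
  unfold N
  rw [add_sub_right_comm]
  exact D.add h (h'.mono (by omega))

theorem N_odd (n : ℤ) (hn : n % 2 = 1) : D 7 ((n : L) - 1) := by
  obtain ⟨m, rfl⟩ : ∃ m, n = 1 + 2 * m := ⟨n / 2, by omega⟩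
  push_cast
  rw [add_sub_cancel_left]
  have := E_two.d.mul (D_int m)
  simpa using this


theorem N.mul {k l : ℤ} {x y : L} (h : N k x) (h' : N l y) : N (k + l) (x * y) := by
  unfold N
  have e : x * y - p ^ (k + l) = x * (y - p ^ l) + p ^ l * (x - p ^ k) := by
    rw [zpow_add₀ p_ne]; ring
  rw [e]
  refine (D.add (D.mono (h.e.d.mul h') (by omega)) (D.mono ((E_pp l).d.mul h) (by omega)))

theorem N.inv {k : ℤ} {x : L} (h : N k x) : N (-k) x⁻¹ := by
  unfold N
  have hx := h.e.ne
  have hq := (E_pp k).ne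
  have e : x⁻¹ - p ^ (-k) = -((x - p ^ k) / (x * p ^ k)) := by
    rw [zpow_neg]; field_simp; ring
  rw [e]
  exact ((D.div h (h.e.mul (E_pp k))).neg).mono (by omega)

theorem N_one : N 0 1 := by
  unfold N; simpa using D_zero 1

theorem N.pow {k : ℤ} {x : L} (h : N k x) (n : ℕ) : N (n * k) (x ^ n) := by
  induction n with
  | zero => simpa using N_one
  | succ n ih =>
    have := ih.mul h
    rw [pow_succ]
    convert this using 1
    push_cast; ring

theorem N_two : N 7 (2 : L) := by
  unfold N
  rw [show p ^ (7 : ℤ) = 162 from hp]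
  have h := (E_two.pow 5).mul (E_odd (-5) (by norm_num))
  have h2 := h.d.mono (show (7 + 1 : ℤ) ≤ _ by norm_num)
  convert h2 using 1
  push_cast; norm_num

theorem N_oddI (n : ℤ) (hn : n % 2 = 1) : N 0 (n : L) := by
  unfold N
  simpa using (N_odd n hn).mono (show (1 : ℤ) ≤ 7 by norm_num)

theorem N_int (n : ℤ) (hn : n ≠ 0) : ∃ m : ℤ, N (7 * m) (n : L) := by
  obtain ⟨k, u, hu, rfl⟩ : ∃ k : ℕ, ∃ u : ℤ, u % 2 = 1 ∧ n = 2 ^ k * u := by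
    obtain ⟨u, hu, h⟩ := (Int.finiteMultiplicity_iff (a := 2) (b := n)).2 ⟨by norm_num, hn⟩ |>.exists_eq_pow_mul_and_not_dvd
    exact ⟨_, u, by omega, hu⟩
  refine ⟨k, ?_⟩
  have := (N_two.pow k).mul (N_oddI u hu)
  push_cast
  convert this using 1
  ring

theorem N_rat (a : ℚ) (ha : a ≠ 0) : ∃ m : ℤ, N (7 * m) (a : L) := by
  obtain ⟨m, hm⟩ := N_int a.num (Rat.num_ne_zero.2 ha)
  obtain ⟨l, hl⟩ := N_int a.den (by exact_mod_cast a.den_ne_zero)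
  refine ⟨m - l, ?_⟩
  have := hm.mul hl.inv
  convert this using 1
  · ring
  · rw [Rat.cast_def a]; push_cast; rw [div_eq_mul_inv]

theorem ex_N_aux (a : ℕ → ℚ) (j : ℕ) (hj : j ≤ 7) :
    (∑ i ∈ Finset.range j, (a i : L) * p ^ i) = 0 ∨
    ∃ k : ℤ, N k (∑ i ∈ Finset.range j, (a i : L) * p ^ i) ∧ k % 7 < j := by
  induction j with
  | zero => left; simp
  | succ j ih =>
    rw [Finset.sum_range_succ]
    by_cases h0 : a j = 0
    · rw [h0]
      rcases ih (by omega) with h | ⟨k, h, hk⟩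
      · left; rw [h]; simp
      · right; exact ⟨k, by simpa using h, by push_cast; omega⟩
    obtain ⟨m, hm⟩ := N_rat (a j) h0
    have hm2 : N (7 * m + j) ((a j : L) * p ^ j) := by
      have : N (j : ℤ) (p ^ j) := by
        unfold N; rw [zpow_natCast, sub_self]; exact D_zero _
      exact hm.mul this
    right
    rcases ih (by omega) with h | ⟨k, h, hk⟩
    · refine ⟨7 * m + j, ?_, by push_cast; omega⟩
      rw [h, zero_add]; exact hm2
    · rcases lt_trichotomy k (7 * m + j) with hlt | heq | hgt
      · exact ⟨k, h.addD hm2.e.d hlt, by push_cast; omega⟩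
      · omega
      · refine ⟨7 * m + j, ?_, by push_cast; omega⟩
        rw [add_comm (Finset.sum _ _)]
        exact hm2.addD h.e.d hgt

theorem ex_N (x : L) (hx : x ≠ 0) : ∃ k : ℤ, N k x := by
  obtain ⟨a, ha⟩ := repr7 x
  let b : ℕ → ℚ := fun i => if h : i < 7 then a ⟨i, h⟩ else 0
  have e : ∑ i ∈ Finset.range 7, (b i : L) * p ^ i = x := by
    rw [Finset.sum_range, ha]
    refine Finset.sum_congr rfl fun i _ => ?_
    have : b i = a i := by simp [b]
    rw [this]
  have h := ex_N_aux b 7 le_rfl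
  rw [e] at h
  rcases h with h | ⟨k, h, _⟩
  · exact absurd h hx
  · exact ⟨k, h⟩

theorem ex_E (x : L) (hx : x ≠ 0) : ∃ k : ℤ, E k x := by
  obtain ⟨k, h⟩ := ex_N x hx
  exact ⟨k, h.e⟩

theorem E.n {k : ℤ} {x : L} (h : E k x) : N k x := by
  obtain ⟨l, hl⟩ := ex_N x h.ne
  rwa [h.uniq hl.e]

theorem E.addE {k : ℤ} {x y : L} (h : E k x) (h' : E k y) : D (k + 1) (x + y) := by
  have h1 : D (k + 1) (2 * p ^ k) := (E_two.mul (E_pp k)).d.mono (by omega)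
  have := (D.add h.n h'.n).add h1
  convert this using 1
  ring

theorem E.subE {k : ℤ} {x y : L} (h : E k x) (h' : E k y) : D (k + 1) (x - y) := by
  rw [sub_eq_add_neg]; exact h.addE h'.neg

theorem D.cases {k : ℤ} {x : L} (h : D k x) : E k x ∨ D (k + 1) x := by
  by_cases hx : x = 0
  · right; rw [hx]; exact D_zero _
  obtain ⟨l, hl⟩ := ex_E x hx
  rcases (hl.le h).eq_or_lt with h1 | h1
  · left; rw [h1]; exact hl
  · right; exact hl.d.mono (by omega)

end C3
end

section
open Polynomial NumberField
namespace C3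

theorem ev_int (x : 𝓞 L) (hx : x ≠ 0) (h : ∀ v : Pl, ∃ c, vl v (x : L) = c ^ 2) :
    ∃ (u : (𝓞 L)ˣ) (g : 𝓞 L), x = u * g ^ 2 := by
  revert hx h
  induction x using (wellFounded_dvdNotUnit (α := 𝓞 L)).induction with
  | _ x ih =>
  intro hx h
  by_cases hu : IsUnit x
  · obtain ⟨u, rfl⟩ := hu
    exact ⟨u, 1, by simp⟩
  obtain ⟨q, hq, y, rfl⟩ := WfDvdMonoid.exists_irreducible_factor hu hx
  have hqp : Prime q := hq.prime
  have hq0 := hq.ne_zero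
  let v : Pl := ⟨Ideal.span {q}, (Ideal.span_singleton_prime hq0).2 hqp, by simpa using hq0⟩
  obtain ⟨c, hc⟩ := h v
  have hvq : vl v (q : L) = WithZero.exp (-1 : ℤ) := by
    rw [IsDedekindDomain.HeightOneSpectrum.valuation_of_algebraMap]
    exact v.intValuation_singleton hq0 rfl
  have hdiv : q ∣ y := by
    by_contra hn
    have hy : vl v (y : L) = 1 := by
      rw [IsDedekindDomain.HeightOneSpectrum.valuation_eq_one_iff_notMem, Ideal.mem_span_singleton]
      exact hn
    simp only [RingOfIntegers.coe_eq_algebraMap, map_mul] at hc hvq hy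
    rw [hvq, hy, mul_one] at hc
    have hc0 : c ≠ 0 := by rintro rfl; simp at hc
    obtain ⟨d, rfl⟩ : ∃ d : ℤ, c = WithZero.exp d := ⟨WithZero.log c, (WithZero.exp_log hc0).symm⟩
    rw [← WithZero.exp_nsmul, WithZero.exp_inj] at hc
    simp at hc
    omega
  obtain ⟨z, rfl⟩ := hdiv
  have hz0 : z ≠ 0 := by rintro rfl; simp at hx
  obtain ⟨u, g, hg⟩ := ih z ⟨hz0, q * q, fun hh => hq.not_isUnit (isUnit_of_mul_isUnit_left hh), by ring⟩ hz0 (by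
    intro w
    obtain ⟨c, hc⟩ := h w
    simp only [RingOfIntegers.coe_eq_algebraMap, map_mul] at hc
    have : vl w (q : L) ≠ 0 := by
      rw [Valuation.ne_zero_iff]; exact RingOfIntegers.coe_ne_zero_iff.2 hq0
    refine ⟨c / vl w (q : L), ?_⟩
    rw [div_pow, ← hc]
    field_simp)
  exact ⟨u, q * g, by rw [hg]; ring⟩

theorem ev_unit (x : L) (hx : x ≠ 0) (h : ∀ v : Pl, ∃ c, vl v x = c ^ 2) :
    ∃ (u : (𝓞 L)ˣ) (g : L), g ≠ 0 ∧ x = ((u : 𝓞 L) : L) * g ^ 2 := by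
  obtain ⟨a, b, hb, rfl⟩ := IsFractionRing.div_surjective (A := 𝓞 L) x
  have hb0 : b ≠ 0 := nonZeroDivisors.ne_zero hb
  have hbL : (b : L) ≠ 0 := RingOfIntegers.coe_ne_zero_iff.2 hb0
  have ha0 : a ≠ 0 := by rintro rfl; simp at hx
  obtain ⟨u, g, hg⟩ := ev_int (a * b) (mul_ne_zero ha0 hb0) (by
    intro v
    obtain ⟨c, hc⟩ := h v
    refine ⟨c * vl v (b : L), ?_⟩
    have : vl v (b : L) ≠ 0 := by
      rw [Valuation.ne_zero_iff]; exact hbL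
    rw [mul_pow, ← hc, map_div₀]
    simp only [RingOfIntegers.coe_eq_algebraMap, map_mul] at this ⊢
    field_simp)
  have h2 : (a : L) * b = ((u : 𝓞 L) : L) * (g : L) ^ 2 := by
    rw [← map_mul, hg]; simp
  have hg0 : (g : L) ≠ 0 := by
    intro h0
    rw [h0] at h2
    simp [ha0, hb0] at h2
  refine ⟨u, g / b, div_ne_zero hg0 hbL, ?_⟩
  field_simp
  linear_combination h2

end C3
end

section
open Polynomial NumberField
namespace C3

theorem sq_lev {h : L} {k : ℤ} (hk : k % 2 = 1) (hk2 : k < 14) (hd : D k (h ^ 2 - 1)) : D (k + 1) (h ^ 2 - 1) := by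
  have e : h ^ 2 - 1 = (h - 1) ^ 2 + 2 * (h - 1) := by ring
  by_cases h0 : h - 1 = 0
  · rw [e, h0]; simpa using D_zero _
  obtain ⟨i, hi⟩ := ex_E _ h0
  have h1 := hi.pow 2
  have h2 := E_two.mul hi
  rw [e] at hd ⊢
  push_cast at h1
  by_cases hi7 : i < 7
  · have h3 := h1.addD h2.d (by omega)
    have := h3.le hd
    exact h3.d.mono (by omega)
  · exact (h1.d.mono (by omega)).add (h2.d.mono (by omega))

theorem no_sq {h : L} {k : ℤ} (hk : k % 2 = 1 ∧ k < 14 ∨ k = 14) (hd : E k (h ^ 2 - 1)) : False := by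
  rcases hk with ⟨hk, hk2⟩ | rfl
  · exact hd.notD (sq_lev hk hk2 hd.d)
  have e : h ^ 2 - 1 = (h - 1) ^ 2 + 2 * (h - 1) := by ring
  by_cases h0 : h - 1 = 0
  · apply hd.ne; rw [e, h0]; simp
  obtain ⟨i, hi⟩ := ex_E _ h0
  have h1 := hi.pow 2
  have h2 := E_two.mul hi
  rw [e] at hd
  push_cast at h1
  rcases lt_trichotomy i 7 with hi7 | rfl | hi7
  · have h3 := h1.addD h2.d (by omega)
    have := h3.uniq hd
    omega
  · have h3 := hi.addE E_two
    have h4 := hi.d.mul h3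
    have h5 : (h - 1) ^ 2 + 2 * (h - 1) = (h - 1) * (h - 1 + 2) := by ring
    rw [h5] at hd
    exact hd.notD (h4.mono (by norm_num))
  · exact hd.notD ((h1.d.mono (by omega)).add (h2.d.mono (by omega)))

noncomputable def m1 : L := 25 + 51 * p - 148 / 3 * p ^ 2 + 32 * p ^ 3 - 16 * p ^ 4 + 58 / 9 * p ^ 5 - 53 / 27 * p ^ 6
noncomputable def m2 : L := 55 - 30 * p - 22 / 3 * p ^ 2 + 9 * p ^ 3 - 1 / 3 * p ^ 4 - 2 * p ^ 5 + 14 / 27 * p ^ 6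
noncomputable def m3 : L := -2903 - 3244 * p + 1376 * p ^ 2 + 1388 / 3 * p ^ 3 - 3794 / 9 * p ^ 4 - 155 / 9 * p ^ 5 + 2758 / 27 * p ^ 6

/-- integers in `p` are locally integral -/
theorem D_npow (n : ℕ) : D n (p ^ n) := by
  have := (E_pp n).d
  rwa [zpow_natCast] at this
theorem E_npow (n : ℕ) : E n (p ^ n) := by
  have := (E_pp n)
  rwa [zpow_natCast] at this

/-- local integers closed -/
theorem D0_add {x y : L} (h : D 0 x) (h' : D 0 y) : D 0 (x + y) := h.add h'
theorem D0_mul {x y : L} (h : D 0 x) (h' : D 0 y) : D 0 (x * y) := by simpa using h.mul h'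
theorem D0_p : D 0 p := E_p.d.mono (by norm_num)


/-- local check -/
def V7.dck (v : V7) (k : ℕ) : Bool :=
  v.a % 2 ^ ((k + 6) / 7) == 0 && v.b % 2 ^ ((k + 5) / 7) == 0 && v.c % 2 ^ ((k + 4) / 7) == 0 &&
  v.d % 2 ^ ((k + 3) / 7) == 0 && v.e % 2 ^ ((k + 2) / 7) == 0 && v.f % 2 ^ ((k + 1) / 7) == 0 &&
  v.g % 2 ^ (k / 7) == 0

theorem D_term (a : ℤ) (i j k : ℕ) (hj : k ≤ 7 * j + i) (h : a % 2 ^ j = 0) : D k ((a : L) * p ^ i) := by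
  obtain ⟨b, rfl⟩ := Int.dvd_of_emod_eq_zero h
  have := ((E_two.pow j).d.mul (D_int b)).mul (D_npow i)
  push_cast
  exact this.mono (by omega)

theorem V7.dpe (v : V7) (k : ℕ) (h : v.dck k = true) : D k v.pe := by
  simp only [V7.dck, Bool.and_eq_true, beq_iff_eq] at h
  obtain ⟨⟨⟨⟨⟨⟨h0, h1⟩, h2⟩, h3⟩, h4⟩, h5⟩, h6⟩ := h
  have t0 := D_term _ 0 _ k (by omega) h0
  have t1 := D_term _ 1 _ k (by omega) h1
  have t2 := D_term _ 2 _ k (by omega) h2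
  have t3 := D_term _ 3 _ k (by omega) h3
  have t4 := D_term _ 4 _ k (by omega) h4
  have t5 := D_term _ 5 _ k (by omega) h5
  have t6 := D_term _ 6 _ k (by omega) h6
  have := (((((t0.add t1).add t2).add t3).add t4).add t5).add t6
  rw [V7.pe]
  simpa using this

theorem D_of (k : ℕ) (t : ℤ) (ht : t % 2 = 1) (v : V7) {x : L}
    (h : (t : L) * x = v.pe) (hv : v.dck k = true) : D k x := by
  have h1 := (v.dpe k hv).div (E_odd t ht)
  rw [← h, mul_div_cancel_left₀ _ (E_odd t ht).ne] at h1
  simpa using h1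

theorem m1_lev : D 2 (m1 - 1 - p) := by
  refine D_of 2 27 (by norm_num) ⟨648, 1350, -1332, 864, -432, 174, -53⟩ ?_ (by decide)
  simp only [m1, V7.pe]; push_cast; ring

theorem m2_lev : D 4 (m2 - 1 - p ^ 3) := by
  refine D_of 4 27 (by norm_num) ⟨1458, -810, -198, 216, -9, -54, 14⟩ ?_ (by decide)
  simp only [m2, V7.pe]; push_cast; ring

theorem m3_lev : D 6 (m3 - 1 - p ^ 5) := by
  refine D_of 6 27 (by norm_num) ⟨-78408, -87588, 37152, 12492, -11382, -492, 2758⟩ ?_ (by decide)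
  simp only [m3, V7.pe]; push_cast; ring

theorem m4_lev : D 8 ((7 : L) - 1 - p ^ 7) := by
  refine D_of 8 1 (by norm_num) ⟨-156, 0, 0, 0, 0, 0, 0⟩ ?_ (by decide)
  simp only [hp, V7.pe]; push_cast; ring

theorem lev_E {m : L} {k : ℕ} (h : D (k + 1) (m - 1 - p ^ k)) : E k (m - 1) := by
  have := (E_npow k).addD h (by omega)
  simpa using this

/-- Selmer-type elements -/
def Sel (u : L) : Prop := ∃ n1 n2 n3 n4 g : L, (n1 = 1 ∨ n1 = m1) ∧ (n2 = 1 ∨ n2 = m2) ∧ (n3 = 1 ∨ n3 = m3) ∧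
  (n4 = 1 ∨ n4 = 7) ∧ g ≠ 0 ∧ u = n1 * n2 * n3 * n4 * g ^ 2

theorem choice_lev {m n : L} {k : ℤ} (hm : E k (m - 1)) (h : n = 1 ∨ n = m) : D k (n - 1) := by
  rcases h with rfl | rfl
  · simpa using D_zero _
  · exact hm.d

theorem unit_of_lev {n : L} {k : ℤ} (hk : 0 < k) (h : D k (n - 1)) : E 0 n := by
  have := N_one.e.addD h hk
  simpa using this

theorem lev_mul {m n : L} {k : ℤ} (hk : 0 < k) (h : D k (m - 1)) (h' : D k (n - 1)) : D k (m * n - 1) := by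
  have e : m * n - 1 = m * (n - 1) + (m - 1) := by ring
  rw [e]
  have := (unit_of_lev hk h).d.mul h'
  rw [zero_add] at this
  exact this.add h

/-- one step of the comparison -/
theorem sel_step {m n r h : L} {k l : ℤ} (hk : k % 2 = 1) (hk0 : 0 < k) (hk14 : k < 14) (hl : k < l) (hm : E k (m - 1)) (hn : n = 1 ∨ n = m)
    (hr : D l (r - 1)) (hh : D (k + 1) (n * r - h ^ 2)) : n = 1 := by
  rcases hn with rfl | rfl
  · rfl
  exfalso
  have e : n * r - 1 = (n - 1) + n * (r - 1) := by ring
  have h1 : E k (n * r - 1) := by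
    rw [e]
    refine hm.addD (l := l) ?_ hl
    simpa using (unit_of_lev hk0 hm.d).d.mul hr
  have h2 : E k (h ^ 2 - 1) := by
    have := h1.subD hh (by omega)
    convert this using 1
    ring
  exact h2.notD (sq_lev hk hk14 h2.d)

theorem sel_sq {u f e : L} (hu : Sel u) (h : u = f ^ 2 * (1 + e)) (he : D 8 e) : ∃ g, g ≠ 0 ∧ u = g ^ 2 := by
  obtain ⟨n1, n2, n3, n4, g, h1, h2, h3, h4, hg, rfl⟩ := hu
  have E1 : E 1 (m1 - 1) := lev_E (k := 1) (by simpa using m1_lev)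
  have E2 : E 3 (m2 - 1) := lev_E (k := 3) m2_lev
  have E3 : E 5 (m3 - 1) := lev_E (k := 5) m3_lev
  have E4 : E 7 ((7 : L) - 1) := lev_E (k := 7) m4_lev
  have d1 := choice_lev E1 h1
  have d2 := choice_lev E2 h2
  have d3 := choice_lev E3 h3
  have d4 := choice_lev E4 h4
  have d34 := lev_mul (by norm_num) d3 (d4.mono (by norm_num))
  have d234 := lev_mul (by norm_num) d2 (d34.mono (by norm_num))
  have d1234 := lev_mul (by norm_num) d1 (d234.mono (by norm_num))
  have u1 := unit_of_lev (by norm_num) d1234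
  have ue : E 0 (1 + e) := N_one.e.addD he (by norm_num)
  have hf : f ≠ 0 := by
    rintro rfl
    have := (unit_of_lev (by norm_num) d1234).ne
    apply mul_ne_zero this (pow_ne_zero 2 hg)
    linear_combination h
  have key : n1 * (n2 * (n3 * n4)) = (f / g) ^ 2 * (1 + e) := by
    field_simp
    linear_combination h
  have hfg : E 0 ((f / g) ^ 2) := by
    have := u1.div ue
    rw [key, mul_div_cancel_right₀ _ ue.ne] at this
    simpa using this
  have hh : D 8 (n1 * (n2 * (n3 * n4)) - (f / g) ^ 2) := by
    have e2 : n1 * (n2 * (n3 * n4)) - (f / g) ^ 2 = (f / g) ^ 2 * e := by rw [key]; ring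
    rw [e2]
    simpa using hfg.d.mul he
  have r1 := sel_step (by norm_num) (by norm_num) (by norm_num) (by norm_num) E1 h1 d234 (hh.mono (by norm_num))
  rw [r1, one_mul] at hh
  have r2 := sel_step (by norm_num) (by norm_num) (by norm_num) (by norm_num) E2 h2 d34 (hh.mono (by norm_num))
  rw [r2, one_mul] at hh
  have r3 := sel_step (by norm_num) (by norm_num) (by norm_num) (by norm_num) E3 h3 d4 (hh.mono (by norm_num))
  rw [r3, one_mul] at hh
  have r4 := sel_step (r := 1) (l := 8) (by norm_num) (by norm_num) (by norm_num) (by norm_num) E4 h4 (by simpa using D_zero _) (by simpa using hh)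
  exact ⟨g, hg, by rw [r1, r2, r3, r4]; ring⟩

/-- the contradiction used everywhere -/
theorem sel_absurd {u f e : L} {k : ℤ} (hu : Sel u) (hf : f ≠ 0) (h : u = f ^ 2 * (1 + e)) (he : E k e)
    (hk : k = 9 ∨ k = 11 ∨ k = 13 ∨ k = 14) : False := by
  obtain ⟨g, hg, hg2⟩ := sel_sq hu h (he.d.mono (by omega))
  refine no_sq (h := g / f) (k := k) (by omega) ?_
  have : (g / f) ^ 2 - 1 = e := by
    rw [div_pow, ← hg2, h]
    field_simp
    ring
  rwa [this]

theorem sel_mul_aux {m x y : L} (hm : m ≠ 0) (h : x = 1 ∨ x = m) (h' : y = 1 ∨ y = m) :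
    ∃ z g : L, (z = 1 ∨ z = m) ∧ g ≠ 0 ∧ x * y = z * g ^ 2 := by
  rcases h with rfl | rfl <;> rcases h' with rfl | rfl
  · exact ⟨1, 1, by simp, by simp, by simp⟩
  · exact ⟨y, 1, by simp, by simp, by simp⟩
  · exact ⟨x, 1, by simp, by simp, by simp⟩
  · exact ⟨1, y, by simp, hm, by ring⟩

theorem m1_ne : m1 ≠ 0 := (unit_of_lev (k := 1) (by norm_num) (lev_E (k := 1) (by simpa using m1_lev)).d).ne
theorem m2_ne : m2 ≠ 0 := (unit_of_lev (k := 3) (by norm_num) (lev_E (k := 3) m2_lev).d).ne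
theorem m3_ne : m3 ≠ 0 := (unit_of_lev (k := 5) (by norm_num) (lev_E (k := 5) m3_lev).d).ne

theorem Sel.mul {u v : L} (hu : Sel u) (hv : Sel v) : Sel (u * v) := by
  obtain ⟨n1, n2, n3, n4, g, h1, h2, h3, h4, hg, rfl⟩ := hu
  obtain ⟨k1, k2, k3, k4, f, h1', h2', h3', h4', hf, rfl⟩ := hv
  obtain ⟨z1, g1, hz1, hg1, e1⟩ := sel_mul_aux m1_ne h1 h1'
  obtain ⟨z2, g2, hz2, hg2, e2⟩ := sel_mul_aux m2_ne h2 h2'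
  obtain ⟨z3, g3, hz3, hg3, e3⟩ := sel_mul_aux m3_ne h3 h3'
  obtain ⟨z4, g4, hz4, hg4, e4⟩ := sel_mul_aux (by norm_num : (7 : L) ≠ 0) h4 h4'
  refine ⟨z1, z2, z3, z4, g1 * g2 * g3 * g4 * g * f, hz1, hz2, hz3, hz4, by simp [hg1, hg2, hg3, hg4, hg, hf], ?_⟩
  calc _ = (n1 * k1) * (n2 * k2) * (n3 * k3) * (n4 * k4) * g ^ 2 * f ^ 2 := by ring
    _ = _ := by rw [e1, e2, e3, e4]; ring

theorem Sel_seven : Sel 7 := ⟨1, 1, 1, 7, 1, by simp, by simp, by simp, by simp, by simp, by simp⟩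

end C3
end

section
open Polynomial NumberField
namespace C3

theorem el_one : (V7.mk 1 0 0 0 0 0 0).el = 1 := by
  apply RingOfIntegers.ext
  simp [V7.el, omO_coe, om, jj]

noncomputable def u1 : (𝓞 L)ˣ := Units.mkOfMulEqOne (V7.mk 25 51 (-148) 96 (-144) 58 (-53)).el
  (V7.mk 667771 322837 468229 226367 328315 158725 230208).el (by
    rw [V7.el_mul, ← el_one]; exact congrArg V7.el rfl)
noncomputable def u2 : (𝓞 L)ˣ := Units.mkOfMulEqOne (V7.mk 55 (-30) (-22) 27 (-3) (-18) 14).el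
  (V7.mk 705151 340908 494440 239039 346693 167610 243095).el (by
    rw [V7.el_mul, ← el_one]; exact congrArg V7.el rfl)
noncomputable def u3 : (𝓞 L)ˣ := Units.mkOfMulEqOne (V7.mk (-197) (-312) 339 146 (-332) (-31) 253).el
  (V7.mk 2815 1358 1971 956 1391 673 974).el (by
    rw [V7.el_mul, ← el_one]; exact congrArg V7.el rfl)

theorem u1_coe : ((u1 : 𝓞 L) : L) = m1 := by
  have := (V7.mk 25 51 (-148) 96 (-144) 58 (-53)).el_coe
  simp only [V7.sc, V7.pe] at this
  change ((V7.mk 25 51 (-148) 96 (-144) 58 (-53)).el : L) = m1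
  rw [m1]
  push_cast at this
  linear_combination this / 27

theorem u2_coe : ((u2 : 𝓞 L) : L) = m2 := by
  have := (V7.mk 55 (-30) (-22) 27 (-3) (-18) 14).el_coe
  simp only [V7.sc, V7.pe] at this
  change ((V7.mk 55 (-30) (-22) 27 (-3) (-18) 14).el : L) = m2
  rw [m2]
  push_cast at this
  linear_combination this / 27

theorem u3_coe : ((u3 : 𝓞 L) : L) * (1 + p + p ^ 2) ^ 2 = m3 := by
  have := (V7.mk (-197) (-312) 339 146 (-332) (-31) 253).el_coe
  simp only [V7.sc, V7.pe] at this
  change ((V7.mk (-197) (-312) 339 146 (-332) (-31) 253).el : L) * (1 + p + p ^ 2) ^ 2 = m3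
  rw [m3]
  push_cast at this
  have h := hp
  linear_combination this / 27 * (1 + p + p ^ 2) ^ 2 + ((253 * p ^ 3 + (2 * 253 - 93) * p ^ 2 - 423 * p - 451) / 27) * hp

open Classical in
/-- classes of units -/
theorem unit_cls : ∃ φ : (𝓞 L)ˣ → Bool × (Fin 3 → Bool), ∀ x y, φ x = φ y → ∃ g : (𝓞 L)ˣ, x * y = g ^ 2 := by
  have h := fun x => (Units.exist_unique_eq_mul_prod L x).exists
  choose f hf using h
  rw [← rankL]
  refine ⟨fun x => (decide (((f x).1 : (𝓞 L)ˣ) = 1), fun i => decide (Even ((f x).2 i))), ?_⟩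
  intro x y hxy
  simp only [Prod.mk.injEq, decide_eq_decide, funext_iff] at hxy
  obtain ⟨h1, h2⟩ := hxy
  have hodd : Odd (Module.finrank ℚ L) := by rw [finrankL]; decide
  have ht : (((f x).1 : (𝓞 L)ˣ)) * ((f y).1 : (𝓞 L)ˣ) = 1 := by
    rcases Units.torsion_eq_one_or_neg_one_of_odd_finrank hodd (f x).1 with hx | hx <;>
    rcases Units.torsion_eq_one_or_neg_one_of_odd_finrank hodd (f y).1 with hy | hy
    · rw [hx, hy, one_mul]
    · rw [h1.1 hx, hx, one_mul]
    · rw [h1.2 hy, hy, one_mul]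
    · rw [hx, hy]; simp
  have hev : ∀ i, ∃ k, (f x).2 i + (f y).2 i = 2 * k := by
    intro i
    have := h2 i
    have h3 : Even ((f x).2 i + (f y).2 i) := by
      rw [Int.even_add]; exact this
    exact h3.exists_two_nsmul.imp (by intro a ha; simpa using ha)
  choose k hk using hev
  refine ⟨∏ i, Units.fundSystem L i ^ k i, ?_⟩
  conv_lhs => rw [hf x, hf y]
  calc _ = (((f x).1 : (𝓞 L)ˣ) * ((f y).1 : (𝓞 L)ˣ)) * ((∏ i, Units.fundSystem L i ^ (f x).2 i) * ∏ i, Units.fundSystem L i ^ (f y).2 i) := by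
        simp only [mul_assoc, mul_left_comm, mul_comm]
    _ = _ := by
        rw [ht, one_mul, ← Finset.prod_mul_distrib, ← Finset.prod_pow]
        refine Finset.prod_congr rfl fun i _ => ?_
        rw [← zpow_add, hk, mul_comm, zpow_mul, zpow_ofNat]

noncomputable def mu (t : Bool × Bool × Bool × Bool) : (𝓞 L)ˣ :=
  (if t.1 then -1 else 1) * ((if t.2.1 then u1 else 1) * ((if t.2.2.1 then u2 else 1) * (if t.2.2.2 then u3 else 1)))

theorem σ_pe_pos (v : V7) (h : 0 < v.a ∧ 0 < v.b ∧ 0 < v.c ∧ 0 < v.d ∧ 0 < v.e ∧ 0 < v.f ∧ 0 < v.g) : 0 < σ (v.el : L) := by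
  have h1 := congrArg σ v.el_coe
  simp only [V7.pe, V7.sc, map_mul, map_add, map_pow, map_intCast, σp, map_ofNat] at h1
  obtain ⟨h2, h3, h4, h5, h6, h7, h8⟩ := h
  have hr := rr_pos
  have : 0 < 27 * σ (v.el : L) := by
    rw [h1]
    push_cast
    have : (0 : ℝ) < v.a ∧ (0 : ℝ) < v.b ∧ (0 : ℝ) < v.c ∧ (0 : ℝ) < v.d ∧ (0 : ℝ) < v.e ∧ (0 : ℝ) < v.f ∧ (0 : ℝ) < v.g := by
      exact ⟨by exact_mod_cast h2, by exact_mod_cast h3, by exact_mod_cast h4, by exact_mod_cast h5, by exact_mod_cast h6, by exact_mod_cast h7, by exact_mod_cast h8⟩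
    obtain ⟨h2, h3, h4, h5, h6, h7, h8⟩ := this
    positivity
  linarith

theorem σ_unit_pos (u : (𝓞 L)ˣ) (w : V7) (hw : 0 < w.a ∧ 0 < w.b ∧ 0 < w.c ∧ 0 < w.d ∧ 0 < w.e ∧ 0 < w.f ∧ 0 < w.g)
    (h : (u : 𝓞 L) * w.el = 1) : 0 < σ ((u : 𝓞 L) : L) := by
  have h1 : ((u : 𝓞 L) : L) * (w.el : L) = 1 := by
    have := congrArg (algebraMap (𝓞 L) L) h
    simpa using this
  have h2 := congrArg σ h1
  rw [map_mul, map_one] at h2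
  have h3 := σ_pe_pos w hw
  by_contra hc
  nlinarith

theorem σ_u1 : 0 < σ ((u1 : 𝓞 L) : L) :=
  σ_unit_pos u1 (V7.mk 667771 322837 468229 226367 328315 158725 230208) (by norm_num) (by
    rw [← Units.val_one (α := 𝓞 L), ← mul_inv_cancel u1]; rfl)
theorem σ_u2 : 0 < σ ((u2 : 𝓞 L) : L) :=
  σ_unit_pos u2 (V7.mk 705151 340908 494440 239039 346693 167610 243095) (by norm_num) (by
    rw [← Units.val_one (α := 𝓞 L), ← mul_inv_cancel u2]; rfl)
theorem σ_u3 : 0 < σ ((u3 : 𝓞 L) : L) :=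
  σ_unit_pos u3 (V7.mk 2815 1358 1971 956 1391 673 974) (by norm_num) (by
    rw [← Units.val_one (α := 𝓞 L), ← mul_inv_cancel u3]; rfl)

theorem σ_m1 : 0 < σ m1 := by rw [← u1_coe]; exact σ_u1
theorem σ_m2 : 0 < σ m2 := by rw [← u2_coe]; exact σ_u2

theorem sel_triv {n1 n2 n3 h : L} (h1 : n1 = 1 ∨ n1 = m1) (h2 : n2 = 1 ∨ n2 = m2) (h3 : n3 = 1 ∨ n3 = m3)
    (hh : n1 * (n2 * n3) = h ^ 2) : n1 = 1 ∧ n2 = 1 ∧ n3 = 1 := by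
  have E1 : E 1 (m1 - 1) := lev_E (k := 1) (by simpa using m1_lev)
  have E2 : E 3 (m2 - 1) := lev_E (k := 3) m2_lev
  have E3 : E 5 (m3 - 1) := lev_E (k := 5) m3_lev
  have d2 := choice_lev E2 h2
  have d3 := choice_lev E3 h3
  have d23 := lev_mul (by norm_num) d2 (d3.mono (by norm_num))
  have hz : ∀ k, D k (n1 * (n2 * n3) - h ^ 2) := fun k => by rw [hh, sub_self]; exact D_zero _
  have r1 := sel_step (by norm_num) (by norm_num) (by norm_num) (by norm_num) E1 h1 d23 (hz _)
  rw [r1, one_mul] at hz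
  have r2 := sel_step (by norm_num) (by norm_num) (by norm_num) (by norm_num) E2 h2 d3 (hz _)
  rw [r2, one_mul] at hz
  have r3 := sel_step (r := 1) (l := 8) (by norm_num) (by norm_num) (by norm_num) (by norm_num) E3 h3 (by simpa using D_zero _) (by simpa using hz _)
  exact ⟨r1, r2, r3⟩

theorem comp (s t : Bool) (m : L) : (if s then m else 1) * (if t then m else 1) =
    (if s = t then 1 else m) * (if s && t then m else 1) ^ 2 := by
  cases s <;> cases t <;> simp <;> ring

theorem mu_coe (t : Bool × Bool × Bool × Bool) : ((mu t : 𝓞 L) : L) =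
   (if t.1 then -1 else 1) * ((if t.2.1 then m1 else 1) * ((if t.2.2.1 then m2 else 1) * (if t.2.2.2 then ((u3 : 𝓞 L) : L) else 1))) := by
  simp only [mu, Units.val_mul, map_mul]
  rw [← u1_coe, ← u2_coe]
  congr 1
  · split_ifs <;> simp
  congr 1
  · split_ifs <;> simp
  congr 1
  · split_ifs <;> simp
  · split_ifs <;> simp

theorem m1_ne_one : m1 ≠ 1 := by
  intro h
  have E1 : E 1 (m1 - 1) := lev_E (k := 1) (by simpa using m1_lev)
  exact E1.ne (by rw [h, sub_self])
theorem m2_ne_one : m2 ≠ 1 := by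
  intro h
  have E1 : E 3 (m2 - 1) := lev_E (k := 3) m2_lev
  exact E1.ne (by rw [h, sub_self])
theorem m3_ne_one : m3 ≠ 1 := by
  intro h
  have E1 : E 5 (m3 - 1) := lev_E (k := 5) m3_lev
  exact E1.ne (by rw [h, sub_self])

theorem mu_indep (s t : Bool × Bool × Bool × Bool) (g : (𝓞 L)ˣ) (h : mu s * mu t = g ^ 2) : s = t := by
  have h1 : ((mu s : 𝓞 L) : L) * ((mu t : 𝓞 L) : L) = ((g : 𝓞 L) : L) ^ 2 := by
    have := congrArg (fun x : (𝓞 L)ˣ => ((x : 𝓞 L) : L)) h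
    simpa using this
  rw [mu_coe, mu_coe] at h1
  obtain ⟨s1, s2, s3, s4⟩ := s
  obtain ⟨t1, t2, t3, t4⟩ := t
  simp only at h1
  have c1 := comp s1 t1 (-1)
  have c2 := comp s2 t2 m1
  have c3 := comp s3 t3 m2
  have c4 := comp s4 t4 ((u3 : 𝓞 L) : L)
  set G2 : L := (if (s2 && t2) = true then m1 else 1) with hG2
  set G3 : L := (if (s3 && t3) = true then m2 else 1) with hG3
  set G4 : L := (if (s4 && t4) = true then ((u3 : 𝓞 L) : L) else 1) with hG4
  have hG1 : (if (s1 && t1) = true then (-1 : L) else 1) ^ 2 = 1 := by split_ifs <;> simp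
  have G2n : G2 ≠ 0 := by rw [hG2]; split_ifs <;> simp [m1_ne]
  have G3n : G3 ≠ 0 := by rw [hG3]; split_ifs <;> simp [m2_ne]
  have G4n : G4 ≠ 0 := by rw [hG4]; split_ifs <;> simp
  rw [hG1, mul_one] at c1
  have hprod : (if s1 = t1 then (1 : L) else -1) * ((if s2 = t2 then 1 else m1) * ((if s3 = t3 then 1 else m2) * (if s4 = t4 then 1 else ((u3 : 𝓞 L) : L)))) = (((g : 𝓞 L) : L) / (G2 * G3 * G4)) ^ 2 := by
    rw [div_pow, eq_div_iff (by simp [G2n, G3n, G4n]), ← h1]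
    linear_combination (-1 : L) * (((if s2 = true then m1 else 1) * if t2 = true then m1 else 1) * (((if s3 = true then m2 else 1) * if t3 = true then m2 else 1) * ((if s4 = true then ((u3 : 𝓞 L) : L) else 1) * if t4 = true then ((u3 : 𝓞 L) : L) else 1))) * c1
      - (if s1 = t1 then (1 : L) else -1) * (((if s3 = true then m2 else 1) * if t3 = true then m2 else 1) * ((if s4 = true then ((u3 : 𝓞 L) : L) else 1) * if t4 = true then ((u3 : 𝓞 L) : L) else 1)) * c2
      - (if s1 = t1 then (1 : L) else -1) * (if s2 = t2 then 1 else m1) * G2 ^ 2 * ((if s4 = true then ((u3 : 𝓞 L) : L) else 1) * if t4 = true then ((u3 : 𝓞 L) : L) else 1) * c3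
      - (if s1 = t1 then (1 : L) else -1) * (if s2 = t2 then 1 else m1) * G2 ^ 2 * (if s3 = t3 then 1 else m2) * G3 ^ 2 * c4
  set gg := (((g : 𝓞 L) : L) / (G2 * G3 * G4)) with hgg
  have hs1 : s1 = t1 := by
    by_contra hne
    rw [if_neg hne] at hprod
    have := congrArg σ hprod
    rw [map_mul, map_mul, map_mul, map_pow, map_neg, map_one] at this
    have p1 : 0 < σ (if s2 = t2 then 1 else m1) := by split_ifs; simp; exact σ_m1
    have p2 : 0 < σ (if s3 = t3 then 1 else m2) := by split_ifs; simp; exact σ_m2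
    have p3 : 0 < σ (if s4 = t4 then 1 else ((u3 : 𝓞 L) : L)) := by split_ifs; simp; exact σ_u3
    have p4 := mul_pos p1 (mul_pos p2 p3)
    have p5 := sq_nonneg (σ gg)
    linarith
  rw [if_pos hs1, one_mul] at hprod
  have hprod2 : (if s2 = t2 then 1 else m1) * ((if s3 = t3 then 1 else m2) * (if s4 = t4 then 1 else m3)) = (gg * (if s4 = t4 then 1 else (1 + p + p ^ 2))) ^ 2 := by
    rw [mul_pow, ← hprod, ← u3_coe]
    split_ifs <;> ring
  have hr := sel_triv (by split_ifs <;> simp) (by split_ifs <;> simp) (by split_ifs <;> simp) hprod2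
  obtain ⟨r1, r2, r3⟩ := hr
  have hs2 : s2 = t2 := by
    by_contra hne; rw [if_neg hne] at r1; exact m1_ne_one r1
  have hs3 : s3 = t3 := by
    by_contra hne; rw [if_neg hne] at r2; exact m2_ne_one r2
  have hs4 : s4 = t4 := by
    by_contra hne; rw [if_neg hne] at r3; exact m3_ne_one r3
  rw [hs1, hs2, hs3, hs4]

theorem unit_gen (u : (𝓞 L)ˣ) : ∃ t, ∃ g : (𝓞 L)ˣ, u * mu t = g ^ 2 := by
  obtain ⟨φ, hφ⟩ := unit_cls
  have inj : Function.Injective (φ ∘ mu) := by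
    intro s t h
    obtain ⟨g, hg⟩ := hφ _ _ h
    exact mu_indep s t g hg
  have bij := (Fintype.bijective_iff_injective_and_card (φ ∘ mu)).2 ⟨inj, by simp⟩
  obtain ⟨t, ht⟩ := bij.surjective (φ u)
  obtain ⟨g, hg⟩ := hφ _ _ ht.symm
  exact ⟨t, g, hg⟩

/-- positive elements with even valuations are in the Selmer set (without seven) -/
theorem sel_of_even (x : L) (hx : x ≠ 0) (hpos : 0 < σ x) (h : ∀ v : Pl, ∃ c, vl v x = c ^ 2) :
    ∃ n1 n2 n3 g : L, (n1 = 1 ∨ n1 = m1) ∧ (n2 = 1 ∨ n2 = m2) ∧ (n3 = 1 ∨ n3 = m3) ∧ g ≠ 0 ∧ x = n1 * n2 * n3 * g ^ 2 := by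
  obtain ⟨u, g, hg, rfl⟩ := ev_unit x hx h
  obtain ⟨⟨t1, t2, t3, t4⟩, f, hf⟩ := unit_gen u
  have h1 : ((u : 𝓞 L) : L) * ((mu (t1, t2, t3, t4) : 𝓞 L) : L) = ((f : 𝓞 L) : L) ^ 2 := by
    have := congrArg (fun x : (𝓞 L)ˣ => ((x : 𝓞 L) : L)) hf
    simpa using this
  rw [mu_coe] at h1
  simp only at h1
  have fn : ((f : 𝓞 L) : L) ≠ 0 := by simp
  set n1 : L := if t2 = true then m1 else 1 with hn1
  set n2 : L := if t3 = true then m2 else 1 with hn2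
  set n3 : L := if t4 = true then ((u3 : 𝓞 L) : L) else 1 with hn3
  have p1 : 0 < σ n1 := by rw [hn1]; split_ifs; exact σ_m1; simp
  have p2 : 0 < σ n2 := by rw [hn2]; split_ifs; exact σ_m2; simp
  have p3 : 0 < σ n3 := by rw [hn3]; split_ifs; exact σ_u3; simp
  have n1n : n1 ≠ 0 := by rintro h0; rw [h0] at p1; simp at p1
  have n2n : n2 ≠ 0 := by rintro h0; rw [h0] at p2; simp at p2
  have n3n : n3 ≠ 0 := by rintro h0; rw [h0] at p3; simp at p3
  have ht1 : t1 = false := by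
    by_contra hne
    simp only [Bool.not_eq_false] at hne
    rw [if_pos hne] at h1
    have := congrArg σ h1
    rw [map_mul, map_mul, map_mul, map_mul, map_pow, map_neg, map_one] at this
    rw [map_mul, map_pow] at hpos
    have hgp : 0 < σ g ^ 2 := by
      have : σ g ≠ 0 := by simpa using hg
      positivity
    have hu : 0 < σ ((u : 𝓞 L) : L) := by
      by_contra hc; push Not at hc; nlinarith
    have p4 := mul_pos hu (mul_pos p1 (mul_pos p2 p3))
    have p5 := sq_nonneg (σ ((f : 𝓞 L) : L))
    linarith
  simp only [ht1, Bool.false_eq_true, if_false, one_mul] at h1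
  refine ⟨n1, n2, (if t4 = true then m3 else 1), ((f : 𝓞 L) : L) * g / (n1 * n2 * n3 * (if t4 = true then (1 + p + p ^ 2) else 1)),
    by rw [hn1]; split_ifs <;> simp, by rw [hn2]; split_ifs <;> simp, by split_ifs <;> simp, ?_, ?_⟩
  · have : (if t4 = true then (1 + p + p ^ 2) else 1) ≠ 0 := by
      split_ifs
      · intro h0
        have := u3_coe
        rw [h0] at this
        apply m3_ne
        rw [← this]; simp
      · simp
    exact div_ne_zero (mul_ne_zero fn hg) (mul_ne_zero (mul_ne_zero (mul_ne_zero n1n n2n) n3n) this)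
  · have key : (if t4 = true then m3 else 1) = n3 * (if t4 = true then (1 + p + p ^ 2) else 1) ^ 2 := by
      rw [hn3, ← u3_coe]; split_ifs <;> ring
    have qn : (if t4 = true then (1 + p + p ^ 2) else 1) ≠ 0 := by
      intro h0
      rw [h0] at key
      split_ifs at key with h4
      · apply m3_ne; rw [key]; simp
      · simp at key
    rw [key]
    field_simp
    linear_combination h1

end C3
end

section
open Polynomial NumberField
namespace C3

theorem vl_exp {v : Pl} {x : L} (hx : x ≠ 0) : ∃ k : ℤ, vl v x = WithZero.exp k :=
  ⟨WithZero.log (vl v x), (WithZero.exp_log ((Valuation.ne_zero_iff _).2 hx)).symm⟩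

theorem exp_even (k : ℤ) (hk : k % 2 = 0) : ∃ c : WithZero (Multiplicative ℤ), WithZero.exp k = c ^ 2 := by
  refine ⟨WithZero.exp (k / 2), ?_⟩
  rw [← WithZero.exp_nsmul, WithZero.exp_inj]
  simp; omega

noncomputable def b7 : 𝓞 L := (V7.mk 1 1 1 0 0 0 0).el
noncomputable def u7 : (𝓞 L)ˣ := Units.mkOfMulEqOne (V7.mk 1009 515 622 207 219 122 263).el
  (V7.mk (-60401) 14477 4517 (-14086) 33646 (-19434) 27198).el (by
    rw [V7.el_mul, ← el_one]; exact congrArg V7.el rfl)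

theorem el_seven : (V7.mk 7 0 0 0 0 0 0).el = 7 := by
  apply RingOfIntegers.ext
  simp [V7.el, omO_coe, om, jj]

theorem b7_pow : b7 ^ 7 = 7 * (u7 : 𝓞 L) := by
  change (V7.mk 1 1 1 0 0 0 0).el ^ 7 = 7 * (V7.mk 1009 515 622 207 219 122 263).el
  rw [← el_seven]
  simp only [pow_succ, pow_zero, one_mul, V7.el_mul]
  exact congrArg V7.el rfl

theorem b7_norm : Ideal.absNorm (Ideal.span {b7}) = 7 := by
  rw [Ideal.absNorm_span_singleton]
  have h := congrArg (fun x => (Algebra.norm ℤ x).natAbs) b7_pow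
  simp only [map_pow, map_mul, Int.natAbs_pow, Int.natAbs_mul] at h
  have h1 : (Algebra.norm ℤ (u7 : 𝓞 L)).natAbs = 1 := by
    have := (u7.isUnit).map (Algebra.norm ℤ)
    exact Int.isUnit_iff_natAbs_eq.1 this
  have h4 : Algebra.norm ℤ (7 : 𝓞 L) = 7 ^ 7 := by
    have := Algebra.norm_algebraMap (S := 𝓞 L) (7 : ℤ)
    rw [RingOfIntegers.rank, finrankL] at this
    simpa using this
  rw [h1, h4, mul_one, Int.natAbs_pow] at h
  exact Nat.pow_left_injective (by norm_num : 7 ≠ 0) h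

theorem b7_ne : b7 ≠ 0 := by
  intro h
  have := b7_norm
  rw [h] at this
  simp at this

theorem b7_prime : (Ideal.span {b7}).IsPrime := by
  apply Ideal.isPrime_of_irreducible_absNorm
  rw [b7_norm]
  exact (by norm_num : Nat.Prime 7)

theorem A7_span {v : Pl} (hv : vl v 7 < 1) : v.asIdeal = Ideal.span {b7} := by
  have h7 : (7 : 𝓞 L) ∈ v.asIdeal := by
    rw [← IsDedekindDomain.HeightOneSpectrum.valuation_lt_one_iff_mem (K := L)]
    have e : algebraMap (𝓞 L) L (7 : 𝓞 L) = 7 := by simp only [map_ofNat]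
    change vl v (algebraMap (𝓞 L) L (7 : 𝓞 L)) < 1
    rw [e]; exact hv
  have hb : b7 ∈ v.asIdeal := by
    apply v.isPrime.mem_of_pow_mem 7
    rw [b7_pow]
    exact Ideal.mul_mem_right _ _ h7
  have hm := b7_prime.isMaximal (by simpa using b7_ne)
  exact (hm.eq_of_le v.isPrime.ne_top (by rwa [Ideal.span_singleton_le_iff_mem])).symm

theorem A7_val {v : Pl} (hv : vl v 7 < 1) : vl v 7 = WithZero.exp (-7 : ℤ) := by
  have h := A7_span hv
  have hvq : vl v (b7 : L) = WithZero.exp (-1 : ℤ) := by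
    rw [IsDedekindDomain.HeightOneSpectrum.valuation_of_algebraMap]
    exact v.intValuation_singleton b7_ne h
  have hu : vl v ((u7 : 𝓞 L) : L) = 1 := by
    rw [IsDedekindDomain.HeightOneSpectrum.valuation_eq_one_iff_notMem]
    intro hh
    exact v.isPrime.ne_top (Ideal.eq_top_of_isUnit_mem _ hh u7.isUnit)
  have e := congrArg (fun x : 𝓞 L => vl v (x : L)) b7_pow
  simp only [RingOfIntegers.coe_eq_algebraMap, map_mul, map_pow, map_ofNat] at e hvq hu
  rw [hvq, hu, mul_one, ← WithZero.exp_nsmul] at e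
  simp at e
  rw [← e, WithZero.exp_neg]

theorem A7_uniq {v w : Pl} (hv : vl v 7 < 1) (hw : vl w 7 < 1) : v = w := by
  apply IsDedekindDomain.HeightOneSpectrum.ext
  rw [A7_span hv, A7_span hw]

/-- Selmer classes from positivity and parity -/
theorem sel_of (x : L) (hx : x ≠ 0) (hpos : 0 < σ x) (h2 : ∃ k : ℤ, k % 2 = 0 ∧ E k x)
    (h : ∀ v : Pl, ¬ vl v 2 < 1 → ¬ vl v 7 < 1 → ∃ c, vl v x = c ^ 2) : Sel x := by
  obtain ⟨k, hk, hE⟩ := h2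
  have hev : ∀ v : Pl, ¬ vl v 7 < 1 → ∃ c, vl v x = c ^ 2 := by
    intro v h7
    by_cases hv : vl v 2 < 1
    · refine ⟨vl v p ^ (k / 2), ?_⟩
      rw [hE v hv, ← zpow_natCast, ← zpow_mul]
      congr 1; push_cast; omega
    · exact h v hv h7
  have hs : (1 : WithZero (Multiplicative ℤ)) = 1 ^ 2 := by simp
  by_cases hall : ∀ v : Pl, vl v 7 < 1 → ∃ c, vl v x = c ^ 2
  · obtain ⟨n1, n2, n3, g, h1, h2, h3, hg, e⟩ := sel_of_even x hx hpos (fun v => by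
      by_cases h7 : vl v 7 < 1
      · exact hall v h7
      · exact hev v h7)
    exact ⟨n1, n2, n3, 1, g, h1, h2, h3, by simp, hg, by rw [e]; ring⟩
  · push Not at hall
    obtain ⟨w, hw, hc⟩ := hall
    obtain ⟨n1, n2, n3, g, h1, h2, h3, hg, e⟩ := sel_of_even (7 * x) (mul_ne_zero (by norm_num) hx)
      (by rw [map_mul, map_ofNat]; positivity) (fun v => by
      rw [map_mul]
      by_cases h7 : vl v 7 < 1
      · rw [A7_uniq h7 hw, A7_val hw]
        obtain ⟨k, hk⟩ := vl_exp (v := w) hx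
        rw [hk, ← WithZero.exp_add]
        apply exp_even
        by_contra hodd
        obtain ⟨c, hcc⟩ := exp_even k (by omega)
        exact hc c (by rw [hk, hcc])
      · obtain ⟨c, hc⟩ := hev v h7
        refine ⟨c, ?_⟩
        have : vl v 7 = 1 := le_antisymm (by simpa using vl_int v 7) (not_lt.1 h7)
        rw [this, one_mul, hc])
    exact ⟨n1, n2, n3, 7, g / 7, h1, h2, h3, by simp, by simpa using hg, by
      linear_combination e / 7⟩

theorem sel_quad (x w : L) (b c : ℤ) (hx : x ≠ 0) (hpos : 0 < σ x) (h2 : ∃ k : ℤ, k % 2 = 0 ∧ E k x)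
    (hc : ∃ a : ℕ, c = 2 ^ a * 7 ∨ c = - (2 ^ a * 7)) (h : x * w ^ 2 = x ^ 2 + b * x + c) : Sel x := by
  refine sel_of x hx hpos h2 fun v hv2 hv7 => ?_
  have e2 : vl v 2 = 1 := le_antisymm (by simpa using vl_int v 2) (not_lt.1 hv2)
  have e7 : vl v 7 = 1 := le_antisymm (by simpa using vl_int v 7) (not_lt.1 hv7)
  have ec : vl v (c : L) = 1 := by
    obtain ⟨a, rfl | rfl⟩ := hc
    · push_cast; simp [e2, e7]
    · push_cast; rw [Valuation.map_neg]; simp [e2, e7]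
  have hb := vl_int v b
  have hv := congrArg (vl v) h
  rw [map_mul, map_pow] at hv
  have hx0 : vl v x ≠ 0 := (Valuation.ne_zero_iff _).2 hx
  rcases lt_trichotomy (vl v x) 1 with hlt | heq | hgt
  · have h1 : vl v (x ^ 2 + b * x) < vl v (c : L) := by
      rw [ec, show x ^ 2 + b * x = x * (x + b) by ring, map_mul]
      refine mul_lt_one_of_lt_of_le hlt ?_
      exact Valuation.map_add_le _ hlt.le hb
    rw [Valuation.map_add_eq_of_lt_right _ h1, ec] at hv
    refine ⟨(vl v w)⁻¹, ?_⟩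
    rw [inv_pow]
    exact eq_inv_of_mul_eq_one_left hv
  · exact ⟨1, by rw [heq]; simp⟩
  · have h1 : vl v (b * x + c) < vl v (x ^ 2) := by
      rw [map_pow]
      have h3 : vl v (b * x + c) ≤ vl v x := by
        refine Valuation.map_add_le _ ?_ (ec.le.trans hgt.le)
        rw [map_mul]; exact mul_le_of_le_one_left' hb
      refine lt_of_le_of_lt h3 ?_
      rw [sq]
      exact lt_mul_of_one_lt_left (zero_lt_iff.2 hx0) hgt
    rw [add_assoc, Valuation.map_add_eq_of_lt_left _ h1, map_pow, sq (vl v x)] at hv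
    exact ⟨vl v w, (mul_left_cancel₀ hx0 hv).symm⟩

/-- pairs describing points of the curve -/
def Pt (U w : L) : Prop := U ≠ 0 ∧ U * w ^ 2 = U ^ 2 + 21 * U + 112

theorem Pt.pos {U w : L} (h : Pt U w) : 0 < σ U := by
  have h1 := congrArg σ h.2
  simp only [map_mul, map_add, map_pow, map_ofNat] at h1
  have h2 := sq_nonneg (σ w)
  by_contra hc
  push Not at hc
  nlinarith [sq_nonneg (2 * σ U + 21), mul_nonneg (neg_nonneg.2 hc) h2]

theorem Pt.sel {U w : L} (h : Pt U w) (k : ℤ) (hk : k % 2 = 0) (hE : E k U) : Sel U :=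
  sel_quad U w 21 112 h.1 h.pos ⟨k, hk, hE⟩ ⟨4, by norm_num⟩ (by push_cast; exact h.2)

theorem sel_x {x c : L} (hpos : 0 < σ x) (h : x * c ^ 2 = x ^ 2 - 42 * x - 7) (k : ℤ) (hk : k % 2 = 0) (hE : E k x) : Sel x :=
  sel_quad x c (-42) (-7) hE.ne hpos ⟨k, hk, hE⟩ ⟨0, by norm_num⟩ (by push_cast; linear_combination h)

end C3
end

section
open Polynomial NumberField
namespace C3

theorem E_sqrt {k : ℤ} {x : L} (h : E (2 * k) (x ^ 2)) : E k x := by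
  have hx : x ≠ 0 := by
    intro h0
    apply h.ne
    rw [h0]; simp
  obtain ⟨l, hl⟩ := ex_E x hx
  have := h.uniq (hl.pow 2)
  have e : k = l := by push_cast at this; omega
  rwa [e]

theorem E_16 : E 28 (16 : L) := by
  have := E_two.pow 4
  norm_num at this; exact this
theorem E_4 : E 14 (4 : L) := by
  have := E_two.pow 2
  norm_num at this; exact this
theorem D_n (n : ℕ) : D 0 (n : L) := by simpa using D_int n
theorem D_ofNat (n : ℕ) [n.AtLeastTwo] : D 0 (OfNat.ofNat n : L) := by simpa using D_int (OfNat.ofNat n)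
theorem D_112 : D 28 (112 : L) := by
  have := E_16.d.mul (D_ofNat 7)
  norm_num at this; exact this
theorem E_112 : E 28 (112 : L) := by
  have := E_16.mul (E_odd 7 (by norm_num))
  norm_num at this; exact this
theorem E_21 : E 0 (21 : L) := by simpa using E_odd 21 (by norm_num)
theorem E_7 : E 0 (7 : L) := by simpa using E_odd 7 (by norm_num)
theorem D_1 : D 0 (1 : L) := by simpa using D_int 1

/-- near the origin -/
def Nr (n : ℤ) (U w : L) : Prop := Pt U w ∧ 1 ≤ n ∧ E (-n) w ∧ E (-2 * n) U

theorem Nr.lvl {n : ℤ} {U w : L} (h : Nr n U w) : ∃ e, U = (w + 1) ^ 2 * (1 + e) ∧ E (7 + n) e ∧ E (-n) (w + 1) := by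
  obtain ⟨⟨hU, hp⟩, hn, hw, hEU⟩ := h
  have h1 : E (-n) (w + 1) := hw.addD D_1 (by omega)
  have h1' := h1.ne
  refine ⟨-(2 * w + (22 + 112 / U)) / (w + 1) ^ 2, ?_, ?_, h1⟩
  · field_simp
    linear_combination -hp
  · have h2 : E (7 + -n) (2 * w) := E_two.mul hw
    have h3 : D 7 (22 + 112 / U) := by
      refine D.add ?_ ?_
      · have := E_two.d.mul (D_ofNat 11)
        norm_num at this; exact this
      · exact (E_112.div hEU).d.mono (by omega)
    have h4 := (h2.addD h3 (by omega)).neg.div (h1.pow 2)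
    convert h4 using 1
    push_cast; ring

theorem two_roots {s U1 U2 : L} {m k : ℤ} (hs : U1 + U2 = s) (hE : E m s) (hp : E k (U1 * U2)) (hk : 2 * m < k) : E m U1 ∨ E m U2 := by
  have hn := hp.ne
  obtain ⟨a, ha⟩ := ex_E U1 (left_ne_zero_of_mul hn)
  obtain ⟨b, hb⟩ := ex_E U2 (right_ne_zero_of_mul hn)
  have h1 := hp.uniq (ha.mul hb)
  rcases lt_trichotomy a b with h | h | h
  · have := (ha.addD hb.d h).uniq (hs ▸ hE)
    left; rwa [← this]
  · subst h
    have := hE.le (hs ▸ ha.d.add hb.d)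
    omega
  · have h2 := (hb.addD ha.d h)
    rw [add_comm, hs] at h2
    have := h2.uniq hE
    right; rwa [← this]

/-- halving -/
theorem half_pt {ξ η w : L} (h : Pt (ξ ^ 2) w) (hη : η ^ 2 = 21 + 2 * ξ ^ 2 + 2 * w * ξ) :
    Pt ((η ^ 2 - 21 + 2 * ξ * η) / 2) η ∧ Pt ((η ^ 2 - 21 - 2 * ξ * η) / 2) η ∧
    ((η ^ 2 - 21 + 2 * ξ * η) / 2) * ((η ^ 2 - 21 - 2 * ξ * η) / 2) = 112 := by
  obtain ⟨h0, h1⟩ := h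
  have hx : ξ ≠ 0 := by intro h; apply h0; rw [h]; simp
  have h2 : w ^ 2 * ξ ^ 2 = ξ ^ 4 + 21 * ξ ^ 2 + 112 := by linear_combination h1
  have hh : η ^ 2 * (4 * ξ ^ 2) = (η ^ 2 - 21) ^ 2 - 448 := by
    rw [hη]; linear_combination (-4) * h2
  have hprod : ((η ^ 2 - 21 + 2 * ξ * η) / 2) * ((η ^ 2 - 21 - 2 * ξ * η) / 2) = 112 := by
    linear_combination -hh / 4
  have hn := hprod ▸ (by norm_num : (112 : L) ≠ 0)
  refine ⟨⟨left_ne_zero_of_mul hn, ?_⟩, ⟨right_ne_zero_of_mul hn, ?_⟩, hprod⟩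
  · linear_combination hprod
  · linear_combination hprod

theorem near_aux (N : ℕ) : ∀ (n : ℤ) (U w : L), n ≤ N → Nr n U w → n % 7 = 2 ∨ n % 7 = 4 ∨ n % 7 = 6 → False := by
  induction N with
  | zero => intro n U w hn h _; have := h.2.1; push_cast at hn; omega
  | succ N ih =>
  intro n U w hn h hm
  obtain ⟨e, he, hEe, hw1⟩ := h.lvl
  obtain ⟨hP, h1, hw, hU⟩ := h
  have hSel := hP.sel _ (by omega) hU
  by_cases hn7 : n < 7
  · exact sel_absurd hSel hw1.ne he hEe (by omega)
  obtain ⟨ξ, hξ0, hξ⟩ := sel_sq hSel he (hEe.d.mono (by omega))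
  have hEξ : E (-n) ξ := E_sqrt (by rw [← hξ]; convert hU using 1; ring)
  -- choose the sign
  have hex : ∃ ξ, U = ξ ^ 2 ∧ ξ ≠ 0 ∧ E (-n) ξ ∧ E (7 - n) (ξ + w) := by
    have h2 : E (7 - n) ((ξ + w) + (w - ξ)) := by
      have := E_two.mul hw
      convert this using 1
      all_goals ring
    have h3 : E 0 ((ξ + w) * (w - ξ)) := by
      have : E 0 (21 + 112 / U) := E_21.addD (E_112.div hU).d (by omega)
      convert this using 1
      field_simp [hP.1]
      linear_combination hP.2 - (-U) * hξ
    rcases two_roots rfl h2 h3 (by omega) with h4 | h4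
    · exact ⟨ξ, hξ, hξ0, hEξ, h4⟩
    · exact ⟨-ξ, by rw [hξ]; ring, neg_ne_zero.2 hξ0, hEξ.neg, by rwa [neg_add_eq_sub]⟩
  clear hξ hξ0 hEξ
  obtain ⟨ξ, rfl, hξ0, hEξ, hxw⟩ := hex
  have h2 : w ^ 2 * ξ ^ 2 = ξ ^ 4 + 21 * ξ ^ 2 + 112 := by linear_combination hP.2
  set x' := 21 + 2 * ξ ^ 2 + 2 * w * ξ with hx'
  set y' := 21 + 2 * ξ ^ 2 + 2 * w * (-ξ) with hy'
  have hprod : x' * y' = -7 := by rw [hx', hy']; linear_combination (-4) * h2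
  have hEx : E (2 * (7 - n)) x' := by
    have : E (7 + -n + (7 - n)) (2 * ξ * (ξ + w)) := (E_two.mul hEξ).mul hxw
    have := this.addD E_21.d (by omega)
    convert this using 1
    · ring
    · rw [hx']; ring
  have hEy : E (2 * (n - 7)) y' := by
    have e : y' = -7 / x' := by rw [← hprod]; field_simp [hEx.ne]
    rw [e]
    convert E_7.neg.div hEx using 1
    ring
  have hx1 : x' = (ξ + w) ^ 2 * (1 + (-112 / (ξ ^ 2 * (ξ + w) ^ 2))) := by
    have := hxw.ne
    field_simp
    rw [hx']
    linear_combination -h2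
  have hd1 : D (14 + 4 * n) (-112 / (ξ ^ 2 * (ξ + w) ^ 2)) :=
    (E_112.neg.div ((hEξ.pow 2).mul (hxw.pow 2))).d.mono (by push_cast; omega)
  rcases lt_or_ge 0 (σ x') with hpos | hneg
  · -- large branch
    have hs := sel_x (x := x') (c := 2 * ξ) hpos (by
      rw [hx']; linear_combination (-4) * h2) _ (by omega) hEx
    obtain ⟨η, hη0, hη⟩ := sel_sq hs hx1 (hd1.mono (by omega))
    obtain ⟨q1, q2, q3⟩ := half_pt hP hη.symm
    have hEη : E (7 - n) η := E_sqrt (by rw [← hη]; exact hEx)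
    have hsum : E (2 * (7 - n)) (η ^ 2 - 21) := by
      rw [← hη]
      exact hEx.subD E_21.d (by omega)
    have key : ∀ V, Pt V η → E (2 * (7 - n)) V → False := by
      intro V hV hE
      refine ih (n - 7) V η (by omega) ⟨hV, by omega, ?_, ?_⟩ (by omega)
      · convert hEη using 1; ring
      · convert hE using 1; ring
    rcases two_roots (by ring) hsum (q3 ▸ E_112) (by omega) with h4 | h4
    · exact key _ q1 h4
    · exact key _ q2 h4
  · -- small branch
    have hpos : 0 < σ y' := by
      have := congrArg σ hprod
      rw [map_mul, map_neg, map_ofNat] at this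
      by_contra hc
      push Not at hc
      nlinarith [mul_nonneg (neg_nonneg.2 hneg) (neg_nonneg.2 hc)]
    have hs := sel_x (x := y') (c := 2 * ξ) hpos (by
      rw [hy']; linear_combination (-4) * h2) _ (by omega) hEy
    set d := -112 / (ξ ^ 2 * (ξ + w) ^ 2) with hd
    have hE1 : E 0 (1 + d) := N_one.e.addD hd1 (by omega)
    have hy1 : y' = (11 / (ξ + w)) ^ 2 * (1 + (-128 / 121 - d) / (1 + d)) := by
      have := hxw.ne
      have := hE1.ne
      have h11 : (121 : L) ≠ 0 := by norm_num
      have e : y' = -7 / x' := by rw [← hprod]; field_simp [hEx.ne]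
      rw [e, hx1]
      field_simp
      ring
    have hd2 : D 8 ((-128 / 121 - d) / (1 + d)) := by
      have h121 : E 0 (121 : L) := by simpa using E_odd 121 (by norm_num)
      have h128 : E 49 (128 : L) := by have := E_two.pow 7; norm_num at this; exact this
      have := ((h128.neg.div h121).d.mono (show (8 : ℤ) ≤ _ by omega)).sub (hd1.mono (show (8 : ℤ) ≤ _ by omega))
      simpa using this.div hE1
    obtain ⟨η, hη0, hη⟩ := sel_sq hs hy1 hd2
    obtain ⟨q1, q2, q3⟩ := half_pt (ξ := -ξ) (w := w) (η := η) (by rw [neg_sq]; exact hP) (by rw [← hη, hy']; ring)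
    have hEη : E (n - 7) η := E_sqrt (by rw [← hη]; exact hEy)
    have hsum : E 0 (η ^ 2 - 21) := by
      have := E_21.neg.addD (hEη.pow 2).d (by push_cast; omega)
      convert this using 1; ring
    have key : ∀ V, Pt V η → E 0 V → False := by
      intro V hV hE
      have hs7 := Sel_seven.mul (hV.sel 0 (by norm_num) hE)
      have h1η : E 0 (1 + η) := N_one.e.addD hEη.d (by omega)
      have h1n := h1η.ne
      have hV0 := hV.1
      have hV7 : 7 * V = (1 + η) ^ 2 * (1 + (6 * η ^ 2 - 2 * η - 148 - 784 / V) / (1 + η) ^ 2) := by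
        field_simp
        linear_combination -7 * hV.2
      have e784 : D 28 (784 / V) := by
        have := (E_112.mul E_7).div hE
        norm_num at this; exact this.d
      have e6 : E (7 + 2 * (n - 7)) (6 * η ^ 2) := by
        have := (E_two.mul (E_odd 3 (by norm_num))).mul (hEη.pow 2)
        norm_num at this; exact this
      have e2 : E (7 + (n - 7)) (2 * η) := E_two.mul hEη
      have e148 : E 14 (148 : L) := by
        have := E_4.mul (E_odd 37 (by norm_num))
        norm_num at this; exact this
      by_cases hm7 : n < 14
      · have h5 : E (7 + (n - 7)) (6 * η ^ 2 - 2 * η - 148 - 784 / V) := by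
          have := ((e2.neg.addD e6.d (by omega)).subD e148.d (by omega)).subD e784 (by omega)
          convert this using 1; ring
        refine sel_absurd hs7 h1n hV7 (h5.div (h1η.pow 2)) ?_
        push_cast; omega
      · have h5 : E 14 (6 * η ^ 2 - 2 * η - 148 - 784 / V) := by
          have := ((e148.neg.addD e6.d (by omega)).subD e2.d (by omega)).subD e784 (by omega)
          convert this using 1; ring
        have h6 := h5.div (h1η.pow 2)
        norm_num at h6
        exact sel_absurd hs7 h1n hV7 h6 (by omega)
    rcases two_roots (by ring) hsum (q3 ▸ E_112) (by omega) with h4 | h4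
    · exact key _ q1 h4
    · exact key _ q2 h4

theorem near {n : ℤ} {U w : L} (h : Nr n U w) (hm : n % 7 = 2 ∨ n % 7 = 4 ∨ n % 7 = 6) : False :=
  near_aux n.toNat n U w (by omega) h hm

end C3
end

section
open Polynomial NumberField
namespace C3

/-- points near the origin in the other chart -/
def Zt (a : ℤ) (z t : L) : Prop := t = z ^ 3 + 21 * z ^ 2 * t + 112 * z * t ^ 2 ∧ D a z ∧ D (3 * a) t

theorem Zt.neg {a : ℤ} {z t : L} (h : Zt a z t) : Zt a (-z) (-t) :=
  ⟨by linear_combination -h.1, h.2.1.neg, h.2.2.neg⟩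

theorem Zt_zero (a : ℤ) : Zt a 0 0 := ⟨by ring, D_zero _, D_zero _⟩

theorem D_21 : D 0 (21 : L) := E_21.d

theorem Zt.add {a : ℤ} (ha : 1 ≤ a) {z1 t1 z2 t2 : L} (h1 : Zt a z1 t1) (h2 : Zt a z2 t2) :
    ∃ z3 t3, Zt a z3 t3 ∧ D (3 * a) (z3 - (z1 + z2)) := by
  obtain ⟨e1, dz1, dt1⟩ := h1
  obtain ⟨e2, dz2, dt2⟩ := h2
  set dn := 1 - 21 * z1 ^ 2 - 112 * z1 * (t1 + t2) with hdn
  set nm := z1 ^ 2 + z1 * z2 + z2 ^ 2 + 21 * t2 * (z1 + z2) + 112 * t2 ^ 2 with hnm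
  have hE : E 0 dn := by
    refine (N_one.e.subD (l := 2) ?_ (by norm_num)).subD (l := 2) ?_ (by norm_num)
    · exact (D_21.mul (dz1.pow 2)).mono (by push_cast; omega)
    · exact ((D_112.mul dz1).mul (dt1.add dt2)).mono (by omega)
  have hn : D (2 * a) nm := by
    refine D.add (D.add (D.add (D.add ?_ ?_) ?_) ?_) ?_
    · exact (dz1.pow 2).mono (by push_cast; omega)
    · exact (dz1.mul dz2).mono (by omega)
    · exact (dz2.pow 2).mono (by push_cast; omega)
    · exact ((D_21.mul dt2).mul (dz1.add dz2)).mono (by omega)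
    · exact (D_112.mul (dt2.pow 2)).mono (by push_cast; omega)
  set m := nm / dn with hm
  have hmD : D (2 * a) m := by simpa using hn.div hE
  have hmdn : m * dn = nm := by rw [hm]; field_simp [hE.ne]
  have hlin : t1 - t2 = m * (z1 - z2) := by
    have : dn * (t1 - t2) = dn * (m * (z1 - z2)) := by
      have : dn * (m * (z1 - z2)) = nm * (z1 - z2) := by rw [← hmdn]; ring
      rw [this, hdn, hnm]
      linear_combination e1 - e2
    exact mul_left_cancel₀ hE.ne this
  set c := t1 - m * z1 with hc
  have hcD : D (3 * a) c := dt1.sub ((hmD.mul dz1).mono (by omega))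
  have ht1 : t1 = m * z1 + c := by rw [hc]; ring
  have ht2 : t2 = m * z2 + c := by linear_combination ht1 - hlin
  clear_value c
  set A := 1 + 21 * m + 112 * m ^ 2 with hA
  have hAE : E 0 A := by
    refine (N_one.e.addD (l := 2) ?_ (by norm_num)).addD (l := 2) ?_ (by norm_num)
    · exact (D_21.mul hmD).mono (by omega)
    · exact (D_112.mul (hmD.pow 2)).mono (by push_cast; omega)
  set B := 21 * c + 224 * m * c with hB
  have hBD : D (3 * a) B := by
    refine D.add ?_ ?_
    · exact (D_21.mul hcD).mono (by omega)
    · exact (((D_ofNat 224).mul hmD).mul hcD).mono (by omega)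
  have hstar : A * (z1 ^ 2 + z1 * z2 + z2 ^ 2) + B * (z1 + z2) + (112 * c ^ 2 - m) = 0 := by
    rw [hdn, hnm] at hmdn
    rw [ht1, ht2] at hmdn
    rw [hA, hB]
    linear_combination -hmdn
  set z3 := -z1 - z2 - B / A with hz3
  have hs : A * (z1 + z2 + z3) + B = 0 := by rw [hz3]; field_simp [hAE.ne]; ring
  have hBA : D (3 * a) (B / A) := by simpa using hBD.div hAE
  have dz3 : D a z3 := (dz1.neg.sub dz2).sub (hBA.mono (by omega))
  have hf1 : A * z1 ^ 3 + B * z1 ^ 2 + (112 * c ^ 2 - m) * z1 - c = 0 := by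
    rw [hA, hB]
    rw [ht1] at e1
    linear_combination -e1
  have hf3 : A * z3 ^ 3 + B * z3 ^ 2 + (112 * c ^ 2 - m) * z3 - c = 0 := by
    linear_combination hf1 + (z3 - z1) * hstar + (z3 - z1) * (z3 - z2) * hs
  refine ⟨-z3, -(m * z3 + c), ?_, ?_⟩
  · apply Zt.neg
    refine ⟨?_, dz3, ((hmD.mul dz3).mono (by omega)).add hcD⟩
    rw [hA, hB] at hf3
    linear_combination -hf3
  · have : -z3 - (z1 + z2) = B / A := by rw [hz3]; ring
    rw [this]; exact hBA

theorem Zt.near {a n : ℤ} (ha : 1 ≤ a) {z t : L} (h : Zt a z t) (hz : E n z) (hm : n % 7 = 2 ∨ n % 7 = 4 ∨ n % 7 = 6) : False := by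
  obtain ⟨e, dz, dt⟩ := h
  have hn := hz.le dz
  have hE : E 0 (1 - 21 * z ^ 2 - 112 * z * t) := by
    refine (N_one.e.subD (l := 2) ?_ (by norm_num)).subD (l := 2) ?_ (by norm_num)
    · exact (D_21.mul (dz.pow 2)).mono (by push_cast; omega)
    · exact ((D_112.mul dz).mul dt).mono (by omega)
  have ht : t = z ^ 3 / (1 - 21 * z ^ 2 - 112 * z * t) := by
    rw [eq_div_iff hE.ne]; linear_combination e
  have htE : E (3 * n) t := by
    have := (hz.pow 3).div hE
    rw [← ht] at this
    simpa using this
  have hz0 := hz.ne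
  have ht0 := htE.ne
  refine C3.near (n := n) (U := z / t) (w := 1 / z) ⟨⟨div_ne_zero hz0 ht0, ?_⟩, by omega, ?_, ?_⟩ hm
  · field_simp
    linear_combination e
  · rw [one_div]; exact hz.inv
  · convert hz.div htE using 1; ring

/-- multiples -/
theorem Zt.mul {a : ℤ} (ha : 1 ≤ a) {z t : L} (h : Zt a z t) (m : ℕ) :
    ∃ z' t', Zt a z' t' ∧ D (3 * a) (z' - m * z) := by
  induction m with
  | zero => exact ⟨0, 0, Zt_zero a, by simpa using D_zero _⟩
  | succ m ih =>
    obtain ⟨z', t', h', hd⟩ := ih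
    obtain ⟨z3, t3, h3, hd3⟩ := h'.add ha h
    refine ⟨z3, t3, h3, ?_⟩
    convert hd3.add hd using 1
    push_cast; ring

theorem Zt.mono {a n : ℤ} (ha : 1 ≤ a) {z t : L} (h : Zt a z t) (hz : D n z) (hn : a ≤ n) : Zt n z t := by
  obtain ⟨e, dz, dt⟩ := h
  have hE : E 0 (1 - 21 * z ^ 2 - 112 * z * t) := by
    refine (N_one.e.subD (l := 2) ?_ (by norm_num)).subD (l := 2) ?_ (by norm_num)
    · exact (D_21.mul (dz.pow 2)).mono (by push_cast; omega)
    · exact ((D_112.mul dz).mul dt).mono (by omega)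
  have ht : t = z ^ 3 / (1 - 21 * z ^ 2 - 112 * z * t) := by
    rw [eq_div_iff hE.ne]; linear_combination e
  refine ⟨e, hz, ?_⟩
  have := (hz.pow 3).div hE
  rw [← ht] at this
  simpa using this

theorem D_two (j : ℕ) : D (7 * j) ((2 : L) ^ j) := by
  have := (E_two.pow j).d
  rwa [mul_comm] at this

theorem dbls {z t : L} (h : Zt 15 z t) (j : ℕ) :
    ∃ z' t', Zt (15 + 7 * j) z' t' ∧ D (38 + 7 * j) (z' - 2 ^ j * z) := by
  induction j with
  | zero => exact ⟨z, t, by simpa using h, by simpa using D_zero _⟩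
  | succ j ih =>
    obtain ⟨z', t', h', hd⟩ := ih
    obtain ⟨z3, t3, h3, hd3⟩ := h'.add (by omega) h'
    have hd4 : D (38 + 7 * (j + 1)) (z3 - 2 ^ (j + 1) * z) := by
      have h5 := (E_two.d.mul hd).mono (show (38 + 7 * (j + 1) : ℤ) ≤ _ by omega)
      have h6 := hd3.mono (show (38 + 7 * (j + 1) : ℤ) ≤ _ by omega)
      convert h5.add h6 using 1
      ring
    have h7 : D (15 + 7 * (j + 1)) z3 := by
      have := (D_two (j + 1)).mul h.2.1
      have := (hd4.mono (show (15 + 7 * (j + 1) : ℤ) ≤ _ by omega)).add (this.mono (show (15 + 7 * (j + 1) : ℤ) ≤ _ by push_cast; omega))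
      convert this using 1
      ring
    refine ⟨z3, t3, ?_, by push_cast; exact hd4⟩
    push_cast
    exact h3.mono (by omega) h7 (by omega)

/-- final comparison -/
theorem final {l tl z t e : L} (hl : Zt 15 l tl) (j m : ℕ) (hz : Zt (15 + 7 * j) z t)
    (he : z = 2 ^ j * (m * l + e)) {n : ℤ} (hn : E n e) (hn1 : n ≤ 37) (hm : n % 7 = 2 ∨ n % 7 = 4 ∨ n % 7 = 6) : False := by
  obtain ⟨z1, t1, h1, d1⟩ := dbls hl j
  obtain ⟨z2, t2, h2, d2⟩ := h1.mul (by omega) m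
  obtain ⟨z3, t3, h3, d3⟩ := hz.add (by omega) h2.neg
  have h5 : E (7 * j + n) (2 ^ j * e) := by
    have := (E_two.pow j).mul hn
    rwa [mul_comm (j : ℤ)] at this
  have h6 : E (7 * j + n) z3 := by
    have a1 := ((D_n m).mul d1).mono (show (38 + 7 * j : ℤ) ≤ _ by omega)
    have a2 := d2.mono (show (38 + 7 * j : ℤ) ≤ _ by omega)
    have a3 := d3.mono (show (38 + 7 * j : ℤ) ≤ _ by omega)
    have := h5.addD ((a3.sub a2).sub a1) (by omega)
    convert this using 1
    rw [he]
    ring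
  exact h3.near (by omega) h6 (by omega)

theorem final8 {l tl z t e : L} (hl : Zt 15 l tl) (m : ℕ) (hz : Zt 8 z t)
    (he : 2 * z = m * l + e) {n : ℤ} (hn : E n e) (hn1 : n ≤ 23) (hn2 : 15 ≤ n) (hm : n % 7 = 2 ∨ n % 7 = 4 ∨ n % 7 = 6) : False := by
  obtain ⟨z2, t2, h2, d2⟩ := hz.add (by omega) hz
  have hd : D 24 (z2 - 2 * z) := by
    convert d2 using 1
    all_goals ring
  have h3 : D 15 z2 := by
    have := (D_n m).mul hl.2.1
    have := ((hd.mono (by norm_num)).add (hn.d.mono hn2)).add (by simpa using this)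
    convert this using 1
    linear_combination he
  refine final (e := e + (z2 - 2 * z)) hl 0 m (z := z2) (t := t2) (by simpa using h2.mono (by omega) h3 (by omega)) ?_ (hn.addD hd (by omega)) (by omega) hm
  linear_combination he

end C3
end

section
open Polynomial NumberField
namespace C3

theorem Pt.neg {U w : L} (h : Pt U w) : Pt U (-w) := ⟨h.1, by rw [neg_sq]; exact h.2⟩

theorem Pt.zt {n : ℤ} {U w : L} (h : Pt U w) (hw : E (-n) w) (hU : E (-2 * n) U) : Zt n (1 / w) (1 / (U * w)) := by
  have h0 := h.1
  have hw0 := hw.ne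
  refine ⟨?_, ?_, ?_⟩
  · field_simp
    linear_combination h.2
  · rw [one_div]; simpa using hw.inv.d
  · rw [one_div]; exact (hU.mul hw).inv.d.mono (by omega)

theorem Pt.sub {U1 w1 U2 w2 : L} (h1 : Pt U1 w1) (h2 : Pt U2 w2) (hd : U1 - U2 ≠ 0) (hy : w1 + w2 ≠ 0) :
    Pt (U1 * U2 * (w1 + w2) ^ 2 / (U1 - U2) ^ 2) (-(U1 * w1 + U2 * w2) / (U1 - U2) + (U1 - U2) / (w1 + w2)) := by
  obtain ⟨a1, b1⟩ := h1
  obtain ⟨a2, b2⟩ := h2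
  refine ⟨by positivity, ?_⟩
  have c1 : 112 * (U1 - U2) = U1 * U2 * ((U1 - U2) - (w1 - w2) * (w1 + w2)) := by
    linear_combination U2 * b1 - U1 * b2
  have c2 : U1 * U2 * (w1 + w2) ^ 2 - (U1 * w1 + U2 * w2) ^ 2 + 21 * (U1 - U2) ^ 2 = -(U1 - U2) ^ 2 * (U1 + U2) := by
    linear_combination -(U1 - U2) * (b1 - b2)
  have c3 : (U1 - U2) * (w1 - w2) - 2 * (U1 * w1 + U2 * w2) = -(U1 + U2) * (w1 + w2) := by ring
  generalize w1 + w2 = y at *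
  generalize U1 - U2 = d at *
  generalize U1 * w1 + U2 * w2 = S at *
  generalize w1 - w2 = e at *
  generalize U1 * U2 = P at *
  generalize U1 + U2 = T at *
  have c4 : (112 : L) = P * (d - e * y) / d := by
    rw [eq_div_iff hd]; exact c1
  rw [c4]
  have c5 : y ^ 2 * S ^ 2 - 2 * S * d ^ 2 * y - P * y ^ 4 - 21 * y ^ 2 * d ^ 2 + d ^ 3 * e * y = 0 := by
    linear_combination -y ^ 2 * c2 + d ^ 2 * y * c3
  have c6 : P * y ^ 2 / d ^ 2 * (-S / d + d / y) ^ 2 - ((P * y ^ 2 / d ^ 2) ^ 2 + 21 * (P * y ^ 2 / d ^ 2) + P * (d - e * y) / d) =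
      P / d ^ 4 * (y ^ 2 * S ^ 2 - 2 * S * d ^ 2 * y - P * y ^ 4 - 21 * y ^ 2 * d ^ 2 + d ^ 3 * e * y) := by
    field_simp
    ring
  rw [c5, mul_zero] at c6
  exact sub_eq_zero.mp c6

theorem diff {U1 w1 U2 w2 ρ : L} {k n : ℤ} (h1 : Pt U1 w1) (h2 : Pt U2 w2) (hE : E k U2) (hw : E 0 w2)
    (hρ : U1 = U2 * (1 + ρ)) (hn : E (7 + n) ρ) (hk : 8 ≤ k) (hk2 : k ≤ 12) (hn8 : 8 ≤ n) :
    ∃ z t, Zt n z t ∧ D (k + 2 * n - 7) (z - ρ / (w2 * (2 + ρ))) := by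
  have hE1 : E k U1 := by
    rw [hρ]
    simpa using hE.mul (N_one.e.addD hn.d (by omega))
  have n1 := h1.1
  have n2 := h2.1
  have hκ : E 0 (1 - 112 / (U1 * U2)) := N_one.e.subD (E_112.div (hE1.mul hE)).d (by omega)
  have hex : ∃ w, Pt U1 w ∧ E 7 (w + w2) := by
    have q1 : E 7 ((w1 + w2) + (w2 - w1)) := by
      have := E_two.mul hw
      convert this using 1
      all_goals ring
    have q2 : E (k + (7 + n)) ((w1 + w2) * (w2 - w1)) := by
      have := ((hE.mul hn).mul hκ).neg
      convert this using 1
      · ring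
      · have : U2 * ρ = U1 - U2 := by rw [hρ]; ring
        rw [this]
        field_simp
        linear_combination U1 * h2.2 - U2 * h1.2
    rcases two_roots rfl q1 q2 (by omega) with h | h
    · exact ⟨w1, h1, h⟩
    · exact ⟨-w1, h1.neg, by rwa [neg_add_eq_sub]⟩
  clear h1
  obtain ⟨w, h1, hy⟩ := hex
  have hd : E (k + n) (w - w2) := by
    have q2 : E (k + (7 + n)) ((w + w2) * (w - w2)) := by
      have := ((hE.mul hn).mul hκ)
      convert this using 1
      · ring
      · have : U2 * ρ = U1 - U2 := by rw [hρ]; ring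
        rw [this]
        field_simp
        linear_combination U2 * h1.2 - U1 * h2.2
    have := q2.div hy
    rw [mul_div_cancel_left₀ _ hy.ne] at this
    convert this using 1; ring
  have hΔ : E (k + (7 + n)) (U1 - U2) := by
    have := hE.mul hn
    convert this using 1
    rw [hρ]; ring
  have h2ρ : E 7 (2 + ρ) := E_two.addD hn.d (by omega)
  have hA : E (k + 7) (w2 * U2 * (2 + ρ)) := by
    convert (hw.mul hE).mul h2ρ using 1; ring
  have hS : E (k + 7) (U1 * w + U2 * w2) := by
    have := hA.addD (hE1.mul hd).d (by omega)
    convert this using 1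
    rw [hρ]; ring
  have hQ : E (2 * k + 2 * n + 7) ((U1 - U2) ^ 2 / (w + w2)) := by
    convert (hΔ.pow 2).div hy using 1; push_cast; ring
  have hT : E (k + 7) ((U1 * w + U2 * w2) - (U1 - U2) ^ 2 / (w + w2)) := hS.subD hQ.d (by omega)
  have hsub := (h1.sub h2 hΔ.ne hy.ne).neg
  have hw3 : E (-n) (-(-(U1 * w + U2 * w2) / (U1 - U2) + (U1 - U2) / (w + w2))) := by
    have := hT.div hΔ
    have e1 := hΔ.ne
    have e2 := hy.ne
    convert this using 1
    · ring
    · field_simp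
      ring
  refine ⟨_, _, hsub.zt hw3 ?_, ?_⟩
  · convert ((hE1.mul hE).mul (hy.pow 2)).div (hΔ.pow 2) using 1
    push_cast; ring
  · have key : (1 / -(-(U1 * w + U2 * w2) / (U1 - U2) + (U1 - U2) / (w + w2)) - ρ / (w2 * (2 + ρ))) =
      (U1 - U2) * ((U1 - U2) ^ 2 / (w + w2) - U1 * (w - w2)) / ((w2 * U2 * (2 + ρ)) * ((U1 * w + U2 * w2) - (U1 - U2) ^ 2 / (w + w2))) := by
      have e1 := hΔ.ne
      have e2 := hT.ne
      have e3 := hy.ne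
      have e4 := h2ρ.ne
      have e5 := hw.ne
      have a1 : 1 / -(-(U1 * w + U2 * w2) / (U1 - U2) + (U1 - U2) / (w + w2)) = (U1 - U2) / ((U1 * w + U2 * w2) - (U1 - U2) ^ 2 / (w + w2)) := by
        rw [div_eq_div_iff hw3.ne e2]
        field_simp
        ring
      have a2 : ρ / (w2 * (2 + ρ)) = (U1 - U2) / (w2 * U2 * (2 + ρ)) := by
        rw [hρ]; field_simp; ring
      rw [a1, a2, div_sub_div _ _ e2 hA.ne, div_eq_div_iff (mul_ne_zero e2 hA.ne) (mul_ne_zero hA.ne e2)]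
      have a3 : w2 * U2 * (2 + ρ) = w2 * (U1 + U2) := by rw [hρ]; ring
      rw [a3]
      ring
    rw [key]
    refine ((hΔ.d.mul ((hQ.d.mono (show 2 * k + n ≤ _ by omega)).sub ((hE1.mul hd).d.mono (by omega)))).div (hA.mul hT)).mono (by omega)

end C3
end

section
open Polynomial NumberField
namespace C3

def V7.padd (v w : V7) : V7 := ⟨v.a + w.a, v.b + w.b, v.c + w.c, v.d + w.d, v.e + w.e, v.f + w.f, v.g + w.g⟩
def V7.psub (v w : V7) : V7 := ⟨v.a - w.a, v.b - w.b, v.c - w.c, v.d - w.d, v.e - w.e, v.f - w.f, v.g - w.g⟩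
def V7.pmul (v w : V7) : V7 :=
  ⟨v.a * w.a + 162 * (v.b * w.g + v.c * w.f + v.d * w.e + v.e * w.d + v.f * w.c + v.g * w.b),
   v.a * w.b + v.b * w.a + 162 * (v.c * w.g + v.d * w.f + v.e * w.e + v.f * w.d + v.g * w.c),
   v.a * w.c + v.b * w.b + v.c * w.a + 162 * (v.d * w.g + v.e * w.f + v.f * w.e + v.g * w.d),
   v.a * w.d + v.b * w.c + v.c * w.b + v.d * w.a + 162 * (v.e * w.g + v.f * w.f + v.g * w.e),
   v.a * w.e + v.b * w.d + v.c * w.c + v.d * w.b + v.e * w.a + 162 * (v.f * w.g + v.g * w.f),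
   v.a * w.f + v.b * w.e + v.c * w.d + v.d * w.c + v.e * w.b + v.f * w.a + 162 * (v.g * w.g),
   v.a * w.g + v.b * w.f + v.c * w.e + v.d * w.d + v.e * w.c + v.f * w.b + v.g * w.a⟩
def V7.ppow (v : V7) : ℕ → V7
  | 0 => ⟨1, 0, 0, 0, 0, 0, 0⟩
  | n + 1 => (v.ppow n).pmul v
def V7.i (n : ℤ) : V7 := ⟨n, 0, 0, 0, 0, 0, 0⟩
def V7.P : V7 := ⟨0, 1, 0, 0, 0, 0, 0⟩

theorem V7.pe_add (v w : V7) : (v.padd w).pe = v.pe + w.pe := by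
  simp only [V7.padd, V7.pe]; push_cast; ring
theorem V7.pe_sub (v w : V7) : (v.psub w).pe = v.pe - w.pe := by
  simp only [V7.psub, V7.pe]; push_cast; ring
theorem V7.pe_mul (v w : V7) : (v.pmul w).pe = v.pe * w.pe := by
  obtain ⟨a, b, c, d, e, f, g⟩ := v
  obtain ⟨a', b', c', d', e', f', g'⟩ := w
  simp only [V7.pmul, V7.pe]
  push_cast
  linear_combination (-(((b : L) * g' + c * f' + d * e' + e * d' + f * c' + g * b') +
    ((c : L) * g' + d * f' + e * e' + f * d' + g * c') * p +
    ((d : L) * g' + e * f' + f * e' + g * d') * p ^ 2 + ((e : L) * g' + f * f' + g * e') * p ^ 3 + ((f : L) * g' + g * f') * p ^ 4 + (g : L) * g' * p ^ 5)) * hp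
theorem V7.pe_i (n : ℤ) : (V7.i n).pe = n := by simp [V7.i, V7.pe]
theorem V7.pe_P : V7.P.pe = p := by simp [V7.P, V7.pe]
theorem V7.D0 (v : V7) : D 0 v.pe := v.dpe 0 (by simp [V7.dck])

def Ap (r : ℕ) (x : L) (v : V7) : Prop := D r (x - v.pe)

theorem Ap.d0 {r x v} (h : Ap r x v) : D 0 x := by
  have := (h.mono (show (0 : ℤ) ≤ r by omega)).add v.D0
  simpa using this
theorem Ap.mono {r s x v} (h : Ap r x v) (hs : s ≤ r) : Ap s x v := D.mono h (by exact_mod_cast hs)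
theorem Ap.add {r x y v w} (h : Ap r x v) (h' : Ap r y w) : Ap r (x + y) (v.padd w) := by
  have := D.add h h'
  rw [Ap, V7.pe_add]
  convert this using 1; ring
theorem Ap.sub {r x y v w} (h : Ap r x v) (h' : Ap r y w) : Ap r (x - y) (v.psub w) := by
  have := D.sub h h'
  rw [Ap, V7.pe_sub]
  convert this using 1; ring
theorem Ap.mul {r x y v w} (h : Ap r x v) (h' : Ap r y w) : Ap r (x * y) (v.pmul w) := by
  have h1 := (Ap.d0 h).mul h'
  have h2 := (V7.D0 w).mul h
  rw [zero_add] at h1 h2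
  rw [Ap, V7.pe_mul]
  convert h1.add h2 using 1; ring
theorem Ap_pe {r} (v : V7) : Ap r v.pe v := by rw [Ap, sub_self]; exact D_zero _
theorem Ap_i {r} (n : ℤ) : Ap r n (V7.i n) := by rw [← V7.pe_i]; exact Ap_pe _
theorem Ap_n {r} (n : ℕ) [n.AtLeastTwo] : Ap r (OfNat.ofNat n) (V7.i (OfNat.ofNat n)) := by
  have := Ap_i (r := r) (OfNat.ofNat n); exact_mod_cast this
theorem Ap_1 {r} : Ap r 1 (V7.i 1) := by
  have := Ap_i (r := r) 1; exact_mod_cast this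
theorem Ap_p {r} : Ap r p V7.P := by
  have := Ap_pe (r := r) V7.P; rwa [V7.pe_P] at this
theorem Ap.pow {r x v} (h : Ap r x v) : ∀ n : ℕ, Ap r (x ^ n) (v.ppow n)
  | 0 => by rw [pow_zero]; exact Ap_1
  | n + 1 => by rw [pow_succ]; exact (h.pow n).mul h
theorem Ap.neg {r x v} (h : Ap r x v) : Ap r (-x) ((V7.i 0).psub v) := by
  have := (Ap_i (r := r) 0).sub h; simpa using this
theorem Ap.conv {r x v} (h : Ap r x v) (w : V7) (hw : (v.psub w).dck r = true) : Ap r x w := by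
  have := D.add h ((v.psub w).dpe r hw)
  rw [V7.pe_sub] at this
  rw [Ap]
  convert this using 1; ring
/-- only `n mod 2^j` matters -/
theorem Ap_mod (j : ℕ) (n c : ℤ) (h : n % 2 ^ j = c) : Ap (7 * j) n (V7.i c) := by
  have h1 : n - c = 2 ^ j * (n / 2 ^ j) := by rw [← h]; have := Int.emod_add_mul_ediv n (2 ^ j); linarith
  have := (E_two.pow j).d.mul (D_int (n / 2 ^ j))
  rw [Ap, V7.pe_i]
  have h2 : (n : L) - c = 2 ^ j * ((n / 2 ^ j : ℤ) : L) := by exact_mod_cast h1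
  rw [h2]
  exact this.mono (by push_cast; omega)
theorem Ap.toD {r x v} (h : Ap r x v) (k : ℕ) (hk : k ≤ r) (hv : v.dck k = true) : D k x := by
  have h1 : D k (x - v.pe) := h.mono hk
  have := h1.add (v.dpe k hv)
  rwa [sub_add_cancel] at this
theorem V7.unit (v : V7) (h : v.a % 2 = 1) : E 0 v.pe := by
  have h1 := (E_odd _ h).addD (V7.dpe ⟨0, v.b, v.c, v.d, v.e, v.f, v.g⟩ 1 (by simp [V7.dck])) (by norm_num)
  convert h1 using 1
  simp only [V7.pe]; push_cast; ring
theorem Ap.unit {r x v} (h : Ap r x v) (hr : 1 ≤ r) (hv : v.a % 2 = 1) : E 0 x := by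
  have := (v.unit hv).addD h (by exact_mod_cast hr)
  simpa using this
set_option maxHeartbeats 1000000 in
theorem Ap.div {r x y v w} (h : Ap r x v) (h' : Ap r y w) (hr : 1 ≤ r) (hw : w.a % 2 = 1) (u : V7)
    (hu : ((u.pmul w).psub v).dck r = true) : Ap r (x / y) u := by
  have hy := h'.unit hr hw
  have h1 : Ap r (x - u.pe * y) (v.psub (u.pmul w)) := h.sub ((Ap_pe u).mul h')
  have h2 : D r (x - u.pe * y) := by
    have := D.sub h1 ((u.pmul w).psub v |>.dpe r hu)
    simp only [V7.pe_sub] at this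
    convert this using 1; ring
  have h3 := h2.div hy
  rw [Ap]
  have h0 := hy.ne
  convert h3 using 1
  · ring
  · field_simp
/-- dividing by powers of `p` -/
theorem Ap.dvp {r x v} (k : ℕ) (u : V7) (h : Ap (r + k) (p ^ k * x) v) (hu : (((V7.P.ppow k).pmul u).psub v).dck (r + k) = true) : Ap r x u := by
  have h1 := h.conv ((V7.P.ppow k).pmul u) (by
    revert hu; simp only [V7.dck, V7.psub, Bool.and_eq_true, beq_iff_eq]
    intro ⟨⟨⟨⟨⟨⟨h0, h1⟩, h2⟩, h3⟩, h4⟩, h5⟩, h6⟩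
    refine ⟨⟨⟨⟨⟨⟨?_, ?_⟩, ?_⟩, ?_⟩, ?_⟩, ?_⟩, ?_⟩ <;>
    · rw [← Int.neg_sub]; apply Int.emod_eq_zero_of_dvd; apply (dvd_neg).mpr; apply Int.dvd_of_emod_eq_zero; assumption)
  have h2 : (V7.P.ppow k).pe = p ^ k := by
    have : ∀ k, (V7.P.ppow k).pe = p ^ k := fun k => by
      induction k with
      | zero => simp [V7.ppow, V7.pe]
      | succ n ih => rw [V7.ppow, V7.pe_mul, ih, V7.pe_P, pow_succ]
    exact this k
  rw [Ap, V7.pe_mul, h2] at h1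
  have h3 := h1.div (E_npow k)
  have hp0 : p ^ k ≠ 0 := pow_ne_zero _ p_ne
  rw [Ap]
  convert h3 using 1
  · push_cast; ring
  · field_simp

theorem Ap_frac {r} (t : ℤ) (ht : t % 2 = 1) (v u : V7) {x : L} (hr : 1 ≤ r)
    (h : (t : L) * x = v.pe) (hu : ((u.pmul (V7.i t)).psub v).dck r = true) : Ap r x u := by
  have := (Ap_pe (r := r) v).div (Ap_i t) hr ht u hu
  rwa [← h, mul_div_cancel_left₀ _ (E_odd t ht).ne] at this

/-- square roots -/
theorem Ap_sqrt {r b v} (h : Ap (r + 7) (b ^ 2) v) (hr : 8 ≤ r) (c : V7) (hc1 : c.a % 2 = 1)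
    (hc : ((c.pmul c).psub v).dck (r + 7) = true) : Ap r b c ∨ Ap r (-b) c := by
  have h1 : D (r + 7) ((b - c.pe) * (-b - c.pe)) := by
    have := D.sub (((c.pmul c).psub v).dpe _ hc) h
    rw [V7.pe_sub, V7.pe_mul] at this
    push_cast at this
    convert this using 1
    all_goals ring
  have hs : E 7 ((b - c.pe) + (-b - c.pe)) := by
    convert (E_two.mul (c.unit hc1)).neg using 1
    all_goals ring
  by_cases h0 : (b - c.pe) * (-b - c.pe) = 0
  · rcases mul_eq_zero.mp h0 with h | h
    · left; rw [Ap, h]; exact D_zero _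
    · right; rw [Ap, h]; exact D_zero _
  · obtain ⟨k, hk⟩ := ex_E _ h0
    have hk1 := hk.le h1
    rcases two_roots rfl hs hk (by omega) with h | h
    · right
      have := h1.div h
      rw [mul_div_cancel_left₀ _ h.ne] at this
      exact this.mono (by omega)
    · left
      have := h1.div h
      rw [mul_div_cancel_right₀ _ h.ne] at this
      exact this.mono (by omega)

end C3
end

section
open Polynomial NumberField
namespace C3

theorem two_p : (2 : L) = p ^ 7 / 81 := by rw [hp]; norm_num
theorem hp14 : p ^ 14 = 26244 := by linear_combination (p ^ 7 + 162) * hp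

theorem phi {x y z : L} (h : 3 * x ^ 3 * y + 2 * y ^ 3 * z + z ^ 3 * x = 0)
    (hx : x * y * z ≠ 0) (hS : 9 * x + 3 * p * z + p ^ 3 * y ≠ 0) (hT : 9 * x * z + 3 * p ^ 2 * x * y + p ^ 3 * y * z ≠ 0) :
    Pt (-p ^ 12 * (9 * x * z + 3 * p ^ 2 * x * y + p ^ 3 * y * z) ^ 2 / (19683 * (x * y * z) * (9 * x + 3 * p * z + p ^ 3 * y)))
      (5 - 2 * (9 * x + 3 * p * z + p ^ 3 * y) ^ 2 / (3 * p * (9 * x * z + 3 * p ^ 2 * x * y + p ^ 3 * y * z))) := by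
  have gen : ∀ X Y Z : L, X ^ 3 * Y + Y ^ 3 * Z + Z ^ 3 * X = 0 → X * Y * Z ≠ 0 → X + Y + Z ≠ 0 → X * Y + Y * Z + Z * X ≠ 0 →
      Pt (-4 * (X * Y + Y * Z + Z * X) ^ 2 / ((X + Y + Z) * (X * Y * Z))) (5 - 2 * (X + Y + Z) ^ 2 / (X * Y + Y * Z + Z * X)) := by
    intro X Y Z hK h3 h1 h2
    have R : (X * Y + Y * Z + Z * X) ^ 4 + 7 * (X + Y + Z) ^ 2 * (X * Y * Z) ^ 2 - 5 * (X + Y + Z) ^ 3 * (X * Y + Y * Z + Z * X) * (X * Y * Z)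
        + (X + Y + Z) * (X * Y + Y * Z + Z * X) ^ 2 * (X * Y * Z) + (X + Y + Z) ^ 5 * (X * Y * Z) = 0 := by
      linear_combination (X * Y ^ 3 + Y * Z ^ 3 + Z * X ^ 3) * hK
    generalize X * Y + Y * Z + Z * X = s2 at *
    generalize X + Y + Z = s1 at *
    generalize X * Y * Z = s3 at *
    refine ⟨div_ne_zero (mul_ne_zero (by norm_num) (pow_ne_zero _ h2)) (mul_ne_zero h1 h3), ?_⟩
    field_simp
    linear_combination -16 * R
  have hp0 := p_ne
  have e1 : 9 * x + p ^ 3 * y + 3 * p * z = 9 * x + 3 * p * z + p ^ 3 * y := by ring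
  have e2 : 9 * x * (p ^ 3 * y) + p ^ 3 * y * (3 * p * z) + 3 * p * z * (9 * x) =
    3 * p * (9 * x * z + 3 * p ^ 2 * x * y + p ^ 3 * y * z) := by ring
  have e3 : 9 * x * (p ^ 3 * y) * (3 * p * z) = 27 * p ^ 4 * (x * y * z) := by ring
  have := gen (9 * x) (p ^ 3 * y) (3 * p * z) (by linear_combination (243 * p ^ 3) * h + (3 * p ^ 3 * y ^ 3 * z) * hp)
    (by rw [e3]; exact mul_ne_zero (mul_ne_zero (by norm_num) (pow_ne_zero _ hp0)) hx) (by rwa [e1])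
    (by rw [e2]; exact mul_ne_zero (mul_ne_zero (by norm_num) hp0) hT)
  rw [e1, e2, e3] at this
  convert this using 1
  generalize 9 * x * z + 3 * p ^ 2 * x * y + p ^ 3 * y * z = T at *
  generalize 9 * x + 3 * p * z + p ^ 3 * y = S at *
  generalize x * y * z = q at *
  rw [div_eq_div_iff (mul_ne_zero (mul_ne_zero (by norm_num) hx) hS) (mul_ne_zero hS (mul_ne_zero (mul_ne_zero (by norm_num) (pow_ne_zero _ hp0)) hx))]
  linear_combination (-27 * p ^ 2 * T ^ 2 * S * q) * hp14

theorem Pt.dbl {U w : L} (h : Pt U w) (hw : w ≠ 0) (hU : U ^ 2 - 112 ≠ 0) :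
    ∃ w', Pt ((U ^ 2 - 112) ^ 2 / (4 * U * (U ^ 2 + 21 * U + 112))) w' := by
  obtain ⟨h0, h1⟩ := h
  refine ⟨(w ^ 4 + 7) * U / (2 * w * (U ^ 2 - 112)), ?_⟩
  have e1 : (U ^ 2 - 112) ^ 2 / (4 * U * (U ^ 2 + 21 * U + 112)) = (w ^ 4 - 42 * w ^ 2 - 7) / (4 * w ^ 2) := by
    rw [← h1, div_eq_div_iff (mul_ne_zero (mul_ne_zero (by norm_num) h0) (mul_ne_zero h0 (pow_ne_zero _ hw))) (mul_ne_zero (by norm_num) (pow_ne_zero _ hw))]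
    linear_combination (-4 * w ^ 2) * (U * w ^ 2 + U ^ 2 - 21 * U + 112) * h1
  have e2 : (U ^ 2 - 112) ^ 2 = U ^ 2 * (w ^ 4 - 42 * w ^ 2 - 7) := by
    linear_combination - (U * w ^ 2 + U ^ 2 - 21 * U + 112) * h1
  refine ⟨?_, ?_⟩
  · rw [← h1]
    exact div_ne_zero (pow_ne_zero _ hU) (mul_ne_zero (mul_ne_zero (by norm_num) h0) (mul_ne_zero h0 (pow_ne_zero _ hw)))
  · have e3 : ((w ^ 4 + 7) * U / (2 * w * (U ^ 2 - 112))) ^ 2 = (w ^ 4 + 7) ^ 2 / (4 * w ^ 2 * (w ^ 4 - 42 * w ^ 2 - 7)) := by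
      have : w ^ 4 - 42 * w ^ 2 - 7 ≠ 0 := fun h => by rw [h, mul_zero] at e2; exact hU (by simpa using e2)
      rw [div_pow, mul_pow _ (U ^ 2 - 112), e2]
      field_simp
      norm_num
    have : w ^ 4 - 42 * w ^ 2 - 7 ≠ 0 := fun h => by rw [h, mul_zero] at e2; exact hU (by simpa using e2)
    rw [e1, e3]
    obtain ⟨A, hA⟩ : ∃ A, A = w ^ 4 - 42 * w ^ 2 - 7 := ⟨_, rfl⟩
    rw [← hA] at this ⊢
    field_simp
    rw [hA]; ring


theorem Ap_Q : Ap 49 (7 / 81 ^ 4 : L) (V7.i 71) :=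
  Ap_frac (81 ^ 4) (by norm_num) (V7.i 7) (V7.i 71) (by norm_num) (by rw [V7.pe_i]; push_cast; norm_num) (by decide +kernel)

theorem stepw {U w : L} (h : Pt U w) {k m : ℤ} {a : L} (hU : U = p ^ k * a) {v : V7} (ha : Ap 49 a v) (e1 e2 e3 e4 : ℕ)
    (q1 : (e1 : ℤ) = 28 - 2 * k) (q2 : (e2 : ℤ) = 2 * k - m) (q3 : (e3 : ℤ) = k - m) (q4 : (e4 : ℤ) = 28 - m) (v' : V7)
    (c0 : v.a % 2 = 1)
    (c1 : (((v.ppow 2).psub ((V7.i 71).pmul (V7.P.ppow e1)))).a % 2 = 1)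
    (c2 : (v.pmul ((((V7.P.ppow e2).pmul (v.ppow 2)).padd (((V7.i 21).pmul (V7.P.ppow e3)).pmul v)).padd ((V7.i 71).pmul (V7.P.ppow e4)))).a % 2 = 1)
    (c3 : ((v'.pmul (v.pmul ((((V7.P.ppow e2).pmul (v.ppow 2)).padd (((V7.i 21).pmul (V7.P.ppow e3)).pmul v)).padd ((V7.i 71).pmul (V7.P.ppow e4))))).psub
      ((V7.i 6561).pmul (((v.ppow 2).psub ((V7.i 71).pmul (V7.P.ppow e1))).ppow 2))).dck 49 = true) :
    ∃ U' w' a', Pt U' w' ∧ U' = p ^ (3 * k - m - 14) * a' ∧ Ap 49 a' v' := by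
  have hp0 := p_ne
  have f1 : U ^ 2 - 112 = p ^ (2 * k) * (a ^ 2 - 7 / 81 ^ 4 * p ^ e1) := by
    rw [hU, mul_sub, mul_left_comm, ← zpow_natCast p e1, ← zpow_add₀ hp0, q1]
    have : (2 * k + (28 - 2 * k) : ℤ) = (28 : ℕ) := by push_cast; ring
    rw [this, zpow_natCast, show (p ^ 28 : L) = 26244 ^ 2 by rw [← hp14]; ring]
    rw [mul_comm 2 k, zpow_mul]
    norm_cast
    norm_num
    ring
  have f2 : U ^ 2 + 21 * U + 112 = p ^ m * (p ^ e2 * a ^ 2 + 21 * p ^ e3 * a + 7 / 81 ^ 4 * p ^ e4) := by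
    have g1 : p ^ m * p ^ e2 = (p ^ k) ^ 2 := by
      rw [← zpow_natCast p e2, ← zpow_add₀ hp0, q2, ← zpow_natCast, ← zpow_mul]; congr 1; push_cast; ring
    have g2 : p ^ m * p ^ e3 = p ^ k := by
      rw [← zpow_natCast p e3, ← zpow_add₀ hp0, q3]; congr 1; ring
    have g3 : p ^ m * p ^ e4 = 26244 ^ 2 := by
      rw [← zpow_natCast p e4, ← zpow_add₀ hp0, q4]
      have : (m + (28 - m) : ℤ) = (28 : ℕ) := by push_cast; ring
      rw [this, zpow_natCast, ← hp14]; ring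
    rw [hU]
    linear_combination -a ^ 2 * g1 - 21 * a * g2 - 7 / 81 ^ 4 * g3
  have A1 := (ha.pow 2).sub (Ap_Q.mul (Ap_p.pow e1))
  have A2 := ha.mul ((((Ap_p.pow e2).mul (ha.pow 2)).add (((Ap_n 21).mul (Ap_p.pow e3)).mul ha)).add (Ap_Q.mul (Ap_p.pow e4)))
  have u1 := A1.unit (by norm_num) c1
  have u2 := A2.unit (by norm_num) c2
  have u0 := (ha.unit (by norm_num) c0).ne
  have A3 := ((Ap_n 6561).mul (A1.pow 2)).div A2 (by norm_num) c2 v' c3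
  have hw : w ≠ 0 := by
    rintro rfl
    have := h.2
    rw [f2] at this
    have h3 := u2.ne
    simp only [ne_eq, mul_eq_zero, not_or] at h3
    simp only [ne_eq, OfNat.ofNat_ne_zero, not_false_eq_true, zero_pow, mul_zero] at this
    rcases mul_eq_zero.mp this.symm with h4 | h4
    · exact zpow_ne_zero _ hp0 h4
    · exact h3.2 h4
  obtain ⟨w', hw'⟩ := h.dbl hw (by rw [f1]; exact mul_ne_zero (zpow_ne_zero _ hp0) u1.ne)
  refine ⟨_, w', _, hw', ?_, A3⟩
  rw [f1, f2, hU]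
  have h3 := u2.ne
  generalize a ^ 2 - 7 / 81 ^ 4 * p ^ e1 = A at *
  simp only [ne_eq, mul_eq_zero, not_or] at h3
  obtain ⟨_, h3⟩ := h3
  generalize (p ^ e2 * a ^ 2 + 21 * p ^ e3 * a + 7 / 81 ^ 4 * p ^ e4) = B at *
  have g4 : (p ^ (2 * k)) ^ 2 = p ^ (3 * k - m - 14) * (p ^ k * p ^ m * 26244) := by
    rw [← hp14, ← zpow_natCast p 14, ← zpow_natCast, ← zpow_mul, ← zpow_add₀ hp0, ← zpow_add₀ hp0, ← zpow_add₀ hp0]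
    congr 1; push_cast; ring
  have z1 : p ^ k ≠ 0 := zpow_ne_zero _ hp0
  have z2 : p ^ m ≠ 0 := zpow_ne_zero _ hp0
  rw [mul_pow, g4]
  generalize p ^ k = pk at *
  generalize p ^ m = pm at *
  generalize p ^ (3 * k - m - 14) = pq at *
  field_simp
  norm_num
  ring


def vG : V7 := ⟨35, 35, 31, 0, 0, -25, 0⟩
def vH : V7 := ⟨45, 56, -37, -22, -49, -24, -8⟩

theorem apG : Ap 49 ((-9 + 3 * p ^ 2 - p ^ 3) ^ 2 / (19683 * (9 - 3 * p + p ^ 3)) : L) vG := by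
  have a1 : Ap 49 (-9 + 3 * p ^ 2 - p ^ 3 : L) ⟨-9, 0, 3, -1, 0, 0, 0⟩ := by
    have := Ap_pe (r := 49) ⟨-9, 0, 3, -1, 0, 0, 0⟩
    convert this using 1; simp only [V7.pe]; push_cast; ring
  have a2 : Ap 49 (9 - 3 * p + p ^ 3 : L) ⟨9, -3, 0, 1, 0, 0, 0⟩ := by
    have := Ap_pe (r := 49) ⟨9, -3, 0, 1, 0, 0, 0⟩
    convert this using 1; simp only [V7.pe]; push_cast; ring
  exact (a1.pow 2).div ((Ap_n 19683).mul a2) (by norm_num) (by decide +kernel) vG (by decide +kernel)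

theorem exG : ∃ U w a, Pt U w ∧ U = p ^ (12 : ℤ) * a ∧ Ap 49 a vG := by
  have a1 : (-9 + 3 * p ^ 2 - p ^ 3 : L) ≠ 0 := by
    have := (V7.unit ⟨-9, 0, 3, -1, 0, 0, 0⟩ (by norm_num)).ne
    convert this using 1; simp only [V7.pe]; push_cast; ring
  have a2 : (9 - 3 * p + p ^ 3 : L) ≠ 0 := by
    have := (V7.unit ⟨9, -3, 0, 1, 0, 0, 0⟩ (by norm_num)).ne
    convert this using 1; simp only [V7.pe]; push_cast; ring
  have h := phi (x := 1) (y := 1) (z := -1) (by norm_num) (by norm_num) (by convert a2 using 1; ring) (by convert a1 using 1; ring)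
  refine ⟨_, _, _, h, ?_, apG⟩
  have e1 : (9 * 1 * -1 + 3 * p ^ 2 * 1 * 1 + p ^ 3 * 1 * -1 : L) = -9 + 3 * p ^ 2 - p ^ 3 := by ring
  have e2 : (9 * 1 + 3 * p * -1 + p ^ 3 * 1 : L) = 9 - 3 * p + p ^ 3 := by ring
  rw [e1, e2]
  generalize (-9 + 3 * p ^ 2 - p ^ 3 : L) = T at *
  generalize (9 - 3 * p + p ^ 3 : L) = S at *
  have : p ^ (12 : ℤ) = p ^ 12 := by norm_cast
  rw [this]
  field_simp

theorem ex2G : ∃ U w a, Pt U w ∧ U = p ^ (10 : ℤ) * a ∧ Ap 49 a vH := by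
  obtain ⟨U, w, a, h1, h2, h3⟩ := exG
  exact stepw h1 h2 h3 (m := 12) 4 12 0 16 (by norm_num) (by norm_num) (by norm_num) (by norm_num) vH
    (by decide +kernel) (by decide +kernel) (by decide +kernel) (by decide +kernel)

theorem ex32 : ∃ U w a, Pt U w ∧ U = p ^ (-30 : ℤ) * a ∧ Ap 49 a ⟨-39, -56, 3, 34, -5, 22, -42⟩ := by
  obtain ⟨U, w, a, h1, h2, h3⟩ := ex2G
  obtain ⟨U, w, a, h1, h2, h3⟩ := stepw h1 h2 h3 (m := 10) 8 10 0 18 (by norm_num) (by norm_num) (by norm_num) (by norm_num) ⟨61, 46, -10, 50, 23, 34, -14⟩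
    (by decide +kernel) (by decide +kernel) (by decide +kernel) (by decide +kernel)
  obtain ⟨U, w, a, h1, h2, h3⟩ := stepw h1 h2 h3 (m := 6) 16 6 0 22 (by norm_num) (by norm_num) (by norm_num) (by norm_num) ⟨61, 34, 12, -38, 54, -26, 7⟩
    (by decide +kernel) (by decide +kernel) (by decide +kernel) (by decide +kernel)
  obtain ⟨U, w, a, h1, h2, h3⟩ := stepw h1 h2 h3 (m := -4) 32 0 2 32 (by norm_num) (by norm_num) (by norm_num) (by norm_num) ⟨-7, 8, -9, -62, 11, 54, 6⟩
    (by decide +kernel) (by decide +kernel) (by decide +kernel) (by decide +kernel)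
  exact stepw h1 h2 h3 (m := -32) 60 0 16 60 (by norm_num) (by norm_num) (by norm_num) (by norm_num) ⟨-39, -56, 3, 34, -5, 22, -42⟩
    (by decide +kernel) (by decide +kernel) (by decide +kernel) (by decide +kernel)

theorem p28 : (112 : L) = p ^ 28 * (7 / 81 ^ 4) := by
  rw [show (p ^ 28 : L) = 26244 ^ 2 by rw [← hp14]; ring]; norm_num

theorem lam : ∃ l tl μ, Zt 15 l tl ∧ l = p ^ 15 * μ ∧ Ap 21 μ ⟨1, 1, 0, 1, 0, 0, 0⟩ := by
  obtain ⟨U, w, a, h1, h2, h3⟩ := ex32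
  have hp0 := p_ne
  have ha := h3.unit (by norm_num) (by decide +kernel)
  have ha0 := ha.ne
  have hsq : (p ^ 15 * w) ^ 2 = a + 21 * p ^ 30 + p ^ 88 * (7 / 81 ^ 4) / a := by
    have h4 : p ^ (-30 : ℤ) = (p ^ 30)⁻¹ := by rw [zpow_neg]; norm_cast
    have h5 := h1.2
    rw [h2, h4, p28] at h5
    generalize (7 / 81 ^ 4 : L) = q at *
    field_simp at h5 ⊢
    linear_combination h5
  have A1 := (((h3.mono (show 28 ≤ 49 by norm_num)).add ((Ap_n 21).mul (Ap_p.pow 30))).add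
      (((Ap_p.pow 88).mul (Ap_Q.mono (by norm_num))).div (h3.mono (by norm_num)) (by norm_num) (by decide +kernel) (V7.i 0) (by decide +kernel)))
  rw [← hsq] at A1
  have key : ∃ w', Pt U w' ∧ Ap 21 (p ^ 15 * w') ⟨3, -3, -1, -2, -3, -4, -2⟩ := by
    rcases Ap_sqrt (r := 21) A1 (by norm_num) ⟨3, -3, -1, -2, -3, -4, -2⟩ (by decide +kernel) (by decide +kernel) with h | h
    · exact ⟨w, h1, h⟩
    · exact ⟨-w, h1.neg, by rwa [mul_neg]⟩
  obtain ⟨w', k1, k2⟩ := key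
  have k3 := k2.unit (by norm_num) (by decide +kernel)
  have k4 := Ap_1.div k2 (by norm_num) (by decide +kernel) ⟨1, 1, 0, 1, 0, 0, 0⟩ (by decide +kernel)
  have k5 : E (-15) w' := by
    have := k3.div (E_npow 15)
    rw [mul_div_cancel_left₀ _ (pow_ne_zero _ hp0)] at this
    simpa using this
  refine ⟨_, _, _, k1.zt (n := 15) k5 (by rw [h2]; simpa using (E_pp (-30)).mul ha), ?_, k4⟩
  have := k5.ne
  field_simp

theorem ptw {k : ℕ} {U w a : L} {v v' : V7} (h : Pt U w) (h1 : U = p ^ k * a) (h2 : Ap 49 a v) (hk : k ≤ 28) (u : V7) (c1 : v.a % 2 = 1) 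
    (c2 : ((v'.pmul v).psub (((V7.P.ppow (28 - k)).pmul (V7.i 71)))).dck 49 = true) (cu : u.a % 2 = 1)
    (c3 : ((u.pmul u).psub ((((V7.P.ppow k).pmul v).padd (V7.i 21)).padd v')).dck 49 = true) : ∃ w', Pt U w' ∧ Ap 42 w' u := by
  have hp0 := p_ne
  have ha0 := (h2.unit (by norm_num) c1).ne
  have hsq : w ^ 2 = p ^ k * a + 21 + p ^ (28 - k) * (7 / 81 ^ 4) / a := by
    have h5 := h.2
    have h6 : p ^ 28 = p ^ (28 - k) * p ^ k := by rw [← pow_add]; congr 1; omega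
    rw [h1, p28, h6] at h5
    generalize (7 / 81 ^ 4 : L) = q at *
    have : p ^ k ≠ 0 := pow_ne_zero _ hp0
    generalize p ^ k = pk at *
    field_simp at h5 ⊢
    linear_combination h5
  have A1 : Ap 49 (w ^ 2) ((((V7.P.ppow k).pmul v).padd (V7.i 21)).padd v') := by
    rw [hsq]
    exact ((((Ap_p.pow k).mul h2).add (Ap_n 21)).add (((Ap_p.pow _).mul Ap_Q).div h2 (by norm_num) c1 _ c2))
  rcases Ap_sqrt (r := 42) A1 (by norm_num) u cu c3 with h' | h'
  · exact ⟨w, h, h'⟩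
  · exact ⟨-w, h.neg, h'⟩

end C3
end

section
open Polynomial NumberField
namespace C3

theorem ex_two (n : ℤ) (hn : n ≠ 0) : ∃ (k : ℕ) (σ : ℤ), n = 2 ^ k * σ ∧ σ % 2 = 1 := by
  obtain ⟨σ, h1, h2⟩ := (Int.finiteMultiplicity_iff (a := 2) (b := n) |>.mpr ⟨by decide, hn⟩).exists_eq_pow_mul_and_not_dvd
  exact ⟨_, σ, h1, by omega⟩

theorem E_2k {n σ : ℤ} {k : ℕ} (h : n = 2 ^ k * σ) (hσ : σ % 2 = 1) : E (7 * k) (n : L) := by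
  have := (E_two.pow k).mul (E_odd σ hσ)
  rw [h]; push_cast
  convert this using 1; ring

noncomputable def SS (x y z : L) : L := 9 * x + 3 * p * z + p ^ 3 * y
noncomputable def TT (x y z : L) : L := 9 * x * z + 3 * p ^ 2 * x * y + p ^ 3 * y * z
noncomputable def UU (x y z : L) : L := -p ^ 12 * (TT x y z) ^ 2 / (19683 * (x * y * z) * SS x y z)
noncomputable def ww (x y z : L) : L := 5 - 2 * (SS x y z) ^ 2 / (3 * p * TT x y z)

theorem pt {x y z : L} (h : 3 * x ^ 3 * y + 2 * y ^ 3 * z + z ^ 3 * x = 0)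
    (hx : x * y * z ≠ 0) (hS : SS x y z ≠ 0) (hT : TT x y z ≠ 0) : Pt (UU x y z) (ww x y z) := phi h hx hS hT

theorem E_odd' {n : ℕ} [n.AtLeastTwo] (h : (OfNat.ofNat n : ℤ) % 2 = 1) : E 0 (OfNat.ofNat n : L) := by
  have := E_odd _ h; exact_mod_cast this

theorem UU_E {x y z : L} {s t q : ℤ} (hS : E s (SS x y z)) (hT : E t (TT x y z)) (hq : E q (x * y * z)) :
    E (12 + 2 * t - q - s) (UU x y z) := by
  have := (((E_npow 12).neg.mul (hT.pow 2))).div ((((E_odd' (n := 19683) (by norm_num))).mul hq).mul hS)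
  rw [UU]
  convert this using 1
  push_cast; ring

theorem ww_E {x y z : L} {s t : ℤ} (hS : E s (SS x y z)) (hT : E t (TT x y z)) (h : 6 + 2 * s - t < 0) :
    E (6 + 2 * s - t) (ww x y z) := by
  have := (E_two.mul (hS.pow 2)).div (((E_odd' (n := 3) (by norm_num)).mul E_p).mul hT)
  have := this.subD (E_odd' (n := 5) (by norm_num)).d (by push_cast; omega)
  have := this.neg
  rw [ww]
  convert this using 1
  · push_cast; ring
  · ring

/-- case B1 -/
theorem caseB1 {x y z : ℤ} (h : 3 * x ^ 3 * y + 2 * y ^ 3 * z + z ^ 3 * x = 0) (hz : z % 2 = 1) (hx : x % 2 = 0) (hy : y % 2 = 0)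
    (hx0 : x ≠ 0) (hy0 : y ≠ 0) : False := by
  have hL : 3 * (x : L) ^ 3 * y + 2 * (y : L) ^ 3 * z + (z : L) ^ 3 * x = 0 := by exact_mod_cast h
  obtain ⟨k, σ, rfl, hσ⟩ := ex_two y hy0
  have hk : 1 ≤ k := by
    rcases Nat.eq_zero_or_pos k with rfl | h
    · simp at hy; omega
    · exact h
  have Ey := E_2k rfl hσ (n := 2 ^ k * σ) (k := k)
  have Ez := E_odd z hz
  generalize 2 ^ k * σ = y at *
  have Ex : E (21 * k + 7) (x : L) := by
    have h1 : E 0 (((z ^ 3 + 3 * x ^ 2 * y : ℤ)) : L) := E_odd _ (by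
      obtain ⟨b, rfl⟩ := Int.dvd_of_emod_eq_zero hx
      have : z ^ 3 % 2 = 1 := by rcases Int.odd_iff.mpr hz with ⟨c, rfl⟩; ring_nf; omega
      ring_nf; omega)
    have h2 := ((E_two.mul (Ey.pow 3)).mul Ez).neg.div h1
    have h3 : (x : L) = -(2 * (y : L) ^ 3 * z) / ((z ^ 3 + 3 * x ^ 2 * y : ℤ) : L) := by
      rw [eq_div_iff h1.ne]; push_cast; linear_combination hL
    rw [h3]
    convert h2 using 1
    push_cast; ring
  have hS : E 1 (SS x y z) := by
    have := (((E_odd' (n := 3) (by norm_num)).mul E_p).mul Ez).addD (((E_odd' (n := 9) (by norm_num)).mul Ex).d.mono (show 2 ≤ _ by omega) |>.add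
      (((E_npow 3).mul Ey).d.mono (by push_cast; omega))) (by norm_num)
    rw [SS]; convert this using 1
    all_goals ring
  have hT : E (3 + 7 * k) (TT x y z) := by
    have := (((E_npow 3).mul Ey).mul Ez).addD ((((E_odd' (n := 9) (by norm_num)).mul Ex).mul Ez).d.mono (show (4 + 7 * k : ℤ) ≤ _ by omega) |>.add
      ((((E_odd' (n := 3) (by norm_num)).mul (E_npow 2)).mul Ex).mul Ey |>.d.mono (by push_cast; omega))) (by push_cast; omega)
    rw [TT]; convert this using 1
    · push_cast; ring
    · ring
  have hq := (Ex.mul Ey).mul Ez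
  have hU := UU_E hS hT hq
  have hw := ww_E hS hT (by omega)
  exact near (n := 7 * k - 5) (U := UU x y z) (w := ww x y z) ⟨pt hL hq.ne hS.ne hT.ne, by omega, by convert hw using 1; ring, by convert hU using 1; ring⟩ (by omega)


theorem odd_cube {z : ℤ} (h : z % 2 = 1) : z ^ 3 % 2 = 1 := by
  rcases Int.odd_iff.mpr h with ⟨c, rfl⟩; ring_nf; omega

/-- case C, `4 ∣ x` -/
theorem caseC2 {x y z : ℤ} (h : 3 * x ^ 3 * y + 2 * y ^ 3 * z + z ^ 3 * x = 0) (hy : y % 2 = 1) (hx : x % 4 = 0) (hz : z % 2 = 0)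
    (hx0 : x ≠ 0) (hz0 : z ≠ 0) : False := by
  have hL : 3 * (x : L) ^ 3 * y + 2 * (y : L) ^ 3 * z + (z : L) ^ 3 * x = 0 := by exact_mod_cast h
  obtain ⟨k, σ, rfl, hσ⟩ := ex_two x hx0
  have hk : 2 ≤ k := by
    by_contra hc
    have hc2 : k = 0 ∨ k = 1 := by omega
    clear h hL
    rcases hc2 with rfl | rfl
    · rw [pow_zero] at hx; omega
    · rw [pow_one] at hx; omega
  have Ex := E_2k rfl hσ (n := 2 ^ k * σ) (k := k)
  have Ey := E_odd y hy
  generalize 2 ^ k * σ = x at *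
  have Ez : E (21 * k - 7) (z : L) := by
    obtain ⟨b, rfl⟩ := Int.dvd_of_emod_eq_zero hz
    have h1 : E 0 (((y ^ 3 + 2 * b ^ 2 * x : ℤ)) : L) := E_odd _ (by
      have := odd_cube hy
      rw [mul_assoc]; omega)
    have h2 := (((E_odd' (n := 3) (by norm_num)).mul (Ex.pow 3)).mul Ey).neg.div (E_two.mul h1)
    have h3 : ((2 * b : ℤ) : L) = -(3 * (x : L) ^ 3 * y) / (2 * ((y ^ 3 + 2 * b ^ 2 * x : ℤ) : L)) := by
      rw [eq_div_iff (E_two.mul h1).ne]; push_cast at hL ⊢; linear_combination hL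
    rw [h3]
    convert h2 using 1
    push_cast; ring
  have hS : E 3 (SS x y z) := by
    have := ((E_npow 3).mul Ey).addD (((E_odd' (n := 9) (by norm_num)).mul Ex).d.mono (show 4 ≤ _ by omega) |>.add
      ((((E_odd' (n := 3) (by norm_num)).mul E_p).mul Ez).d.mono (by push_cast; omega))) (by norm_num)
    rw [SS]; convert this using 1
    all_goals ring
  have hT : E (2 + 7 * k) (TT x y z) := by
    have := ((((E_odd' (n := 3) (by norm_num)).mul (E_npow 2)).mul Ex).mul Ey).addD ((((E_odd' (n := 9) (by norm_num)).mul Ex).mul Ez).d.mono (show (3 + 7 * k : ℤ) ≤ _ by omega) |>.add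
      ((((E_npow 3).mul Ey).mul Ez).d.mono (by push_cast; omega))) (by push_cast; omega)
    rw [TT]; convert this using 1
    · push_cast; ring
    · ring
  have hq := (Ex.mul Ey).mul Ez
  have hU := UU_E hS hT hq
  have hw := ww_E hS hT (by omega)
  exact near (n := 7 * k - 10) (U := UU x y z) (w := ww x y z) ⟨pt hL hq.ne hS.ne hT.ne, by omega, by convert hw using 1; ring, by convert hU using 1; ring⟩ (by omega)

/-- valuation data for `x` odd, `z` even -/
theorem dataA {x y z : ℤ} (h : 3 * x ^ 3 * y + 2 * y ^ 3 * z + z ^ 3 * x = 0) (hx : x % 1024 = 1) (k : ℕ) (hk : 1 ≤ k) (Ez : E (7 * k) (z : L)) :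
    E (21 * k) (y : L) ∧ E 0 (SS x y z) ∧ E (7 * k) (TT x y z) ∧ E (7 * k + 21 * k) ((x : L) * y * z) := by
  have hL : 3 * (x : L) ^ 3 * y + 2 * (y : L) ^ 3 * z + (z : L) ^ 3 * x = 0 := by exact_mod_cast h
  have Ex := E_odd x (by omega)
  have Ey : E (21 * k) (y : L) := by
    have h1 : E 0 (((3 * x ^ 3 + 2 * (y ^ 2 * z) : ℤ)) : L) := E_odd _ (by
      have := odd_cube (z := x) (by omega)
      omega)
    have h2 := ((Ez.pow 3).mul Ex).neg.div h1
    have h3 : (y : L) = -((z : L) ^ 3 * x) / ((3 * x ^ 3 + 2 * (y ^ 2 * z) : ℤ) : L) := by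
      rw [eq_div_iff h1.ne]; push_cast; linear_combination hL
    rw [h3]
    convert h2 using 1
    push_cast; ring
  refine ⟨Ey, ?_, ?_, ?_⟩
  · have := (((E_odd' (n := 9) (by norm_num)).mul Ex)).addD (((((E_odd' (n := 3) (by norm_num)).mul E_p).mul Ez)).d.mono (show 1 ≤ _ by omega) |>.add
      (((E_npow 3).mul Ey).d.mono (by push_cast; omega))) (by norm_num)
    rw [SS]; convert this using 1
    all_goals ring
  · have := (((E_odd' (n := 9) (by norm_num)).mul Ex).mul Ez).addD ((((((E_odd' (n := 3) (by norm_num)).mul (E_npow 2)).mul Ex).mul Ey)).d.mono (show (1 + 7 * k : ℤ) ≤ _ by push_cast; omega) |>.add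
      ((((E_npow 3).mul Ey).mul Ez).d.mono (by push_cast; omega))) (by push_cast; omega)
    rw [TT]; convert this using 1
    all_goals ring
  · convert (Ex.mul Ey).mul Ez using 1; ring

theorem D_x {x : ℤ} (hx : x % 1024 = 1) : D 70 ((x : L) - 1) := by
  have := Ap_mod 10 x 1 (by omega)
  rw [Ap, V7.pe_i] at this
  exact_mod_cast this

end C3
end

section
open Polynomial NumberField
namespace C3

theorem D1_mul {u v : L} {k : ℤ} (hk : 0 < k) (h : D k (u - 1)) (h' : D k (v - 1)) : D k (u * v - 1) := lev_mul hk h h'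
theorem D1_div {u v : L} {k : ℤ} (hk : 0 < k) (h : D k (u - 1)) (h' : D k (v - 1)) : D k (u / v - 1) := by
  have hv := unit_of_lev hk h'
  have := (h.sub h').div hv
  have h0 := hv.ne
  convert this using 1
  · ring
  · field_simp; ring
theorem D1_odd (n : ℤ) (h : n % 2 = 1) : D 7 ((n : L) - 1) := by
  have := Ap_mod 1 n 1 (by simpa using h)
  rw [Ap, V7.pe_i] at this
  exact_mod_cast this

theorem caseA1 {x y z : ℤ} (h : 3 * x ^ 3 * y + 2 * y ^ 3 * z + z ^ 3 * x = 0) (hx : x % 1024 = 1) (hz : z % 4 = 0)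
    (hz0 : z ≠ 0) : False := by
  have hL : 3 * (x : L) ^ 3 * y + 2 * (y : L) ^ 3 * z + (z : L) ^ 3 * x = 0 := by exact_mod_cast h
  obtain ⟨k, σ, hzk, hσ⟩ := ex_two z hz0
  have hk : 2 ≤ k := by
    by_contra hc
    have hc2 : k = 0 ∨ k = 1 := by omega
    clear h hL
    rw [hzk] at hz
    rcases hc2 with rfl | rfl
    · rw [pow_zero] at hz; omega
    · rw [pow_one] at hz; omega
  have Ez := E_2k hzk hσ
  obtain ⟨Ey, hS, hT, hq⟩ := dataA h hx k (by omega) Ez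
  have hU := UU_E hS hT hq
  have hw := ww_E hS hT (by omega)
  have hpt := (pt hL hq.ne hS.ne hT.ne).neg
  have hZ := hpt.zt (n := 7 * k - 6) (by convert hw.neg using 1; ring) (by convert hU using 1; ring)
  have Ex := E_odd x (by omega)
  have dx : D 2 ((x : L) - 1) := (D_x hx).mono (by norm_num)
  have d9 : D 2 ((9 : L) - 1) := by
    have := D1_odd 9 (by norm_num); exact_mod_cast this.mono (by norm_num)
  have d9x := D1_mul (by norm_num) d9 dx
  -- `T / z`
  have dT : D 2 (TT x y z / z - 1) := by
    have h1 : D (2 + 7 * k) (3 * p ^ 2 * (x : L) * y + p ^ 3 * y * z) :=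
      ((((E_odd' (n := 3) (by norm_num)).mul (E_npow 2)).mul Ex).mul Ey |>.d.mono (by push_cast; omega)).add
      ((((E_npow 3).mul Ey).mul Ez).d.mono (by push_cast; omega))
    have h2 := (h1.div Ez).mono (show 2 ≤ _ by omega)
    have h3 := h2.add d9x
    have := Ez.ne
    convert h3 using 1
    rw [TT]; field_simp; ring
  have dS : D 2 (SS x y z - 1) := by
    have h1 := ((((E_odd' (n := 3) (by norm_num)).mul E_p).mul Ez)).d.mono (show 2 ≤ _ by omega) |>.add
      (((E_npow 3).mul Ey).d.mono (by push_cast; omega))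
    have h3 := h1.add d9x
    convert h3 using 1
    rw [SS]; ring
  have dA : D 2 ((SS x y z) ^ 2 - 15 * p * TT x y z / 2 - 1) := by
    have h1 := D1_mul (by norm_num) dS dS
    have h2 := ((((E_odd' (n := 15) (by norm_num)).mul E_p).mul hT).div E_two).d.mono (show 2 ≤ _ by omega)
    convert h1.sub h2 using 1
    ring
  have du := D1_div (by norm_num) dT dA
  obtain ⟨u0, hu0⟩ : ∃ u0, u0 = TT x y z / z / ((SS x y z) ^ 2 - 15 * p * TT x y z / 2) := ⟨_, rfl⟩
  rw [← hu0] at du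
  have hz' : 1 / -ww x y z = 3 * p * z / 2 * u0 := by
    have e1 := hw.ne
    have e2 := (unit_of_lev (by norm_num) dA).ne
    have e3 := Ez.ne
    have e4 := hT.ne
    have e5 := p_ne
    have e6 : -ww x y z = 2 * ((SS x y z) ^ 2 - 15 * p * TT x y z / 2) / (3 * p * TT x y z) := by
      rw [ww]; field_simp; ring
    rw [e6, hu0, one_div_div]
    generalize ((SS x y z) ^ 2 - 15 * p * TT x y z / 2) = A at *
    field_simp
  obtain ⟨l, tl, μ, hl, hlμ, hμ⟩ := lam
  have hμ1 : E 1 (μ - 1) := by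
    have h1 := hμ.sub (Ap_1 (r := 21))
    have h2 : Ap 21 (μ - 1 - p) _ := h1.sub Ap_p
    have h3 := h2.toD 2 (by norm_num) (by decide +kernel)
    have := E_p.addD h3 (by norm_num)
    simpa using this
  have he : E 16 (12 * p * σ * u0 - l) := by
    have h1 : D 2 ((σ : L) / ((2187 : ℤ) : L) - 1) := D1_div (by norm_num) ((D1_odd σ hσ).mono (by norm_num)) ((D1_odd 2187 (by norm_num)).mono (by norm_num))
    have h2 := hμ1.subD (D1_mul (by norm_num) h1 du) (by norm_num)
    have h3 := ((E_npow 15).mul h2).neg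
    convert h3 using 1
    · norm_num
    · rw [hlμ]
      push_cast
      have : (12 : L) = p ^ 14 / 2187 := by rw [hp14]; norm_num
      rw [this]; ring
  rcases Nat.lt_or_ge k 3 with hk3 | hk3
  · obtain rfl : k = 2 := by omega
    refine final8 hl 1 (z := 1 / -ww x y z) (e := 12 * p * σ * u0 - l) (by convert hZ using 1; norm_num) ?_ he (by norm_num) (by norm_num) (by norm_num)
    rw [hz', hzk]; push_cast; ring
  · obtain ⟨j, rfl⟩ := Nat.exists_eq_add_of_le' hk3
    refine final hl j 1 (z := 1 / -ww x y z) (e := 12 * p * σ * u0 - l) (by convert hZ using 1; push_cast; ring) ?_ he (by norm_num) (by norm_num)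
    rw [hz', hzk]; push_cast; ring

theorem caseA2 {x y z : ℤ} (h : 3 * x ^ 3 * y + 2 * y ^ 3 * z + z ^ 3 * x = 0) (hx : x % 1024 = 1) (hz : z % 4 = 2) : False := by
  have hL : 3 * (x : L) ^ 3 * y + 2 * (y : L) ^ 3 * z + (z : L) ^ 3 * x = 0 := by exact_mod_cast h
  obtain ⟨σ, rfl⟩ : ∃ σ, z = 2 * σ := ⟨z / 2, by omega⟩
  have Ez := E_2k (n := 2 * σ) (σ := σ) (k := 1) (by ring) (by omega)
  obtain ⟨Ey, hS, hT, hq⟩ := dataA h hx 1 (by omega) Ez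
  have hU := UU_E hS hT hq
  have hpt := (pt hL hq.ne hS.ne hT.ne)
  have hsel := hpt.sel _ (by norm_num) hU
  have Ex := E_odd x (by omega)
  have dx := D_x hx
  have hQ : E 0 (3 * (x : L) ^ 3 + 2 * (y : L) ^ 2 * (2 * σ : ℤ)) := by
    have h1 := ((E_odd' (n := 3) (by norm_num)).mul (Ex.pow 3)).addD ((E_two.mul (Ey.pow 2)).mul Ez).d (by norm_num)
    simpa using h1
  have hS11 : E 11 (9 * (1 + p ^ 4) ^ 2 - SS x y (2 * σ : ℤ)) := by
    have h1 : E 11 (18 * p ^ 4) := by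
      have := (E_two.mul (E_odd' (n := 9) (by norm_num))).mul (E_npow 4)
      convert this using 1
      all_goals norm_num
    have h2 : D 12 (((1458 - 6 * σ : ℤ) : L) * p) := by
      obtain ⟨b, hb⟩ : ∃ b, 1458 - 6 * σ = 2 ^ 2 * b := ⟨(1458 - 6 * σ) / 4, by omega⟩
      rw [hb]; push_cast
      have h2 := ((((E_two.pow 2).d.mul (D_int b)).mul E_p.d).mono (show 12 ≤ _ by norm_num))
      norm_num at h2; exact h2
    have h3 : D 12 (9 * ((x : L) - 1)) := ((D_ofNat 9).mul dx).mono (by norm_num)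
    have h4 : D 12 (p ^ 3 * (y : L)) := ((E_npow 3).mul Ey).d.mono (by norm_num)
    have h5 := ((h1.addD h2 (by norm_num)).subD h3 (by norm_num)).subD h4 (by norm_num)
    convert h5 using 1
    rw [SS]; push_cast
    linear_combination (9 * p) * hp
  have he : E 11 ((3 * (9 * (1 + p ^ 4) ^ 2 - SS x y (2 * σ : ℤ)) + (3 * (x : L) ^ 3 + 2 * (y : L) ^ 2 * (2 * σ : ℤ) - 3) * (9 * (1 + p ^ 4) ^ 2)) / (3 * SS x y (2 * σ : ℤ))) := by
    have h3 : D 12 (3 * (x : L) ^ 3 + 2 * (y : L) ^ 2 * (2 * σ : ℤ) - 3) := by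
      have hxx : D 0 ((x : L) ^ 2 + x + 1) := by
        have := D_int (x ^ 2 + x + 1)
        exact_mod_cast this
      have h1 : D 12 (3 * (((x : L) - 1) * ((x : L) ^ 2 + x + 1))) :=
        ((D_ofNat 3).mul (dx.mul hxx)).mono (by norm_num)
      have h2 := ((E_two.mul (Ey.pow 2)).mul Ez).d.mono (show 12 ≤ _ by norm_num)
      convert h1.add h2 using 1
      ring
    have h4 : D 0 (9 * (1 + p ^ 4) ^ 2) := by
      have := (D_ofNat 9).mul ((D_1.add ((E_npow 4).d.mono (by norm_num))).pow 2)
      simpa using this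
    have := (((E_odd' (n := 3) (by norm_num)).mul hS11).addD (h3.mul h4) (by norm_num)).div ((E_odd' (n := 3) (by norm_num)).mul hS)
    simpa using this
  have hp4 : E 0 (1 + p ^ 4) := N_one.e.addD (E_npow 4).d (by norm_num)
  refine sel_absurd hsel (f := p ^ 6 * TT x y (2 * σ : ℤ) / (81 * x * (2 * σ : ℤ) ^ 2 * (3 * (1 + p ^ 4)))) ?_ ?_ he (by norm_num)
  · exact div_ne_zero (mul_ne_zero (E_npow 6).ne hT.ne) (mul_ne_zero (mul_ne_zero (mul_ne_zero (by norm_num) Ex.ne) (pow_ne_zero _ Ez.ne)) (mul_ne_zero (by norm_num) hp4.ne))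
  · have e1 := Ex.ne
    have e2 := Ey.ne
    have e3 := Ez.ne
    have e4 := hS.ne
    have e5 := hp4.ne
    have e6 := hQ.ne
    have e7 : (1 + (3 * (9 * (1 + p ^ 4) ^ 2 - SS x y (2 * σ : ℤ)) + (3 * (x : L) ^ 3 + 2 * (y : L) ^ 2 * (2 * σ : ℤ) - 3) * (9 * (1 + p ^ 4) ^ 2)) / (3 * SS x y (2 * σ : ℤ)))
      = (3 * (x : L) ^ 3 + 2 * (y : L) ^ 2 * (2 * σ : ℤ)) * (9 * (1 + p ^ 4) ^ 2) / (3 * SS x y (2 * σ : ℤ)) := by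
      field_simp
      ring
    rw [e7, UU]
    generalize SS x y (2 * σ : ℤ) = S at *
    generalize TT x y (2 * σ : ℤ) = T at *
    generalize ((2 * σ : ℤ) : L) = z at *
    generalize 1 + p ^ 4 = c at *
    rw [div_pow, div_mul_div_comm, div_eq_div_iff]
    · linear_combination (-p ^ 12 * T ^ 2 * 81 ^ 2 * x * z * 27 * c ^ 2 * S) * hL
    · exact mul_ne_zero (mul_ne_zero (by norm_num) (mul_ne_zero (mul_ne_zero e1 e2) e3)) e4
    · exact mul_ne_zero (pow_ne_zero _ (mul_ne_zero (mul_ne_zero (mul_ne_zero (by norm_num) e1) (pow_ne_zero _ e3)) (mul_ne_zero (by norm_num) e5))) (mul_ne_zero (by norm_num) e4)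

end C3
end

section
open Polynomial NumberField
namespace C3

theorem lev_ap {r : ℕ} {x : L} {v : V7} (h : Ap r x v) (c : V7) (hc : c.a % 2 = 1) (k : ℕ) (hk : k < r)
    (ck : ((v.psub (c.ppow 2)).psub (V7.P.ppow k)).dck (k + 1) = true) : ∃ e, x = c.pe ^ 2 * (1 + e) ∧ E k e := by
  have hu := c.unit hc
  have A := (h.sub ((Ap_pe c).pow 2)).sub (Ap_p.pow k)
  have d := A.toD (k + 1) hk ck
  have h1 := (E_npow k).addD d (by push_cast; omega)
  have h2 := h1.div (hu.pow 2)
  have h0 := hu.ne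
  refine ⟨_, ?_, by convert h2 using 1; simp⟩
  field_simp
  ring

theorem sel_ap {u s x : L} (hu : Sel u) (hs : s ≠ 0) (h : u = s ^ 2 * x) {r : ℕ} {v : V7} (ha : Ap r x v) (c : V7) (hc : c.a % 2 = 1)
    (hr : 9 < r) (ck : ((v.psub (c.ppow 2)).psub (V7.P.ppow 9)).dck (9 + 1) = true) : False := by
  obtain ⟨e, he, hE⟩ := lev_ap ha c hc 9 hr ck
  exact sel_absurd hu (f := s * c.pe) (mul_ne_zero hs (c.unit hc).ne) (by rw [h, he]; ring) hE (by norm_num)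

theorem UU_sq {x y z : L} (hq : x * y * z ≠ 0) (hS : SS x y z ≠ 0) :
    UU x y z = (p ^ 6 * TT x y z / (243 * (x * y * z) * SS x y z)) ^ 2 * (-3 * (x * y * z) * SS x y z) := by
  rw [UU]
  generalize x * y * z = q at *
  generalize SS x y z = S at *
  field_simp
  ring

theorem zm (n : ℕ) {a c : ℤ} (h : a % n = c) : (a : ZMod n) = c := by
  rw [← h]; simp
theorem zr (n : ℕ) {a c : ℤ} (h : (a : ZMod n) = c) : a % n = c % n := (ZMod.intCast_eq_intCast_iff' a c n).mp h

theorem caseA3 {x y z : ℤ} (h : 3 * x ^ 3 * y + 2 * y ^ 3 * z + z ^ 3 * x = 0) (hx : x % 1024 = 1) (hz : z % 4 = 1) : False := by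
  have hL : 3 * (x : L) ^ 3 * y + 2 * (y : L) ^ 3 * z + (z : L) ^ 3 * x = 0 := by exact_mod_cast h
  have hy : y % 4 = 3 := by
    have h1 := congrArg (Int.cast : ℤ → ZMod 4) h
    have hx4 := zm 4 (a := x) (c := 1) (by omega)
    have hz4 := zm 4 (a := z) (c := 1) (by omega)
    push_cast at h1 hx4 hz4
    rw [hx4, hz4] at h1
    have : ∀ t : ZMod 4, 3 * 1 ^ 3 * t + 2 * t ^ 3 * 1 + 1 ^ 3 * 1 = 0 → t = 3 := by decide
    have := zr 4 (a := y) (c := 3) (by push_cast; exact this _ h1)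
    omega
  have ax : Ap 14 (x : L) (V7.i 1) := Ap_mod 2 x 1 (by omega)
  have ay : Ap 14 (y : L) (V7.i 3) := Ap_mod 2 y 3 (by omega)
  have az : Ap 14 (z : L) (V7.i 1) := Ap_mod 2 z 1 (by omega)
  have aS : Ap 14 (SS x y z) _ := (((Ap_n 9).mul ax).add (((Ap_n 3).mul Ap_p).mul az)).add ((Ap_p.pow 3).mul ay)
  have aT : Ap 14 (TT x y z) _ := ((((Ap_n 9).mul ax).mul az).add ((((Ap_n 3).mul (Ap_p.pow 2)).mul ax).mul ay)).add (((Ap_p.pow 3).mul ay).mul az)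
  have aq : Ap 14 ((x : L) * y * z) _ := (ax.mul ay).mul az
  have hS := aS.unit (by norm_num) (by decide +kernel)
  have hT := aT.unit (by norm_num) (by decide +kernel)
  have hq := aq.unit (by norm_num) (by decide +kernel)
  have hU := UU_E hS hT hq
  have hpt := pt hL hq.ne hS.ne hT.ne
  have hsel := hpt.sel _ (by norm_num) hU
  obtain ⟨U, w, a, h1, h2, h3⟩ := exG
  have hsel2 := h1.sel 12 (by norm_num) (by rw [h2]; simpa using (E_pp 12).mul (h3.unit (by norm_num) (by decide +kernel)))
  have aX := ((((Ap_n 3).neg).mul aq).mul aS).mul (h3.mono (show 14 ≤ 49 by norm_num))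
  refine sel_ap (hsel.mul hsel2) (s := (p ^ 6 * TT x y z / (243 * ((x : L) * y * z) * SS x y z)) * p ^ 6) ?_ ?_ aX ⟨1, 0, 1, 1, 1, 0, 0⟩
    (by decide) (by norm_num) (by decide +kernel)
  · exact mul_ne_zero (div_ne_zero (mul_ne_zero (E_npow 6).ne hT.ne) (mul_ne_zero (mul_ne_zero (by norm_num) hq.ne) hS.ne)) (E_npow 6).ne
  · rw [h2, UU_sq hq.ne hS.ne]
    have : p ^ (12 : ℤ) = p ^ 12 := by norm_cast
    rw [this]; ring

noncomputable def SB (x y z : L) : L := 3 * z + p ^ 2 * y + p ^ 6 * (x / 9)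
noncomputable def TB (x y z : L) : L := y * z + p ^ 4 * (x / 9) * z + p ^ 6 * (x / 27) * y
theorem SSB (x y z : L) : SS (2 * x) y z = p * SB x y z := by
  rw [SS, SB]; linear_combination (-x / 9) * hp
theorem TTB (x y z : L) : TT (2 * x) y z = p ^ 3 * TB x y z := by
  rw [TT, TB]; linear_combination (-x * z / 9 - p ^ 2 * x * y / 27) * hp

theorem UUB (x y z : L) (hx : x * y * z ≠ 0) (hS : SB x y z ≠ 0) : UU (2 * x) y z = p ^ 10 * (-(TB x y z) ^ 2 / (243 * (x * y * z) * SB x y z)) := by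
  have hp0 := p_ne
  rw [UU, SSB, TTB, show 2 * x * y * z = 2 * (x * y * z) by ring]
  generalize x * y * z = q at *
  generalize SB x y z = S at *
  generalize TB x y z = T at *
  rw [← mul_div_assoc, div_eq_div_iff (mul_ne_zero (mul_ne_zero (by norm_num) (mul_ne_zero (by norm_num) hx)) (mul_ne_zero hp0 hS))
    (mul_ne_zero (mul_ne_zero (by norm_num) hx) hS)]
  linear_combination (-243 * p ^ 11 * T ^ 2 * q * S) * hp

theorem caseB2 {x y z : ℤ} (h : 12 * x ^ 3 * y + y ^ 3 * z + x * z ^ 3 = 0) (hz : z % 1024 = 1) (hy : y % 4 = 1) : False := by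
  have hL : 3 * (2 * (x : L)) ^ 3 * y + 2 * (y : L) ^ 3 * z + (z : L) ^ 3 * (2 * x) = 0 := by
    have : 12 * (x : L) ^ 3 * y + (y : L) ^ 3 * z + x * (z : L) ^ 3 = 0 := by exact_mod_cast h
    linear_combination 2 * this
  have hx : x % 4 = 3 := by
    have h1 := congrArg (Int.cast : ℤ → ZMod 4) h
    have hx4 := zm 4 (a := y) (c := 1) (by omega)
    have hz4 := zm 4 (a := z) (c := 1) (by omega)
    push_cast at h1 hx4 hz4
    rw [hx4, hz4] at h1
    have : ∀ t : ZMod 4, 12 * t ^ 3 * 1 + 1 ^ 3 * 1 + t * 1 ^ 3 = 0 → t = 3 := by decide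
    have := zr 4 (a := x) (c := 3) (by push_cast; exact this _ h1)
    omega
  have ax : Ap 14 (x : L) (V7.i 3) := Ap_mod 2 x 3 (by omega)
  have ay : Ap 14 (y : L) (V7.i 1) := Ap_mod 2 y 1 (by omega)
  have az : Ap 14 (z : L) (V7.i 1) := Ap_mod 2 z 1 (by omega)
  have ax9 := ax.div (Ap_n 9) (by norm_num) (by decide) (V7.i 3) (by decide +kernel)
  have ax27 := ax.div (Ap_n 27) (by norm_num) (by decide) (V7.i 1) (by decide +kernel)
  have aS : Ap 14 (SB x y z) _ := (((Ap_n 3).mul az).add ((Ap_p.pow 2).mul ay)).add ((Ap_p.pow 6).mul ax9)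
  have aT : Ap 14 (TB x y z) _ := ((ay.mul az).add (((Ap_p.pow 4).mul ax9).mul az)).add (((Ap_p.pow 6).mul ax27).mul ay)
  have aq : Ap 14 ((x : L) * y * z) _ := (ax.mul ay).mul az
  have hS := aS.unit (by norm_num) (by decide +kernel)
  have hT := aT.unit (by norm_num) (by decide +kernel)
  have hq := aq.unit (by norm_num) (by decide +kernel)
  have hU : E 10 (UU (2 * x) y z) := by
    rw [UUB _ _ _ hq.ne hS.ne]
    have := (E_npow 10).mul ((hT.pow 2).neg.div (((E_odd' (n := 243) (by norm_num)).mul hq).mul hS))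
    simpa using this
  have hpt := pt hL (by rw [mul_assoc, mul_assoc, ← mul_assoc (x : L)]; exact mul_ne_zero (by norm_num) hq.ne)
    (by rw [SSB]; exact mul_ne_zero p_ne hS.ne) (by rw [TTB]; exact mul_ne_zero (E_npow 3).ne hT.ne)
  have hsel := hpt.sel _ (by norm_num) hU
  have aX := (((Ap_n 3).neg).mul aq).mul aS
  refine sel_ap hsel (s := p ^ 5 * TB x y z / (27 * ((x : L) * y * z) * SB x y z)) ?_ ?_ aX ⟨1, 1, 0, 1, 1, 0, 0⟩
    (by decide) (by norm_num) (by decide +kernel)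
  · exact (div_ne_zero (mul_ne_zero (E_npow 5).ne hT.ne) (mul_ne_zero (mul_ne_zero (by norm_num) hq.ne) hS.ne))
  · rw [UUB _ _ _ hq.ne hS.ne]
    have h1 := hq.ne
    have h2 := hS.ne
    generalize (x : L) * y * z = q at *
    generalize SB x y z = S at *
    field_simp
    ring

noncomputable def SC (x y z : L) : L := y + p ^ 4 * (x / 9) + p ^ 12 * (z / 2187)
theorem SSC (x y z : L) : SS (2 * x) y (4 * z) = p ^ 3 * SC x y z := by
  rw [SS, SC]; linear_combination (-x / 9) * hp - (p * z / 2187) * hp14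

theorem caseC1 {x y z : ℤ} (h : 3 * x ^ 3 * y + y ^ 3 * z + 16 * z ^ 3 * x = 0) (hy : y % 1024 = 1) (hx : x % 2 = 1) : False := by
  have hL : 3 * (2 * (x : L)) ^ 3 * y + 2 * (y : L) ^ 3 * (4 * z) + (4 * z : L) ^ 3 * (2 * x) = 0 := by
    have : 3 * (x : L) ^ 3 * y + (y : L) ^ 3 * z + 16 * (z : L) ^ 3 * x = 0 := by exact_mod_cast h
    linear_combination 8 * this
  obtain ⟨c, hc, hxc, hzc⟩ : ∃ c, (c = 1 ∨ c = 3) ∧ x % 4 = c ∧ z % 4 = c := by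
    have h1 := congrArg (Int.cast : ℤ → ZMod 4) h
    have hy4 := zm 4 (a := y) (c := 1) (by omega)
    have hx4 : x % 4 = 1 ∨ x % 4 = 3 := by omega
    rcases hx4 with hx4 | hx4
    · refine ⟨1, by norm_num, hx4, ?_⟩
      have hx4 := zm 4 (a := x) (c := 1) (by omega)
      push_cast at h1 hx4 hy4
      rw [hx4, hy4] at h1
      have : ∀ t : ZMod 4, 3 * 1 ^ 3 * 1 + 1 ^ 3 * t + 16 * t ^ 3 * 1 = 0 → t = 1 := by decide
      have := zr 4 (a := z) (c := 1) (by push_cast; exact this _ h1)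
      omega
    · refine ⟨3, by norm_num, hx4, ?_⟩
      have hx4 := zm 4 (a := x) (c := 3) (by omega)
      push_cast at h1 hx4 hy4
      rw [hx4, hy4] at h1
      have : ∀ t : ZMod 4, 3 * 3 ^ 3 * 1 + 1 ^ 3 * t + 16 * t ^ 3 * 3 = 0 → t = 3 := by decide
      have := zr 4 (a := z) (c := 3) (by push_cast; exact this _ h1)
      omega
  have ax : Ap 14 (x : L) (V7.i c) := Ap_mod 2 x c (by omega)
  have ay : Ap 14 (y : L) (V7.i 1) := Ap_mod 2 y 1 (by omega)
  have az : Ap 14 (z : L) (V7.i c) := Ap_mod 2 z c (by omega)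
  have ax9 := ax.div (Ap_n 9) (by norm_num) (by decide) (V7.i c) (by rcases hc with rfl | rfl <;> decide +kernel)
  have az2 := az.div (Ap_n 2187) (by norm_num) (by decide) (V7.i (3 * c)) (by rcases hc with rfl | rfl <;> decide +kernel)
  have aS : Ap 14 (SC x y z) _ := (ay.add ((Ap_p.pow 4).mul ax9)).add ((Ap_p.pow 12).mul az2)
  have aq : Ap 14 ((x : L) * y * z) _ := (ax.mul ay).mul az
  have hS := aS.unit (by norm_num) (by rcases hc with rfl | rfl <;> decide +kernel)
  have hq := aq.unit (by norm_num) (by rcases hc with rfl | rfl <;> decide +kernel)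
  have Ex := E_odd x hx
  have Ey := E_odd y (by omega)
  have Ez := E_odd z (by omega)
  have E2x := E_two.mul Ex
  have E4 : E 14 (4 : L) := by
    have := E_two.mul E_two
    norm_num at this; exact this
  have E4z := E4.mul Ez
  have hT : E 9 (TT (2 * x) y (4 * z)) := by
    have := (((((E_odd' (n := 3) (by norm_num)).mul (E_npow 2)).mul E2x).mul Ey)).addD ((((E_odd' (n := 9) (by norm_num)).mul E2x).mul E4z).d.mono (show 10 ≤ _ by norm_num) |>.add
      ((((E_npow 3).mul Ey).mul E4z).d.mono (by norm_num))) (by norm_num)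
    rw [TT]; convert this using 1
    all_goals ring
  have hS3 : E 3 (SS (2 * x) y (4 * z)) := by rw [SSC]; simpa using (E_npow 3).mul hS
  have hq2 : E 21 (2 * (x : L) * y * (4 * z)) := by
    have := (E2x.mul Ey).mul E4z
    simpa using this
  have hU := UU_E hS3 hT hq2
  have hpt := pt hL hq2.ne hS3.ne hT.ne
  have hsel := hpt.sel _ (by norm_num) hU
  have aX := (((Ap_n 3).neg).mul aq).mul aS
  refine sel_ap hsel (s := p ^ 6 * TT (2 * x) y (4 * z) / (243 * (2 * (x : L) * y * (4 * z)) * SS (2 * x) y (4 * z)) * (2 * p ^ 5 / 9)) ?_ ?_ aX ⟨1, 0, 1, 0, 0, 0, 0⟩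
    (by decide) (by norm_num) (by rcases hc with rfl | rfl <;> decide +kernel)
  · exact mul_ne_zero (div_ne_zero (mul_ne_zero (E_npow 6).ne hT.ne) (mul_ne_zero (mul_ne_zero (by norm_num) hq2.ne) hS3.ne)) 
      (div_ne_zero (mul_ne_zero (by norm_num) (E_npow 5).ne) (by norm_num))
  · rw [UU_sq hq2.ne hS3.ne]
    generalize p ^ 6 * TT (2 * x) y (4 * z) / (243 * (2 * (x : L) * y * (4 * z)) * SS (2 * x) y (4 * z)) = G
    rw [SSC]
    linear_combination (G ^ 2 * (4 / 27) * p ^ 3 * x * y * z * SC x y z) * hp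

end C3
end

section
open Polynomial NumberField
namespace C3

theorem E_ap {r : ℕ} {x : L} {v : V7} (h : Ap r x v) (k : ℕ) (hk : k < r) (ck : (v.psub (V7.P.ppow k)).dck (k + 1) = true) : E k x := by
  have := (E_npow k).addD ((h.sub (Ap_p.pow k)).toD (k + 1) hk ck) (by push_cast; omega)
  simpa using this

theorem exH : ∃ U w a, Pt U w ∧ U = p ^ 10 * a ∧ Ap 49 a vH ∧ Ap 42 w ⟨-87, -92, -84, -64, 30, -57, -4⟩ := by
  obtain ⟨U, w, a, h1, h2, h3⟩ := ex2G
  have e : p ^ (10 : ℤ) = p ^ 10 := by norm_cast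
  rw [e] at h2
  obtain ⟨w', k1, k2⟩ := ptw (k := 10) h1 h2 h3 (by norm_num) ⟨-87, -92, -84, -64, 30, -57, -4⟩ (v' := ⟨80, -80, 16, -120, 76, -72, -20⟩)
    (by decide +kernel) (by decide +kernel) (by decide +kernel) (by decide +kernel)
  exact ⟨U, w', a, k1, h2, h3, k2⟩

theorem ptB {x y z : ℤ} (h : 12 * x ^ 3 * y + y ^ 3 * z + x * z ^ 3 = 0) (hx : x % 2 = 1) (hy : y % 2 = 1) (hz : z % 2 = 1) :
    ∃ w, Pt (p ^ 10 * (-(TB x y z) ^ 2 / (243 * ((x : L) * y * z) * SB x y z))) w := by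
  have hL : 3 * (2 * (x : L)) ^ 3 * y + 2 * (y : L) ^ 3 * z + (z : L) ^ 3 * (2 * x) = 0 := by
    have : 12 * (x : L) ^ 3 * y + (y : L) ^ 3 * z + x * (z : L) ^ 3 = 0 := by exact_mod_cast h
    linear_combination 2 * this
  have ax : Ap 7 (x : L) (V7.i 1) := Ap_mod 1 x 1 (by omega)
  have ay : Ap 7 (y : L) (V7.i 1) := Ap_mod 1 y 1 (by omega)
  have az : Ap 7 (z : L) (V7.i 1) := Ap_mod 1 z 1 (by omega)
  have ax9 := ax.div (Ap_n 9) (by norm_num) (by decide) (V7.i 1) (by decide +kernel)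
  have ax27 := ax.div (Ap_n 27) (by norm_num) (by decide) (V7.i 1) (by decide +kernel)
  have aS : Ap 7 (SB x y z) _ := (((Ap_n 3).mul az).add ((Ap_p.pow 2).mul ay)).add ((Ap_p.pow 6).mul ax9)
  have aT : Ap 7 (TB x y z) _ := ((ay.mul az).add (((Ap_p.pow 4).mul ax9).mul az)).add (((Ap_p.pow 6).mul ax27).mul ay)
  have aq : Ap 7 ((x : L) * y * z) _ := (ax.mul ay).mul az
  have hS := aS.unit (by norm_num) (by decide +kernel)
  have hT := aT.unit (by norm_num) (by decide +kernel)
  have hq := aq.unit (by norm_num) (by decide +kernel)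
  have hpt := pt hL (by rw [mul_assoc, mul_assoc, ← mul_assoc (x : L)]; exact mul_ne_zero (by norm_num) hq.ne)
    (by rw [SSB]; exact mul_ne_zero p_ne hS.ne) (by rw [TTB]; exact mul_ne_zero (E_npow 3).ne hT.ne)
  rw [UUB _ _ _ hq.ne hS.ne] at hpt
  exact ⟨_, hpt⟩

theorem apB {x y z : ℤ} (j : ℕ) (hj : 1 ≤ 7 * j) (cx cy x9 x27 : ℤ) (hx : x % 2 ^ j = cx) (hy : y % 2 ^ j = cy) (hz : z % 2 ^ j = 1) (va : V7)
    (c1 : (((V7.i x9).pmul (V7.i 9)).psub (V7.i cx)).dck (7 * j) = true)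
    (c2 : (((V7.i x27).pmul (V7.i 27)).psub (V7.i cx)).dck (7 * j) = true) 
    (c3 : (((V7.i 243).pmul (((V7.i cx).pmul (V7.i cy)).pmul (V7.i 1))).pmul ((((V7.i 3).pmul (V7.i 1)).padd ((V7.P.ppow 2).pmul (V7.i cy))).padd ((V7.P.ppow 6).pmul (V7.i x9)))).a % 2 = 1)
    (c4 : ((va.pmul (((V7.i 243).pmul (((V7.i cx).pmul (V7.i cy)).pmul (V7.i 1))).pmul ((((V7.i 3).pmul (V7.i 1)).padd ((V7.P.ppow 2).pmul (V7.i cy))).padd ((V7.P.ppow 6).pmul (V7.i x9))))).psub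
      ((V7.i 0).psub (((((V7.i cy).pmul (V7.i 1)).padd (((V7.P.ppow 4).pmul (V7.i x9)).pmul (V7.i 1))).padd (((V7.P.ppow 6).pmul (V7.i x27)).pmul (V7.i cy))).ppow 2))).dck (7 * j) = true) :
    Ap (7 * j) (-(TB x y z) ^ 2 / (243 * ((x : L) * y * z) * SB x y z)) va := by
  have ax := Ap_mod j x cx hx
  have ay := Ap_mod j y cy hy
  have az := Ap_mod j z 1 hz
  have ax9 := ax.div (Ap_n 9) hj (by decide) (V7.i x9) c1
  have ax27 := ax.div (Ap_n 27) hj (by decide) (V7.i x27) c2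
  exact ((((ay.mul az).add (((Ap_p.pow 4).mul ax9).mul az)).add (((Ap_p.pow 6).mul ax27).mul ay)).pow 2).neg.div
    (((Ap_n 243).mul ((ax.mul ay).mul az)).mul ((((Ap_n 3).mul az).add ((Ap_p.pow 2).mul ay)).add ((Ap_p.pow 6).mul ax9))) hj c3 va c4

theorem modB {x y z : ℤ} (h : 12 * x ^ 3 * y + y ^ 3 * z + x * z ^ 3 = 0) (hz : z % 1024 = 1) (n : ℕ) (hn : n ∣ 1024) (h1n : 1 < n) (cx cy : ℤ) (hy : y % n = cy) (hcx : cx % n = cx)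
    (hd : ∀ t : ZMod n, 12 * t ^ 3 * cy + cy ^ 3 * 1 + t * 1 ^ 3 = 0 → t = cx) : x % n = cx ∧ z % n = 1 := by
  have h1 := congrArg (Int.cast : ℤ → ZMod n) h
  have hyn := zm n hy
  have hz1 : z % n = 1 := by
    have : (n : ℤ) ∣ 1024 := by exact_mod_cast hn
    rw [← Int.emod_emod_of_dvd z this, hz]
    exact Int.emod_eq_of_lt (by norm_num) (by exact_mod_cast h1n)
  have hzn := zm n hz1
  push_cast at h1 hzn
  rw [hyn, hzn] at h1
  have := zr n (hd _ h1)
  exact ⟨by rw [this, hcx], hz1⟩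

theorem caseB3a {x y z : ℤ} (h : 12 * x ^ 3 * y + y ^ 3 * z + x * z ^ 3 = 0) (hz : z % 1024 = 1) (hy : y % 8 = 3) : False := by
  obtain ⟨hx, hz8⟩ := modB h hz 8 (by norm_num) (by norm_num) 1 3 (by exact_mod_cast hy) (by norm_num) (by decide)
  have A := apB (x := x) (y := y) (z := z) 3 (by norm_num) 1 3 1 3 hx hy hz8 ⟨-3, 0, -1, 2, -1, 0, 0⟩ (by decide +kernel) (by decide +kernel) (by decide +kernel) (by decide +kernel)
  obtain ⟨w1, h1⟩ := ptB h (by omega) (by omega) (by omega)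
  generalize -(TB x y z) ^ 2 / (243 * ((x : L) * y * z) * SB x y z) = a1 at *
  obtain ⟨U, w, a, k1, k2, k3, k4⟩ := exH
  have k3' := k3.mono (show 7 * 3 ≤ 49 by norm_num)
  have R := (A.sub k3').div k3' (by norm_num) (by decide +kernel) ⟨0, 0, -4, 0, -4, 0, 0⟩ (by decide +kernel)
  have ha := k3.unit (by norm_num) (by decide +kernel)
  have hw := k4.unit (by norm_num) (by decide +kernel)
  have hρ := E_ap R 16 (by norm_num) (by decide +kernel)
  have ha0 := ha.ne
  obtain ⟨z0, t0, hz0, hd⟩ := diff (ρ := (a1 - a) / a) (k := 10) (n := 9) h1 k1 (by rw [k2]; simpa using (E_npow 10).mul ha) hw (by rw [k2]; field_simp; ring)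
    (by simpa using hρ) (by norm_num) (by norm_num) (by norm_num)
  have e2 := hρ.div (hw.mul (E_two.addD hρ.d (by norm_num)))
  have e3 := e2.addD hd (by norm_num)
  refine hz0.near (n := 9) (by norm_num) ?_ (by norm_num)
  convert e3 using 1
  all_goals norm_num

theorem finB {a1 w1 : L} (h1 : Pt (p ^ 10 * a1) w1) (r : ℕ) {va : V7} (A : Ap (r + 22) a1 va) (hr : 1 ≤ r) (hr2 : r + 22 ≤ 49) (hr3 : r ≤ 21) (vρ rp vu : V7) (m : ℕ) (q : ℕ)
    (c1 : ((vρ.pmul vH).psub (va.psub vH)).dck (r + 22) = true)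
    (c2 : (((V7.P.ppow 22).pmul rp).psub vρ).dck (r + 22) = true) (c2' : rp.a % 2 = 1)
    (c3 : ((⟨-87, -92, -84, -64, 30, -57, -4⟩ : V7).pmul ((V7.i 1).padd (((V7.i 81).pmul (V7.P.ppow 15)).pmul rp))).a % 2 = 1)
    (c4 : ((vu.pmul ((⟨-87, -92, -84, -64, 30, -57, -4⟩ : V7).pmul ((V7.i 1).padd (((V7.i 81).pmul (V7.P.ppow 15)).pmul rp)))).psub ((V7.i 81).pmul rp)).dck r = true)
    (hq : q < r) (hq17 : q ≤ 17)
    (c5 : ((vu.psub ((V7.i m).pmul ⟨1, 1, 0, 1, 0, 0, 0⟩)).psub (V7.P.ppow q)).dck (q + 1) = true)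
    (hm : (15 + q) % 7 = 2 ∨ (15 + q) % 7 = 4 ∨ (15 + q) % 7 = 6) : False := by
  obtain ⟨U, w, a, k1, k2, k3, k4⟩ := exH
  have k3' := k3.mono hr2
  have ha := k3.unit (by norm_num) (by decide +kernel)
  have hw := k4.unit (by norm_num) (by decide +kernel)
  have ha0 := ha.ne
  have hp0 := p_ne
  have R := (A.sub k3').div k3' (by omega) (by decide +kernel) vρ c1
  obtain ⟨ρ', hρ'⟩ : ∃ ρ', (a1 - a) / a = p ^ 22 * ρ' := ⟨(a1 - a) / a / p ^ 22, by field_simp⟩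
  rw [hρ'] at R
  have R' := R.dvp 22 rp c2
  have hR := R'.unit hr c2'
  have hρ := (E_npow 22).mul hR
  obtain ⟨z0, t0, hz0, hd⟩ := diff (ρ := p ^ 22 * ρ') (k := 10) (n := 15) h1 k1 (by rw [k2]; simpa using (E_npow 10).mul ha) hw (by rw [k2, ← hρ']; field_simp; ring)
    (by simpa using hρ) (by norm_num) (by norm_num) (by norm_num)
  have B := (k4.mono (show r ≤ 42 by omega)).mul (Ap_1.add (((Ap_n 81).mul (Ap_p.pow 15)).mul R'))
  have C := ((Ap_n 81).mul R').div B hr c3 vu c4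
  have hB := (B.unit hr c3).ne
  obtain ⟨l, tl, μ, hl, hlμ, hμ⟩ := lam
  have F := E_ap (C.sub ((Ap_i m).mul (hμ.mono hr3))) q hq c5
  have e1 := ((E_npow 15).mul F).addD hd (by push_cast; omega)
  refine final hl 0 m (by simpa using hz0) (e := z0 - m * l) (by ring) (n := 15 + q) ?_ (by omega) (by omega)
  convert e1 using 1
  · norm_num
  change z0 - m * l = p ^ 15 * (81 * ρ' / (w * (1 + 81 * p ^ 15 * ρ')) - ((m : ℤ) : L) * μ) + (z0 - p ^ 22 * ρ' / (w * (2 + p ^ 22 * ρ')))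
  change w * (1 + 81 * p ^ 15 * ρ') ≠ 0 at hB
  clear C F e1 B
  have e2 : (2 + p ^ 22 * ρ') = p ^ 7 / 81 * (1 + 81 * p ^ 15 * ρ') := by
    linear_combination two_p
  rw [e2, hlμ]
  generalize (1 + 81 * p ^ 15 * ρ') = b at *
  have hb : b ≠ 0 := fun hb => hB (by rw [hb, mul_zero])
  have hw0 := hw.ne
  push_cast
  field_simp
  ring

theorem caseB3 {x y z : ℤ} (h : 12 * x ^ 3 * y + y ^ 3 * z + x * z ^ 3 = 0) (hz : z % 1024 = 1) (hy : y % 4 = 3) : False := by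
  have hc : y % 8 = 3 ∨ y % 16 = 7 ∨ y % 32 = 15 ∨ y % 64 = 31 ∨ y % 64 = 63 := by omega
  rcases hc with hy | hy | hy | hy | hy
  · exact caseB3a h hz hy
  · obtain ⟨hx, hz8⟩ := modB h hz 16 (by norm_num) (by norm_num) 5 7 (by exact_mod_cast hy) (by norm_num) (by decide +kernel)
    have A := apB (x := x) (y := y) (z := z) 4 (by norm_num) 5 7 13 15 hx hy hz8 ⟨-3, 0, -5, 2, -1, 0, 0⟩ (by decide +kernel) (by decide +kernel) (by decide +kernel) (by decide +kernel)
    obtain ⟨w1, h1⟩ := ptB h (by omega) (by omega) (by omega)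
    exact finB h1 6 A (by norm_num) (by norm_num) (by norm_num) ⟨0, -8, 0, 0, 0, 0, -8⟩ ⟨7, -4, 4, -8, -2, -7, 4⟩ ⟨-1, -4, -8, -8, -4, -8, 4⟩ 1 1
      (by decide +kernel) (by decide +kernel) (by decide +kernel) (by decide +kernel) (by decide +kernel) (by norm_num) (by norm_num) (by decide +kernel) (by norm_num)
  · obtain ⟨hx, hz8⟩ := modB h hz 32 (by norm_num) (by norm_num) 13 15 (by exact_mod_cast hy) (by norm_num) (by decide +kernel)
    have A := apB (x := x) (y := y) (z := z) 5 (by norm_num) 13 15 5 23 hx hy hz8 ⟨-3, 0, -13, -14, -1, 0, 0⟩ (by decide +kernel) (by decide +kernel) (by decide +kernel) (by decide +kernel)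
    obtain ⟨w1, h1⟩ := ptB h (by omega) (by omega) (by omega)
    exact finB h1 13 A (by norm_num) (by norm_num) (by norm_num) ⟨-16, 8, 8, 0, -8, -16, 8⟩ ⟨5, 13, -8, 7, 14, -3, 9⟩ ⟨9, -5, -8, 7, -12, 8, 0⟩ 1 8
      (by decide +kernel) (by decide +kernel) (by decide +kernel) (by decide +kernel) (by decide +kernel) (by norm_num) (by norm_num) (by decide +kernel) (by norm_num)
  · obtain ⟨hx, hz8⟩ := modB h hz 64 (by norm_num) (by norm_num) 29 31 (by exact_mod_cast hy) (by norm_num) (by decide +kernel)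
    have A := apB (x := x) (y := y) (z := z) 6 (by norm_num) 29 31 53 39 hx hy hz8 ⟨29, 0, 3, 18, 31, 0, 0⟩ (by decide +kernel) (by decide +kernel) (by decide +kernel) (by decide +kernel)
    obtain ⟨w1, h1⟩ := ptB h (by omega) (by omega) (by omega)
    exact finB h1 20 A (by norm_num) (by norm_num) (by norm_num) ⟨-16, 8, -8, 0, -24, -16, -24⟩ ⟨1, -17, 0, -11, 14, 21, 27⟩ ⟨13, 9, 24, -3, 20, -8, -32⟩ 5 15
      (by decide +kernel) (by decide +kernel) (by decide +kernel) (by decide +kernel) (by decide +kernel) (by norm_num) (by norm_num) (by decide +kernel) (by norm_num)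
  · obtain ⟨hx, hz8⟩ := modB h hz 64 (by norm_num) (by norm_num) 61 63 (by exact_mod_cast hy) (by norm_num) (by decide +kernel)
    have A := apB (x := x) (y := y) (z := z) 6 (by norm_num) 61 63 21 7 hx hy hz8 ⟨29, 0, -29, 18, 31, 0, 0⟩ (by decide +kernel) (by decide +kernel) (by decide +kernel) (by decide +kernel)
    obtain ⟨w1, h1⟩ := ptB h (by omega) (by omega) (by omega)
    exact finB h1 20 A (by norm_num) (by norm_num) (by norm_num) ⟨-16, 8, 24, 0, 8, -16, -24⟩ ⟨-7, -13, 16, 17, 14, 5, 31⟩ ⟨21, -27, 24, 9, 20, 24, 0⟩ 5 17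
      (by decide +kernel) (by decide +kernel) (by decide +kernel) (by decide +kernel) (by decide +kernel) (by norm_num) (by norm_num) (by decide +kernel) (by norm_num)

end C3
end

section
open Polynomial NumberField
namespace C3

def vT : V7 := ⟨-9, 0, 3, -1, 0, 0, 0⟩
def vS : V7 := ⟨9, -3, 0, 1, 0, 0, 0⟩
def vwG : V7 := ⟨101, 116, 74, 56, -102, 20, 121⟩
theorem vT_pe : vT.pe = TT 1 1 (-1) := by
  rw [vT, V7.pe, TT]; push_cast; ring
theorem vS_pe : vS.pe = SS 1 1 (-1) := by
  rw [vS, V7.pe, SS]; push_cast; ring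

theorem exGG : ∃ w, Pt (UU 1 1 (-1)) w ∧ Ap 42 w vwG := by
  have hT : E 0 (TT 1 1 (-1)) := by rw [← vT_pe]; exact vT.unit (by decide)
  have hS : E 0 (SS 1 1 (-1)) := by rw [← vS_pe]; exact vS.unit (by decide)
  have h := pt (x := 1) (y := 1) (z := -1) (by norm_num) (by norm_num) hS.ne hT.ne
  refine ptw (k := 12) h ?_ apG (by norm_num) vwG (v' := ⟨-8, 56, -12, -20, 120, -108, -68⟩)
    (by decide +kernel) (by decide +kernel) (by decide +kernel) (by decide +kernel)
  have e1 : (-9 + 3 * p ^ 2 - p ^ 3 : L) = TT 1 1 (-1) := by rw [TT]; ring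
  have e2 : (9 - 3 * p + p ^ 3 : L) = SS 1 1 (-1) := by rw [SS]; ring
  rw [e1, e2, UU]
  have := hS.ne
  field_simp

noncomputable def T1 (x s t K : L) : L := 9 * x * s + 3 * p ^ 2 * x * t + p ^ 3 * (x * s - x * t + K * s * t)
noncomputable def S1 (s t : L) : L := 3 * p * s + p ^ 3 * t
noncomputable def q1 (x s t K : L) : L := x * (x * s - x * t + K * s * t)
noncomputable def RR (x s t K : L) : L :=
  x ^ 3 * S1 s t * vT.pe ^ 2 - 2 * x ^ 2 * vT.pe * T1 x s t K * vS.pe - K * T1 x s t K ^ 2 * vS.pe - q1 x s t K * x * vS.pe * vT.pe ^ 2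
   - K * q1 x s t K * S1 s t * vT.pe ^ 2

theorem UU_rho {x s t K : L} (hq : x * (x + K * t) * (-x + K * s) ≠ 0) (hS : SS x (x + K * t) (-x + K * s) ≠ 0) :
    UU x (x + K * t) (-x + K * s) = UU 1 1 (-1) * (1 + K * RR x s t K / (x * (x + K * t) * (-x + K * s) * SS x (x + K * t) (-x + K * s) * vT.pe ^ 2)) := by
  have hT0 : vT.pe ≠ 0 := (vT.unit (by decide)).ne
  have hS0 : vS.pe ≠ 0 := (vS.unit (by decide)).ne
  have e : (x * (x + K * t) * (-x + K * s) * SS x (x + K * t) (-x + K * s) * vT.pe ^ 2) + K * RR x s t K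
      = - (TT x (x + K * t) (-x + K * s)) ^ 2 * vS.pe := by
    have a1 : TT x (x + K * t) (-x + K * s) = x ^ 2 * vT.pe + K * T1 x s t K := by rw [vT_pe, TT, TT, T1]; ring
    have a2 : SS x (x + K * t) (-x + K * s) = x * vS.pe + K * S1 s t := by rw [vS_pe, SS, SS, S1]; ring
    have a3 : x * (x + K * t) * (-x + K * s) = -x ^ 3 + K * q1 x s t K := by rw [q1]; ring
    rw [a1, a2, a3, RR]; ring
  rw [UU, UU, ← vT_pe, ← vS_pe]
  generalize TT x (x + K * t) (-x + K * s) = T at *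
  generalize SS x (x + K * t) (-x + K * s) = S at *
  generalize x * (x + K * t) * (-x + K * s) = q at *
  generalize RR x s t K = R at *
  have e' : K * R = -T ^ 2 * vS.pe - q * S * vT.pe ^ 2 := by linear_combination e
  rw [e']
  field_simp
  ring

theorem finA {x σ τ K : ℤ} {H : L} (h : 3 * x ^ 3 * (x + K * τ) + 2 * (x + K * τ) ^ 3 * (-x + K * σ) + (-x + K * σ) ^ 3 * x = 0)
    (r : ℕ) (s c : ℤ) (v : V7) (hs : s = 1 ∨ s = 3 ∨ s = 5 ∨ s = 7)
    (hr : (r = 13 ∧ c = 2 ∧ v = ⟨1, -1, 0, -1, 0, 0, 0⟩) ∨ (r = 20 ∧ c = 4 ∧ v = ⟨-3, -3, 0, 1, 0, 0, -4⟩) ∨ (r = 20 ∧ c = 0 ∧ v = ⟨-3, 1, 0, -3, 0, 0, -4⟩))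
    (ax : Ap (r + 1) (x : L) (V7.i 1)) (aσ : Ap (r + 1) (σ : L) (V7.i s)) (aτ : Ap (r + 1) (τ : L) (V7.i (-s)))
    (aK : Ap (r + 1) (K : L) (V7.i 0)) (aH : Ap (r + 1) H (V7.i c)) (hKH : (K : L) = 2 * H) (k : ℕ) (hk : 2 ≤ k) (EK : E (7 * k) (K : L)) :
    ∃ z t u, Zt (7 * k - 6) z t ∧ D (14 * k - 7) (z - H * p * 6561 * u) ∧ Ap r u ((V7.i s).pmul v) := by
  have hL : 3 * (x : L) ^ 3 * (x + K * τ) + 2 * ((x : L) + K * τ) ^ 3 * (-x + K * σ) + (-(x : L) + K * σ) ^ 3 * x = 0 := by exact_mod_cast h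
  have hr1 : 1 ≤ r ∧ r ≤ 42 := by omega
  obtain ⟨w, hw1, hw2⟩ := exGG
  have ay := ax.add (aK.mul aτ)
  have az := ax.neg.add (aK.mul aσ)
  have aq := (ax.mul ay).mul az
  have aS : Ap (r + 1) (SS x (x + K * τ) (-x + K * σ)) _ := (((Ap_n 9).mul ax).add (((Ap_n 3).mul Ap_p).mul az)).add ((Ap_p.pow 3).mul ay)
  have aT : Ap (r + 1) (TT x (x + K * τ) (-x + K * σ)) _ := ((((Ap_n 9).mul ax).mul az).add ((((Ap_n 3).mul (Ap_p.pow 2)).mul ax).mul ay)).add (((Ap_p.pow 3).mul ay).mul az)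
  have hq := aq.unit (by omega) (by rcases hs with rfl | rfl | rfl | rfl <;> decide +kernel)
  have hS := aS.unit (by omega) (by rcases hs with rfl | rfl | rfl | rfl <;> decide +kernel)
  have hT := aT.unit (by omega) (by rcases hs with rfl | rfl | rfl | rfl <;> decide +kernel)
  have hpt := pt hL hq.ne hS.ne hT.ne
  have aD := (aq.mul aS).mul ((Ap_pe vT).pow 2)
  have cD := aD.unit (by omega) (by rcases hs with rfl | rfl | rfl | rfl <;> decide +kernel)
  have a0 := ((ax.mul aσ).sub (ax.mul aτ)).add ((aK.mul aσ).mul aτ)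
  have aT1 : Ap (r + 1) (T1 x σ τ K) _ := ((((Ap_n 9).mul ax).mul aσ).add ((((Ap_n 3).mul (Ap_p.pow 2)).mul ax).mul aτ)).add ((Ap_p.pow 3).mul a0)
  have aS1 : Ap (r + 1) (S1 σ τ) _ := (((Ap_n 3).mul Ap_p).mul aσ).add ((Ap_p.pow 3).mul aτ)
  have aq1 : Ap (r + 1) (q1 x σ τ K) _ := ax.mul a0
  have aR : Ap (r + 1) (RR x σ τ K) _ := ((((((ax.pow 3).mul aS1).mul ((Ap_pe vT).pow 2)).sub
     (((((Ap_n 2).mul (ax.pow 2)).mul (Ap_pe vT)).mul aT1).mul (Ap_pe vS))).sub ((aK.mul (aT1.pow 2)).mul (Ap_pe vS))).sub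
     (((aq1.mul ax).mul (Ap_pe vS)).mul ((Ap_pe vT).pow 2))).sub (((aK.mul aq1).mul aS1).mul ((Ap_pe vT).pow 2))
  have hp0 := p_ne
  have hρ := UU_rho hq.ne hS.ne
  generalize (x : L) * (x + K * τ) * (-x + K * σ) * SS x (x + K * τ) (-x + K * σ) * vT.pe ^ 2 = Dn at *
  generalize RR x σ τ K = R at *
  obtain ⟨R', rfl⟩ : ∃ R', R = p ^ 1 * R' := ⟨R / p, by field_simp⟩
  have aR' := aR.dvp 1 ((V7.i s).pmul ⟨3, 2, -1, 0, 3, 2, -4⟩) (by rcases hr with ⟨rfl, rfl, rfl⟩ | ⟨rfl, rfl, rfl⟩ | ⟨rfl, rfl, rfl⟩ <;> rcases hs with rfl | rfl | rfl | rfl <;> decide +kernel)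
  have hR' := aR'.unit hr1.1 (by rcases hs with rfl | rfl | rfl | rfl <;> decide +kernel)
  have aRD := aR.div aD (by omega) (by rcases hs with rfl | rfl | rfl | rfl <;> decide +kernel) ((V7.i s).pmul ⟨2, -1, 1, 0, 3, -2, 0⟩)
    (by rcases hr with ⟨rfl, rfl, rfl⟩ | ⟨rfl, rfl, rfl⟩ | ⟨rfl, rfl, rfl⟩ <;> rcases hs with rfl | rfl | rfl | rfl <;> decide +kernel)
  have ab := Ap_1.add (aH.mul aRD)
  have hb := ab.unit (by omega) (by rcases hr with ⟨rfl, rfl, rfl⟩ | ⟨rfl, rfl, rfl⟩ | ⟨rfl, rfl, rfl⟩ <;> rcases hs with rfl | rfl | rfl | rfl <;> decide +kernel)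
  have hw := hw2.unit (by norm_num) (by decide +kernel)
  have au := aR'.div ((Ap_n 6561).mul (((hw2.mono hr1.2).mul (ab.mono (show r ≤ r + 1 by omega))).mul (aD.mono (show r ≤ r + 1 by omega)))) hr1.1
    (by rcases hr with ⟨rfl, rfl, rfl⟩ | ⟨rfl, rfl, rfl⟩ | ⟨rfl, rfl, rfl⟩ <;> rcases hs with rfl | rfl | rfl | rfl <;> decide +kernel)
    ((V7.i s).pmul v) 
    (by rcases hr with ⟨rfl, rfl, rfl⟩ | ⟨rfl, rfl, rfl⟩ | ⟨rfl, rfl, rfl⟩ <;> rcases hs with rfl | rfl | rfl | rfl <;> decide +kernel)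
  have hU2 : E 12 (UU 1 1 (-1)) := by
    have := UU_E (x := 1) (y := 1) (z := -1) (s := 0) (t := 0) (q := 0) (by rw [← vS_pe]; exact vS.unit (by decide)) (by rw [← vT_pe]; exact vT.unit (by decide))
      (by have := N_one.e.neg; simpa using this)
    simpa using this
  have Eρ := (EK.mul ((E_npow 1).mul hR')).div cD
  obtain ⟨z0, t0, hz0, hd⟩ := diff (k := 12) (n := 7 * k - 6) hpt hw1 hU2 hw hρ (by convert Eρ using 1; push_cast; ring) (by norm_num) (by norm_num) (by omega)
  refine ⟨z0, t0, _, hz0, ?_, au⟩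
  convert hd using 1
  · ring
  change z0 - H * p * 6561 * (R' / (6561 * (w * (1 + H * (p ^ 1 * R' / Dn)) * Dn))) = z0 - K * (p ^ 1 * R') / Dn / (w * (2 + K * (p ^ 1 * R') / Dn))
  have e1 := hb.ne
  have e2 := hw.ne
  have e3 := cD.ne
  have e4 : (2 + K * (p ^ 1 * R') / Dn) = 2 * (1 + H * (p ^ 1 * R' / Dn)) := by rw [hKH]; ring
  rw [e4, hKH]
  generalize (1 + H * (p ^ 1 * R' / Dn)) = b at *
  field_simp

end C3
end

section
open Polynomial NumberField
namespace C3

theorem Ap_tau (j : ℕ) {σ τ s : ℤ} (h1 : σ % 2 ^ j = s) (h2 : (τ + σ) % 2 ^ j = 0) : Ap (7 * j) (τ : L) (V7.i (-s)) := by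
  have := (Ap_mod j (τ + σ) 0 h2).sub (Ap_mod j σ s h1)
  convert this using 1
  · push_cast; ring
  · simp [V7.i, V7.psub]

theorem caseA4 {x y z : ℤ} (h : 3 * x ^ 3 * y + 2 * y ^ 3 * z + z ^ 3 * x = 0) (hx : x % 1024 = 1) (hz : z % 4 = 3) (hne : z + x ≠ 0) : False := by
  obtain ⟨k, σ, hσ, hσ2⟩ := ex_two (z + x) hne
  have hk : 2 ≤ k := by
    by_contra hc
    have hc2 : k = 0 ∨ k = 1 := by omega
    clear h
    rcases hc2 with rfl | rfl
    · rw [pow_zero] at hσ; omega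
    · rw [pow_one] at hσ; omega
  have EK : E (7 * k) (((2 : ℤ) ^ k : ℤ) : L) := E_2k (σ := 1) (by ring) (by norm_num)
  obtain ⟨τ, hτ⟩ : (2 : ℤ) ^ k ∣ y - x := by
    have hcop : IsCoprime ((2 : ℤ) ^ k) (-3 * x ^ 3 + 2 * (3 * x ^ 2 * (z + x) - 3 * x ^ 2 * (y - x) + 3 * x * (y - x) * (z + x) - x * (y - x) ^ 2 + (y - x) ^ 2 * (z + x))) := by
      apply IsCoprime.pow_left
      have hc : x ^ 3 % 2 = 1 := odd_cube (z := x) (by omega)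
      generalize (3 * x ^ 2 * (z + x) - 3 * x ^ 2 * (y - x) + 3 * x * (y - x) * (z + x) - x * (y - x) ^ 2 + (y - x) ^ 2 * (z + x)) = W
      generalize x ^ 3 = c at hc
      clear h hσ EK
      exact ⟨2 + 3 * (c / 2) - W, 1, by omega⟩
    refine hcop.dvd_of_dvd_mul_right ⟨-σ * (5 * x ^ 3 - 3 * x ^ 2 * (z + x) + x * (z + x) ^ 2), ?_⟩
    linear_combination h - (5 * x ^ 3 - 3 * x ^ 2 * (z + x) + x * (z + x) ^ 2) * hσ
  obtain rfl : y = x + 2 ^ k * τ := by linarith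
  obtain rfl : z = -x + 2 ^ k * σ := by linarith
  clear hτ hσ hne
  have rel : -3 * x ^ 3 * τ + 5 * x ^ 3 * σ + 2 ^ k * (6 * x ^ 2 * σ * τ - 6 * x ^ 2 * τ ^ 2 - 3 * x ^ 2 * σ ^ 2
    + 2 ^ k * (6 * x * τ ^ 2 * σ - 2 * x * τ ^ 3 + x * σ ^ 3) + 2 * (2 ^ k) ^ 2 * τ ^ 3 * σ) = 0 := by
    have h0 : (2 : ℤ) ^ k ≠ 0 := by positivity
    apply mul_left_cancel₀ h0
    linear_combination h
  obtain ⟨l, tl, μ, hl, hlμ, hμ⟩ := lam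
  rcases Nat.lt_or_ge k 3 with hk3 | hk3
  · obtain rfl : k = 2 := by omega
    have hτ : (τ + σ) % 4 = 0 := by
      have h1 := congrArg (Int.cast : ℤ → ZMod 4) rel
      have hx4 := zm 4 (a := x) (c := 1) (by omega)
      push_cast at h1 hx4
      rw [hx4] at h1
      have h40 : (4 : ZMod 4) = 0 := by decide
      have e : ∀ t s : ZMod 4, -3 * 1 ^ 3 * t + 5 * 1 ^ 3 * s = 0 → t + s = 0 := by decide
      norm_num at h1
      exact zr 4 (a := τ + σ) (c := 0) (by push_cast; exact e _ _ (by linear_combination h1 - (6 * σ * τ - 6 * (τ : ZMod 4) ^ 2 - 3 * σ ^ 2 + 4 * (6 * τ ^ 2 * σ - 2 * τ ^ 3 + σ ^ 3) + 32 * τ ^ 3 * σ) * h40))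
    obtain ⟨m, hm⟩ : ∃ m : ℕ, σ % 2 ^ 2 = m := ⟨(σ % 2 ^ 2).toNat, by omega⟩
    have hm2 : m = 1 ∨ m = 3 := by omega
    obtain ⟨z0, t0, u, h1, h2, h3⟩ := finA (H := 2) h 13 m 2 _ (by omega) (Or.inl ⟨rfl, rfl, rfl⟩) (Ap_mod 2 x 1 (by omega)) (Ap_mod 2 σ m hm)
      (Ap_tau 2 hm hτ) (Ap_mod 2 _ 0 (by norm_num)) (Ap_n 2) (by push_cast; norm_num) 2 le_rfl EK
    have F := E_ap (h3.sub ((Ap_i m).mul (hμ.mono (by norm_num)))) 8 (by norm_num) (by rcases hm2 with rfl | rfl <;> decide +kernel)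
    have e1 := ((E_npow 15).mul F).addD (E_two.d.mul h2) (by norm_num)
    refine final8 hl m (z := z0) (t := t0) (e := 2 * z0 - m * l) (n := 23) (by convert h1 using 1; norm_num) (by ring) ?_ (by norm_num) (by norm_num) (by norm_num)
    convert e1 using 1
    · norm_num
    · rw [hlμ]; push_cast
      linear_combination (p * u) * (-hp14)
  · obtain ⟨j, rfl⟩ := Nat.exists_eq_add_of_le' hk3
    have hτ : (τ + σ) % 8 = 0 := by
      have h1 := congrArg (Int.cast : ℤ → ZMod 8) rel
      have hx4 := zm 8 (a := x) (c := 1) (by omega)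
      push_cast at h1 hx4
      rw [hx4, pow_add, show (2 : ZMod 8) ^ 3 = 0 by decide] at h1
      have e : ∀ t s : ZMod 8, -3 * 1 ^ 3 * t + 5 * 1 ^ 3 * s = 0 → t + s = 0 := by decide
      exact zr 8 (a := τ + σ) (c := 0) (by push_cast; exact e _ _ (by linear_combination h1))
    obtain ⟨m, hm⟩ : ∃ m : ℕ, σ % 2 ^ 3 = m := ⟨(σ % 2 ^ 3).toNat, by omega⟩
    have hm2 : m = 1 ∨ m = 3 ∨ m = 5 ∨ m = 7 := by omega
    have key : ∀ (z0 t0 u : L) (q : ℕ), Zt (7 * (j + 3 : ℕ) - 6) z0 t0 → D (14 * (j + 3 : ℕ) - 7) (z0 - 2 ^ j * 4 * p * 6561 * u) → E q (u - ((5 * m : ℕ) : ℤ) * μ) →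
        q < 20 + 7 * j → (15 + q) % 7 = 2 ∨ (15 + q) % 7 = 4 ∨ (15 + q) % 7 = 6 → q ≤ 22 → False := by
      intro z0 t0 u q h1 h2 F hq hq7 hq22
      have e1 := ((E_npow 15).mul F).addD (h2.div (E_two.pow j)) (by push_cast; omega)
      refine final hl j (5 * m) (z := z0) (t := t0) (e := z0 / 2 ^ j - (5 * m : ℕ) * l) (n := 15 + q) (by convert h1 using 1; push_cast; ring) (by field_simp; ring) ?_ (by omega) (by omega)
      convert e1 using 1
      · norm_num
      · rw [hlμ]; push_cast
        field_simp
        linear_combination (p * u * 2 ^ j) * (-hp14)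
    rcases Nat.eq_zero_or_pos j with rfl | hj
    · obtain ⟨z0, t0, u, h1, h2, h3⟩ := finA (H := 4) h 20 m 4 _ (by omega) (Or.inr (Or.inl ⟨rfl, rfl, rfl⟩)) (Ap_mod 3 x 1 (by omega)) (Ap_mod 3 σ m hm)
        (Ap_tau 3 hm hτ) (Ap_mod 3 _ 0 (by norm_num)) (Ap_n 4) (by push_cast; norm_num) _ (by norm_num) EK
      have F := E_ap (h3.sub ((Ap_i (5 * m : ℕ)).mul (hμ.mono (by norm_num)))) 17 (by norm_num) (by rcases hm2 with rfl | rfl | rfl | rfl <;> decide +kernel)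
      exact key z0 t0 u 17 h1 (by convert h2 using 1; ring) F (by norm_num) (by norm_num) (by norm_num)
    · obtain ⟨i, rfl⟩ := Nat.exists_eq_add_of_le' hj
      obtain ⟨z0, t0, u, h1, h2, h3⟩ := finA (H := ((2 ^ (i + 3) : ℤ) : L)) h 20 m 0 _ (by omega) (Or.inr (Or.inr ⟨rfl, rfl, rfl⟩)) (Ap_mod 3 x 1 (by omega)) (Ap_mod 3 σ m hm)
        (Ap_tau 3 hm hτ) (Ap_mod 3 _ 0 (by rw [show i + 1 + 3 = i + 1 + 3 from rfl, pow_add]; simp)) (Ap_mod 3 _ 0 (by rw [pow_add]; simp)) (by push_cast; ring) _ (by omega) EK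
      have F := E_ap (h3.sub ((Ap_i (5 * m : ℕ)).mul (hμ.mono (by norm_num)))) 15 (by norm_num) (by rcases hm2 with rfl | rfl | rfl | rfl <;> decide +kernel)
      exact key z0 t0 u 15 h1 (by convert h2 using 1; push_cast; ring) F (by omega) (by norm_num) (by norm_num)

theorem scale {w : ℤ} (h : w % 2 = 1) : ∃ t : ℤ, t % 2 = 1 ∧ (t * w) % 1024 = 1 := by
  have : IsCoprime w (2 ^ 10) := by
    apply IsCoprime.pow_right
    exact ⟨1, -(w / 2), by omega⟩
  obtain ⟨a, b, hab⟩ := this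
  refine ⟨a, ?_, by omega⟩
  rcases Int.emod_two_eq_zero_or_one a with ha | ha
  · obtain ⟨c, rfl⟩ := Int.dvd_of_emod_eq_zero ha
    rw [mul_assoc] at hab
    omega
  · exact ha

/-- all nontrivial points have `z = -x` -/
theorem main {x y z : ℤ} (h : 3 * x ^ 3 * y + 2 * y ^ 3 * z + z ^ 3 * x = 0) (hx0 : x ≠ 0) (hy0 : y ≠ 0) (hz0 : z ≠ 0)
    (hodd : x % 2 = 1 ∨ y % 2 = 1 ∨ z % 2 = 1) : x % 2 = 1 ∧ z = -x := by
  rcases Int.emod_two_eq_zero_or_one x with hx | hx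
  · exfalso
    rcases Int.emod_two_eq_zero_or_one z with hz | hz
    · have hy : y % 2 = 1 := by omega
      have hx4 : x % 4 = 0 ∨ x % 4 = 2 := by omega
      rcases hx4 with hx4 | hx4
      · exact caseC2 h hy hx4 hz hx0 hz0
      · obtain ⟨a, rfl⟩ : ∃ a, x = 2 * a := ⟨x / 2, by omega⟩
        obtain ⟨b, rfl⟩ : ∃ b, z = 2 * b := ⟨z / 2, by omega⟩
        have h1 : y ^ 3 * b + 2 * (3 * a ^ 3 * y + 2 * b ^ 3 * a) = 0 := by
          apply mul_left_cancel₀ (show (4 : ℤ) ≠ 0 by norm_num); linear_combination h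
        have hb : b % 2 = 0 := by
          have h2 : (y ^ 3 * b) % 2 = 0 := by omega
          rw [Int.mul_emod, odd_cube hy] at h2
          omega
        obtain ⟨c, rfl⟩ : ∃ c, b = 2 * c := ⟨b / 2, by omega⟩
        obtain ⟨t, ht, hty⟩ := scale hy
        refine caseC1 (x := t * a) (y := t * y) (z := t * c) ?_ hty (by rw [Int.mul_emod, ht]; omega)
        apply mul_left_cancel₀ (show (2 : ℤ) ≠ 0 by norm_num); linear_combination t ^ 4 * h1
    · rcases Int.emod_two_eq_zero_or_one y with hy | hy
      · exact caseB1 h hz hx hy hx0 hy0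
      · obtain ⟨a, rfl⟩ : ∃ a, x = 2 * a := ⟨x / 2, by omega⟩
        obtain ⟨t, ht, htz⟩ := scale hz
        have h1 : 12 * (t * a) ^ 3 * (t * y) + (t * y) ^ 3 * (t * z) + (t * a) * (t * z) ^ 3 = 0 := by
          apply mul_left_cancel₀ (show (2 : ℤ) ≠ 0 by norm_num); linear_combination t ^ 4 * h
        have hty : (t * y) % 2 = 1 := by rw [Int.mul_emod, ht, hy]; rfl
        have : (t * y) % 4 = 1 ∨ (t * y) % 4 = 3 := by omega
        rcases this with h4 | h4
        · exact caseB2 h1 htz h4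
        · exact caseB3 h1 htz h4
  · refine ⟨hx, ?_⟩
    obtain ⟨t, ht, htx⟩ := scale hx
    have ht0 : t ≠ 0 := by rintro rfl; norm_num at ht
    have h1 : 3 * (t * x) ^ 3 * (t * y) + 2 * (t * y) ^ 3 * (t * z) + (t * z) ^ 3 * (t * x) = 0 := by
      linear_combination t ^ 4 * h
    have hz4 : (t * z) % 4 = 0 ∨ (t * z) % 4 = 1 ∨ (t * z) % 4 = 2 ∨ (t * z) % 4 = 3 := by omega
    rcases hz4 with h4 | h4 | h4 | h4
    · exact (caseA1 h1 htx h4 (mul_ne_zero ht0 hz0)).elim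
    · exact (caseA3 h1 htx h4).elim
    · exact (caseA2 h1 htx h4).elim
    · by_contra hc
      refine caseA4 h1 htx h4 ?_
      rw [← mul_add]
      exact mul_ne_zero ht0 (fun h => hc (by omega))

end C3
end

/-- The only rational points on `C₃ : 3x³y + 2y³z + z³x = 0` are
`(1:0:0)`, `(0:1:0)`, `(0:0:1)`, `(1:1:-1)`. -/
theorem rational_points_C3 (x y z : ℤ)
    (hcop : Int.gcd x (Int.gcd y z : ℤ) = 1) (hnz : ¬ (x = 0 ∧ y = 0 ∧ z = 0))
    (h : 3 * x ^ 3 * y + 2 * y ^ 3 * z + z ^ 3 * x = 0) :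
    (x, y, z) = (1, 0, 0) ∨ (x, y, z) = (-1, 0, 0) ∨
    (x, y, z) = (0, 1, 0) ∨ (x, y, z) = (0, -1, 0) ∨
    (x, y, z) = (0, 0, 1) ∨ (x, y, z) = (0, 0, -1) ∨
    (x, y, z) = (1, 1, -1) ∨ (x, y, z) = (-1, -1, 1) := by
  simp only [Prod.mk.injEq]
  have hdvd : ∀ d : ℤ, d ∣ x → d ∣ y → d ∣ z → d ∣ 1 := by
    intro d h1 h2 h3
    have : d ∣ ((Int.gcd x (Int.gcd y z : ℤ) : ℕ) : ℤ) := Int.dvd_coe_gcd h1 (Int.dvd_coe_gcd h2 h3)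
    rw [hcop] at this
    simpa using this
  have hu : ∀ d : ℤ, d ∣ x → d ∣ y → d ∣ z → d = 1 ∨ d = -1 := fun d h1 h2 h3 => Int.isUnit_iff.mp (isUnit_of_dvd_one (hdvd d h1 h2 h3))
  by_cases hx0 : x = 0
  · subst hx0
    have h1 : y ^ 3 * z = 0 := by
      apply mul_left_cancel₀ (show (2 : ℤ) ≠ 0 by norm_num); linear_combination h
    rcases mul_eq_zero.mp h1 with h1 | h1
    · have : y = 0 := by simpa using h1
      subst this
      have := hu z (dvd_zero _) (dvd_zero _) dvd_rfl
      omega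
    · subst h1
      have := hu y (dvd_zero _) dvd_rfl (dvd_zero _)
      omega
  by_cases hy0 : y = 0
  · subst hy0
    have h1 : z ^ 3 * x = 0 := by linear_combination h
    rcases mul_eq_zero.mp h1 with h1 | h1
    · have : z = 0 := by simpa using h1
      subst this
      have := hu x dvd_rfl (dvd_zero _) (dvd_zero _)
      omega
    · exact absurd h1 hx0
  by_cases hz0 : z = 0
  · subst hz0
    have h1 : 3 * x ^ 3 * y = 0 := by linear_combination h
    simp [hx0, hy0] at h1
  have hodd : x % 2 = 1 ∨ y % 2 = 1 ∨ z % 2 = 1 := by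
    by_contra hc
    have := hu 2 (by omega) (by omega) (by omega)
    omega
  obtain ⟨hx, rfl⟩ := C3.main h hx0 hy0 hz0 hodd
  have h1 : (y - x) * (2 * (y ^ 2 + x * y) - x * x) = 0 := by
    apply mul_left_cancel₀ hx0; linear_combination -h
  rcases mul_eq_zero.mp h1 with h1 | h1
  · obtain rfl : y = x := by linarith
    have := hu y dvd_rfl dvd_rfl (by simp)
    clear h h1 hdvd hcop hu hodd
    rcases this with rfl | rfl <;> simp
  · exfalso
    have h2 : (x * x) % 2 = 1 := by rw [Int.mul_emod, hx]; rfl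
    clear h hdvd hcop hu hodd hnz
    generalize y ^ 2 + x * y = A at h1
    generalize x * x = B at h1 h2
    omega
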